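/- Let EP be a minimum-order non-4-colorable maximal planar graph, and let a–b–c–d–a be any 4-cycle in EP. Then either ac or bd is an edge of EP, and exactly one of them is; consequently the 4-cycle bounds a region containing no vertices in one side (the four vertices induce a single diamond). -/

import Mathlib

open SimpleGraph

/-- A simple graph is planar if it admits a straight-line drawing in the plane
(by Fáry's theorem this is equivalent to topological planarity for simple graphs):
an injective placement of the vertices such that two distinct edges, drawn as
closed segments, meet only in common endpoints. -/
def IsPlanar {V : Type} (G : SimpleGraph V) : Prop :=
  ∃ pos : V → ℝ × ℝ, Function.Injective pos ∧
    ∀ u v x y : V, G.Adj u v → G.Adj x y → s(u, v) ≠ s(x, y) →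
      ∀ p : ℝ × ℝ, p ∈ segment ℝ (pos u) (pos v) → p ∈ segment ℝ (pos x) (pos y) →
        (p = pos u ∨ p = pos v) ∧ (p = pos x ∨ p = pos y)

/-- A maximal planar graph (planar triangulation): planar, and no edge between
two non-adjacent vertices can be added while preserving planarity. -/
def IsMaximalPlanar {V : Type} [Fintype V] (G : SimpleGraph V) : Prop :=
  IsPlanar G ∧ ∀ u v : V, u ≠ v → ¬ G.Adj u v →
    ¬ IsPlanar (G ⊔ SimpleGraph.fromEdgeSet {s(u, v)})

/-- A minimum-order counterexample to the Four Color Theorem: a maximal planar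
graph that is not 4-colorable, of minimum number of vertices among all such graphs. -/
def IsMinCounterexample {V : Type} [Fintype V] (G : SimpleGraph V) : Prop :=
  IsMaximalPlanar G ∧ ¬ G.Colorable 4 ∧
    ∀ (W : Type) [Fintype W] (H : SimpleGraph W),
      IsMaximalPlanar H → ¬ H.Colorable 4 → Fintype.card V ≤ Fintype.card W



/-- orientation determinant -/
def oo (p q r : ℝ × ℝ) : ℝ :=
  (q.1 - p.1) * (r.2 - p.2) - (q.2 - p.2) * (r.1 - p.1)

lemma mem_seg {p a b : ℝ × ℝ} (h : p ∈ segment ℝ a b) :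
    ∃ t : ℝ, 0 ≤ t ∧ t ≤ 1 ∧ p.1 = (1 - t) * a.1 + t * b.1 ∧ p.2 = (1 - t) * a.2 + t * b.2 := by
  obtain ⟨s, t, hs, ht, hst, rfl⟩ := h
  refine ⟨t, ht, by linarith, ?_, ?_⟩ <;> simp <;> left <;> linarith

lemma seg_mem {p a b : ℝ × ℝ} (t : ℝ) (h0 : 0 ≤ t) (h1 : t ≤ 1)
    (hx : p.1 = (1 - t) * a.1 + t * b.1) (hy : p.2 = (1 - t) * a.2 + t * b.2) :
    p ∈ segment ℝ a b := by
  refine ⟨1 - t, t, by linarith, h0, by ring, ?_⟩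
  ext <;> simp [hx, hy]

lemma draw_exists_y {U : Type} [Fintype U] [DecidableEq U] (x t : U → ℝ)
    (ht : Function.Injective t) :
    ∃ y : U → ℝ, ∀ u v w, t u < t w → t v < t w → x u < x v →
      0 < oo (x u, y u) (x v, y v) (x w, y w) := by
  have key : ∀ s : Finset U, ∃ y : U → ℝ, ∀ u ∈ s, ∀ v ∈ s, ∀ w ∈ s,
      t u < t w → t v < t w → x u < x v →
      0 < oo (x u, y u) (x v, y v) (x w, y w) := by
    intro s
    induction s using Finset.induction_on_max_value t with
    | empty => exact ⟨fun _ => 0, by simp⟩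
    | insert a s ha hmax ih =>
      obtain ⟨y, hy⟩ := ih
      have hM : ∃ M : ℝ, ∀ u ∈ s, ∀ v ∈ s,
          y u + (y v - y u) * (x a - x u) / (x v - x u) < M := by
        have hfin := ((s ×ˢ s).image (fun q : U × U =>
          y q.1 + (y q.2 - y q.1) * (x a - x q.1) / (x q.2 - x q.1))).finite_toSet.bddAbove
        obtain ⟨M, hM⟩ := hfin
        refine ⟨M + 1, fun u hu v hv => ?_⟩
        have := hM (Finset.mem_coe.2 (Finset.mem_image.2 ⟨(u, v), Finset.mem_product.2 ⟨hu, hv⟩, rfl⟩))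
        simp only at this
        linarith
      obtain ⟨M, hM⟩ := hM
      refine ⟨Function.update y a M, ?_⟩
      intro u hu v hv w hw huw hvw hx
      have hlt : ∀ z ∈ insert a s, t z < t w → z ≠ a ∧ z ∈ s := by
        intro z hz hzw
        have : z ≠ a := by
          rintro rfl
          rcases Finset.mem_insert.1 hw with rfl | hw
          · exact lt_irrefl _ hzw
          · exact absurd (hmax w hw) (not_le.2 hzw)
        exact ⟨this, (Finset.mem_insert.1 hz).resolve_left this⟩
      obtain ⟨hua, hus⟩ := hlt u hu huw
      obtain ⟨hva, hvs⟩ := hlt v hv hvw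
      rcases Finset.mem_insert.1 hw with rfl | hws
      · rw [Function.update_of_ne hua, Function.update_of_ne hva, Function.update_self]
        have h1 := hM u hus v hvs
        have hpos : 0 < x v - x u := by linarith
        have h2 : (y v - y u) * (x w - x u) / (x v - x u) < M - y u := by linarith
        rw [div_lt_iff₀ hpos] at h2
        simp only [oo]; nlinarith
      · have hwa : w ≠ a := by rintro rfl; exact ha hws
        rw [Function.update_of_ne hua, Function.update_of_ne hva, Function.update_of_ne hwa]
        exact hy u hus v hvs w hws huw hvw hx
  obtain ⟨y, hy⟩ := key Finset.univ
  exact ⟨y, fun u v w => hy u (Finset.mem_univ _) v (Finset.mem_univ _) w (Finset.mem_univ _)⟩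

lemma oo_aff {m M u w p : ℝ × ℝ} {t : ℝ} (hx : p.1 = (1 - t) * u.1 + t * w.1)
    (hy : p.2 = (1 - t) * u.2 + t * w.2) :
    oo m M p = (1 - t) * oo m M u + t * oo m M w := by
  simp only [oo, hx, hy]; ring

lemma oo_seg {m M p : ℝ × ℝ} (h : p ∈ segment ℝ m M) : oo m M p = 0 := by
  obtain ⟨t, _, _, hx, hy⟩ := mem_seg h
  simp only [oo, hx, hy]; ring

lemma seg_zero {p a b : ℝ × ℝ} (hx : p.1 = (1 - 0) * a.1 + 0 * b.1)
    (hy : p.2 = (1 - 0) * a.2 + 0 * b.2) : p = a := by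
  ext <;> simp [hx, hy]

/-- case of later vertex -/
lemma draw_case1 {u w m M p : ℝ × ℝ} (hmM : m.1 < M.1)
    (hw : 0 < oo m M w)
    (h1 : u.1 < m.1 → 0 < oo u m w ∧ 0 < oo u M w)
    (h2 : M.1 < u.1 → 0 < oo m u w ∧ 0 < oo M u w)
    (hu : u = m ∨ u = M ∨ 0 < oo m M u ∨ u.1 < m.1 ∨ M.1 < u.1)
    (hp : p ∈ segment ℝ u w) (hp' : p ∈ segment ℝ m M) : p = u ∧ (u = m ∨ u = M) := by
  have h0 := oo_seg hp'
  obtain ⟨a, ha0, ha1, hax, hay⟩ := mem_seg hp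
  obtain ⟨b, hb0, hb1, hbx, hby⟩ := mem_seg hp'
  have hA := oo_aff (m := m) (M := M) hax hay
  have hz : oo m M u = 0 → p = u := by
    intro hz
    rw [h0, hz] at hA
    have : a = 0 := by
      have : a * oo m M w = 0 := by linarith
      rcases mul_eq_zero.1 this with h | h
      · exact h
      · linarith
    subst this
    exact seg_zero hax hay
  rcases hu with rfl | rfl | h | h | h
  · exact ⟨hz (by simp [oo]), Or.inl rfl⟩
  · exact ⟨hz (by simp [oo]; ring), Or.inr rfl⟩
  · exfalso
    rw [h0] at hA
    rcases eq_or_lt_of_le ha0 with h' | h'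
    · subst h'; linarith
    · have := mul_pos h' hw
      have := mul_nonneg (by linarith : 0 ≤ 1 - a) h.le
      linarith
  · exfalso
    obtain ⟨k1, k2⟩ := h1 h
    have hpx : u.1 < p.1 := by nlinarith
    have ha : 0 < a := by
      rcases eq_or_lt_of_le ha0 with h' | h'
      · subst h'; linarith
      · exact h'
    have e1 : a * oo u m w = b * oo u m M := by
      have i1 := oo_aff (m := u) (M := m) hax hay
      have i2 := oo_aff (m := u) (M := m) hbx hby
      have : oo u m u = 0 := by simp [oo]
      have : oo u m m = 0 := by simp [oo]; ring
      simp only [*] at *; linarith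
    have e2 : a * oo u M w = -(1 - b) * oo u m M := by
      have i1 := oo_aff (m := u) (M := M) hax hay
      have i2 := oo_aff (m := u) (M := M) hbx hby
      have : oo u M u = 0 := by simp [oo]
      have : oo u M M = 0 := by simp [oo]; ring
      have : oo u M m = - oo u m M := by simp [oo]; ring
      simp only [*] at *; linarith
    have := mul_pos ha k1
    have := mul_pos ha k2
    have : 0 < oo u m M := by
      by_contra hc
      nlinarith
    nlinarith
  · exfalso
    obtain ⟨k1, k2⟩ := h2 h
    have hpx : p.1 < u.1 := by nlinarith
    have ha : 0 < a := by
      rcases eq_or_lt_of_le ha0 with h' | h'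
      · subst h'; linarith
      · exact h'
    have e1 : a * oo m u w = - b * oo u m M := by
      have i1 := oo_aff (m := m) (M := u) hax hay
      have i2 := oo_aff (m := m) (M := u) hbx hby
      have : oo m u u = 0 := by simp [oo]; ring
      have : oo m u m = 0 := by simp [oo]
      have : oo m u M = - oo u m M := by simp [oo]; ring
      simp only [*] at *; linarith
    have e2 : a * oo M u w = (1 - b) * oo u m M := by
      have i1 := oo_aff (m := M) (M := u) hax hay
      have i2 := oo_aff (m := M) (M := u) hbx hby
      have : oo M u u = 0 := by simp [oo]; ring
      have : oo M u M = 0 := by simp [oo]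
      have : oo M u m = oo u m M := by simp [oo]; ring
      simp only [*] at *; linarith
    have := mul_pos ha k1
    have := mul_pos ha k2
    have : 0 < oo u m M := by
      by_contra hc
      nlinarith
    nlinarith

lemma draw_case2 {u s w p : ℝ × ℝ} (hx : u.1 ≠ s.1) (hw : oo u s w ≠ 0)
    (hp : p ∈ segment ℝ u w) (hp' : p ∈ segment ℝ s w) : p = w := by
  obtain ⟨a, ha0, ha1, hax, hay⟩ := mem_seg hp
  obtain ⟨b, hb0, hb1, hbx, hby⟩ := mem_seg hp'
  have i1 := oo_aff (m := u) (M := s) hax hay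
  have i2 := oo_aff (m := u) (M := s) hbx hby
  have j1 : oo u s u = 0 := by simp [oo]
  have j2 : oo u s s = 0 := by simp [oo]; ring
  have hab : a = b := by
    have : (a - b) * oo u s w = 0 := by rw [j1] at i1; rw [j2] at i2; linarith
    rcases mul_eq_zero.1 this with h | h
    · linarith
    · exact absurd h hw
  subst hab
  have : (1 - a) * (u.1 - s.1) = 0 := by linarith
  rcases mul_eq_zero.1 this with h | h
  · have : a = 1 := by linarith
    subst this
    ext <;> simp [hax, hay]
  · exact absurd (by linarith) hx

theorem draw {U : Type} [Fintype U] (H : SimpleGraph U) (x t : U → ℝ)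
    (hx : Function.Injective x) (ht : Function.Injective t)
    (hC : ∀ u v w, H.Adj u w → t u < t v → t v < t w → ∀ s s',
      (s = v ∨ (H.Adj v s ∧ t s < t v)) → (s' = v ∨ (H.Adj v s' ∧ t s' < t v)) →
      ¬ (x s < x u ∧ x u < x s')) : IsPlanar H := by
  classical
  obtain ⟨y, hy⟩ := draw_exists_y x t ht
  have main : ∀ u w s v, H.Adj u w → H.Adj s v → t u < t w → t s < t v → s(u, w) ≠ s(s, v) →
      t v ≤ t w → ∀ p, p ∈ segment ℝ (x u, y u) (x w, y w) → p ∈ segment ℝ (x s, y s) (x v, y v) →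
      (p = (x u, y u) ∨ p = (x w, y w)) ∧ (p = (x s, y s) ∨ p = (x v, y v)) := by
    intro u w s v huw hsv h1 h2 hne hvw p hp hp'
    rcases eq_or_lt_of_le hvw with h | h
    · have : v = w := ht h
      subst this
      have hus : u ≠ s := by rintro rfl; exact hne rfl
      have := draw_case2 (u := (x u, y u)) (s := (x s, y s)) (hx.ne hus) (by
        rcases lt_or_gt_of_ne (hx.ne hus) with h3 | h3
        · exact (hy _ _ _ h1 h2 h3).ne'
        · have := hy _ _ _ h2 h1 h3
          intro hc
          simp only [oo] at this hc
          linarith) hp hp'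
      exact ⟨Or.inr this, Or.inr this⟩
    · have gen : ∀ m M, ((m = s ∧ M = v) ∨ (m = v ∧ M = s)) → x m < x M →
          p ∈ segment ℝ (x m, y m) (x M, y M) →
          p = (x u, y u) ∧ ((x u, y u) = (x m, y m) ∨ (x u, y u) = (x M, y M)) := by
        intro m M hmM hlt hpm
        have tm : t m < t w := by rcases hmM with ⟨rfl, rfl⟩ | ⟨rfl, rfl⟩ <;> linarith
        have tM : t M < t w := by rcases hmM with ⟨rfl, rfl⟩ | ⟨rfl, rfl⟩ <;> linarith
        refine draw_case1 (m := (x m, y m)) (M := (x M, y M)) hlt (hy _ _ _ tm tM hlt)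
          (fun h => ⟨hy _ _ _ h1 tm h, hy _ _ _ h1 tM (lt_trans h hlt)⟩)
          (fun h => ⟨hy _ _ _ tm h1 (lt_trans hlt h), hy _ _ _ tM h1 h⟩) ?_ hp hpm
        by_cases e1 : u = m
        · exact Or.inl (by rw [e1])
        by_cases e2 : u = M
        · exact Or.inr (Or.inl (by rw [e2]))
        right; right
        have nv : u ≠ v := by rcases hmM with ⟨rfl, rfl⟩ | ⟨rfl, rfl⟩ <;> assumption
        rcases lt_or_gt_of_ne (ht.ne nv) with h3 | h3
        · right
          have hm' : m = v ∨ (H.Adj v m ∧ t m < t v) := by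
            rcases hmM with ⟨rfl, rfl⟩ | ⟨rfl, rfl⟩
            · exact Or.inr ⟨hsv.symm, h2⟩
            · exact Or.inl rfl
          have hM' : M = v ∨ (H.Adj v M ∧ t M < t v) := by
            rcases hmM with ⟨rfl, rfl⟩ | ⟨rfl, rfl⟩
            · exact Or.inl rfl
            · exact Or.inr ⟨hsv.symm, h2⟩
          have := hC u v w huw h3 h m M hm' hM'
          rcases lt_or_gt_of_ne (hx.ne e1) with h4 | h4
          · exact Or.inl h4
          · rcases lt_or_gt_of_ne (hx.ne e2) with h5 | h5
            · exact absurd ⟨h4, h5⟩ this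
            · exact Or.inr h5
        · left
          refine hy _ _ _ ?_ ?_ hlt <;> rcases hmM with ⟨rfl, rfl⟩ | ⟨rfl, rfl⟩ <;> linarith
      rcases lt_or_gt_of_ne (hx.ne (ht.ne_iff.1 h2.ne)) with h3 | h3
      · obtain ⟨q1, q2⟩ := gen s v (Or.inl ⟨rfl, rfl⟩) h3 hp'
        exact ⟨Or.inl q1, by rw [q1]; exact q2⟩
      · obtain ⟨q1, q2⟩ := gen v s (Or.inr ⟨rfl, rfl⟩) h3 (by rwa [segment_symm])
        exact ⟨Or.inl q1, by rw [q1]; exact q2.symm⟩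
  refine ⟨fun u => (x u, y u), fun u v h => hx (Prod.ext_iff.1 h).1, ?_⟩
  have main2 : ∀ u w s v, H.Adj u w → H.Adj s v → t u < t w → t s < t v → s(u, w) ≠ s(s, v) →
      ∀ p, p ∈ segment ℝ (x u, y u) (x w, y w) → p ∈ segment ℝ (x s, y s) (x v, y v) →
      (p = (x u, y u) ∨ p = (x w, y w)) ∧ (p = (x s, y s) ∨ p = (x v, y v)) := by
    intro u w s v a1 a2 h1 h2 hne p hp hp'
    rcases le_total (t v) (t w) with h | h
    · exact main u w s v a1 a2 h1 h2 hne h p hp hp'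
    · exact (main s v u w a2 a1 h2 h1 hne.symm h p hp' hp).symm
  have main3 : ∀ u w s v, H.Adj u w → H.Adj s v → t u < t w → s(u, w) ≠ s(s, v) →
      ∀ p, p ∈ segment ℝ (x u, y u) (x w, y w) → p ∈ segment ℝ (x s, y s) (x v, y v) →
      (p = (x u, y u) ∨ p = (x w, y w)) ∧ (p = (x s, y s) ∨ p = (x v, y v)) := by
    intro u w s v a1 a2 h1 hne p hp hp'
    rcases lt_or_gt_of_ne (ht.ne a2.ne) with h | h
    · exact main2 u w s v a1 a2 h1 h hne p hp hp'
    · obtain ⟨q1, q2⟩ := main2 u w v s a1 a2.symm h1 h (by rwa [Sym2.eq_swap (a := v)]) p hp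
        (by rwa [segment_symm])
      exact ⟨q1, q2.symm⟩
  intro u w s v a1 a2 hne p hp hp'
  rcases lt_or_gt_of_ne (ht.ne a1.ne) with h | h
  · exact main3 u w s v a1 a2 h hne p hp hp'
  · obtain ⟨q1, q2⟩ := main3 w u s v a1.symm a2 h (by rwa [Sym2.eq_swap (a := w)]) p
        (by rwa [segment_symm]) hp'
    exact ⟨q1.symm, q2⟩


set_option linter.unusedSectionVars false
set_option linter.unusedVariables false

section sphere
variable {X : Type} [Fintype X] [DecidableEq X]

def bd (F : Finset (Finset X)) (B : Finset X → ZMod 2) (u v : X) : ZMod 2 :=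
  if u = v then 0 else ∑ f ∈ F with (u ∈ f ∧ v ∈ f), B f

def ed (F : Finset (Finset X)) (u v : X) : Prop := u ≠ v ∧ ∃ f ∈ F, u ∈ f ∧ v ∈ f

structure Sph (F : Finset (Finset X)) : Prop where
  card3 : ∀ f ∈ F, f.card = 3
  two : ∀ u v, ed F u v → (F.filter (fun f => u ∈ f ∧ v ∈ f)).card = 2
  link : ∀ v (B : Finset X → ZMod 2), (∀ u, bd F B v u = 0) →
    ∀ f ∈ F, ∀ g ∈ F, v ∈ f → v ∈ g → B f = B g
  h1 : ∀ z : X → X → ZMod 2, (∀ u v, z u v = z v u) → (∀ u v, z u v ≠ 0 → ed F u v) →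
    (∀ v, ∑ u, z v u = 0) → ∃ B, bd F B = z
  conn : ∀ B : Finset X → ZMod 2, bd F B = 0 → ∀ f ∈ F, ∀ g ∈ F, B f = B g

def eg (p q u v : X) : ZMod 2 := if (u = p ∧ v = q) ∨ (u = q ∧ v = p) then 1 else 0

def ch : List X → X → X → ZMod 2
  | [] => 0
  | [_] => 0
  | a :: b :: l => eg a b + ch (b :: l)

def pe : List X → X → X → Prop
  | [], _, _ => False
  | [_], _, _ => False
  | a :: b :: l, u, v => ((u = a ∧ v = b) ∨ (u = b ∧ v = a)) ∨ pe (b :: l) u v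

lemma zt (a : ZMod 2) : a = 0 ∨ a = 1 := by revert a; decide

lemma ed_symm {F : Finset (Finset X)} {u v : X} (h : ed F u v) : ed F v u := by
  obtain ⟨h, f, hf, a, b⟩ := h
  exact ⟨h.symm, f, hf, b, a⟩

lemma bd_symm (F : Finset (Finset X)) (B : Finset X → ZMod 2) (u v : X) :
    bd F B u v = bd F B v u := by
  simp only [bd, eq_comm (a := u), and_comm]

lemma bd_add (F : Finset (Finset X)) (A B : Finset X → ZMod 2) :
    bd F (A + B) = bd F A + bd F B := by
  funext u v
  simp only [bd, Pi.add_apply]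
  split_ifs <;> simp [Finset.sum_add_distrib]

lemma bd_smul (F : Finset (Finset X)) (c : ZMod 2) (B : Finset X → ZMod 2) :
    bd F (c • B) = c • bd F B := by
  funext u v
  simp only [bd, Pi.smul_apply]
  split_ifs <;> simp [Finset.mul_sum]

lemma bd_not_ed {F : Finset (Finset X)} {B : Finset X → ZMod 2} {u v : X} (h : ¬ ed F u v) :
    bd F B u v = 0 := by
  unfold bd
  split_ifs with h1
  · rfl
  · apply Finset.sum_eq_zero
    intro f hf
    rw [Finset.mem_filter] at hf
    exact absurd ⟨h1, f, hf.1, hf.2⟩ h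

lemma bd_ed {F : Finset (Finset X)} {B : Finset X → ZMod 2} {u v : X} (h : bd F B u v ≠ 0) :
    ed F u v := by
  by_contra hc
  exact h (bd_not_ed hc)

lemma Sph.edge {F : Finset (Finset X)} (hF : Sph F) {u v : X} (h : ed F u v) :
    ∃ f ∈ F, ∃ g ∈ F, f ≠ g ∧ u ∈ f ∧ v ∈ f ∧ u ∈ g ∧ v ∈ g ∧
      (∀ h ∈ F, u ∈ h → v ∈ h → h = f ∨ h = g) ∧ ∀ B, bd F B u v = B f + B g := by
  have h2 := hF.two u v h
  obtain ⟨f, g, hfg, heq⟩ := Finset.card_eq_two.1 h2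
  have hm : ∀ k, k ∈ F ∧ u ∈ k ∧ v ∈ k ↔ k = f ∨ k = g := by
    intro k
    have := Finset.ext_iff.1 heq k
    simpa using this
  obtain ⟨a1, a2, a3⟩ := (hm f).2 (Or.inl rfl)
  obtain ⟨b1, b2, b3⟩ := (hm g).2 (Or.inr rfl)
  refine ⟨f, a1, g, b1, hfg, a2, a3, b2, b3, fun k hk h1 h2 => (hm k).1 ⟨hk, h1, h2⟩, ?_⟩
  intro B
  simp only [bd, if_neg h.1, heq]
  rw [Finset.sum_pair hfg]

lemma bd_even {F : Finset (Finset X)} (h3 : ∀ f ∈ F, f.card = 3) (B : Finset X → ZMod 2) (v : X) :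
    ∑ u, bd F B v u = 0 := by
  have : ∀ u, bd F B v u = ∑ f ∈ F, if (v ≠ u ∧ v ∈ f ∧ u ∈ f) then B f else 0 := by
    intro u
    unfold bd
    split_ifs with h
    · subst h; simp
    · rw [Finset.sum_filter]
      simp [h]
  simp_rw [this]
  rw [Finset.sum_comm]
  apply Finset.sum_eq_zero
  intro f hf
  by_cases hv : v ∈ f
  · rw [← Finset.sum_filter, Finset.sum_const]
    have : (Finset.univ.filter (fun u => v ≠ u ∧ v ∈ f ∧ u ∈ f)) = f.erase v := by
      ext u; simp [hv, eq_comm]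
    rw [this, Finset.card_erase_of_mem hv, h3 f hf]
    generalize B f = b
    revert b; decide
  · simp [hv]

lemma eg_symm (p q u v : X) : eg p q u v = eg p q v u := by
  unfold eg
  congr 1
  apply propext; tauto

lemma eg_swap (p q : X) : eg p q = eg q p := by
  funext u v
  unfold eg
  congr 1
  apply propext; tauto

lemma ch_symm (L : List X) (u v : X) : ch L u v = ch L v u := by
  induction L with
  | nil => rfl
  | cons a l ih =>
    cases l with
    | nil => rfl
    | cons b l => simp only [ch, Pi.add_apply]; rw [ih, eg_symm]

lemma ch_not_pe {L : List X} {u v : X} (h : ¬ pe L u v) : ch L u v = 0 := by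
  induction L with
  | nil => rfl
  | cons a l ih =>
    cases l with
    | nil => rfl
    | cons b l =>
      simp only [pe, not_or] at h
      simp only [ch, Pi.add_apply, ih h.2, add_zero]
      unfold eg
      rw [if_neg]
      tauto

lemma pe_mem {L : List X} {u v : X} (h : pe L u v) : u ∈ L ∧ v ∈ L := by
  induction L with
  | nil => exact h.elim
  | cons a l ih =>
    cases l with
    | nil => exact h.elim
    | cons b l =>
      rcases h with (⟨rfl, rfl⟩ | ⟨rfl, rfl⟩) | h
      · simp
      · simp
      · exact ⟨List.mem_cons_of_mem _ (ih h).1, List.mem_cons_of_mem _ (ih h).2⟩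

lemma ch_append (l : List X) (a : X) (m : List X) :
    ch (l ++ a :: m) = ch (l ++ [a]) + ch (a :: m) := by
  induction l with
  | nil => simp [ch]
  | cons b l ih =>
    cases l with
    | nil => simp [ch]
    | cons c l => simp only [List.cons_append, ch] at ih ⊢; rw [ih, add_assoc]

lemma pe_append (l : List X) (a : X) (m : List X) (u v : X) :
    pe (l ++ a :: m) u v ↔ pe (l ++ [a]) u v ∨ pe (a :: m) u v := by
  induction l with
  | nil => simp [pe]
  | cons b l ih =>
    cases l with
    | nil => simp [pe]
    | cons c l => simp only [List.cons_append, pe] at ih ⊢; rw [ih, ← or_assoc]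

lemma eg_sum {p q : X} (h : p ≠ q) (v : X) :
    ∑ u, eg p q v u = (if v = p then 1 else 0) + (if v = q then 1 else 0) := by
  unfold eg
  by_cases h1 : v = p
  · subst h1
    simp [h]
  · by_cases h2 : v = q
    · subst h2
      simp [h1]
    · simp [h1, h2]

/-- boundary of a walk -/
lemma ch_sum {F : Finset (Finset X)} (a : X) (l : List X)
    (h : ∀ u v, pe (a :: l) u v → ed F u v) (v : X) :
    ∑ u, ch (a :: l) v u = (if v = a then 1 else 0) +
      (if v = (a :: l).getLast (by simp) then 1 else 0) := by
  induction l generalizing a with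
  | nil =>
    simp only [ch, Pi.zero_apply, Finset.sum_const_zero, List.getLast_singleton]
    by_cases h : v = a
    · simp [h]; decide
    · simp [h]
  | cons b l ih =>
    simp only [ch, Pi.add_apply, Finset.sum_add_distrib]
    rw [ih b (fun u v huv => h u v (Or.inr huv)), eg_sum (h a b (Or.inl (Or.inl ⟨rfl, rfl⟩))).1]
    rw [List.getLast_cons (by simp : (b :: l) ≠ [])]
    generalize (if v = b then (1 : ZMod 2) else 0) = x
    generalize (if v = a then (1 : ZMod 2) else 0) = y
    generalize (if v = (b :: l).getLast _ then (1 : ZMod 2) else 0) = z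
    revert x y z; decide

lemma Sph.cyc {F : Finset (Finset X)} (hF : Sph F) (a : X) (l : List X)
    (h : ∀ u v, pe (a :: (l ++ [a])) u v → ed F u v) : ∃ B, bd F B = ch (a :: (l ++ [a])) := by
  apply hF.h1
  · exact fun u v => ch_symm _ u v
  · intro u v huv
    apply h
    by_contra hc
    exact huv (ch_not_pe hc)
  · intro v
    rw [ch_sum a _ h]
    have : (a :: (l ++ [a])).getLast (by simp) = a := by
      rw [List.getLast_cons (by simp)]; simp
    rw [this]
    split_ifs <;> decide

lemma path_support (L : List X) (hL : L.Nodup) (w : X → X → ZMod 2)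
    (hs : ∀ u v, w u v = w v u) (he : ∀ v, ∑ u, w v u = 0)
    (hw : ∀ u v, w u v ≠ 0 → pe L u v) : w = 0 := by
  induction L with
  | nil =>
    funext u v
    by_contra hc
    exact hw u v hc
  | cons a l ih =>
    cases l with
    | nil =>
      funext u v
      by_contra hc
      exact hw u v hc
    | cons b l =>
      have ha : a ∉ b :: l := (List.nodup_cons.1 hL).1
      apply ih (List.nodup_cons.1 hL).2
      have h0 : w a b = 0 := by
        rw [← he a]
        symm
        apply Finset.sum_eq_single_of_mem b (Finset.mem_univ _)
        intro c _ hcb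
        by_contra hc
        rcases hw a c hc with (⟨_, h⟩ | ⟨h, _⟩) | h
        · exact hcb h
        · exact ha (by simp [h])
        · exact ha (pe_mem h).1
      intro u v huv
      rcases hw u v huv with (⟨rfl, rfl⟩ | ⟨rfl, rfl⟩) | h
      · exact absurd h0 huv
      · exact absurd (hs _ _ ▸ h0) huv
      · exact h

lemma cycle_support (a b : X) (l : List X) (hl : l ≠ []) (hL : (a :: b :: l).Nodup)
    {F : Finset (Finset X)} (h : ∀ u v, pe (a :: (b :: l ++ [a])) u v → ed F u v)
    (w : X → X → ZMod 2)
    (hs : ∀ u v, w u v = w v u) (he : ∀ v, ∑ u, w v u = 0)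
    (hw : ∀ u v, w u v ≠ 0 → pe (a :: (b :: l ++ [a])) u v) :
    ∃ c : ZMod 2, w = c • ch (a :: (b :: l ++ [a])) := by
  refine ⟨w a b, ?_⟩
  have hnd : (b :: l ++ [a]).Nodup := by
    have : (b :: l ++ [a]).Perm (a :: b :: l) := List.perm_append_singleton a (b :: l)
    exact this.nodup_iff.2 hL
  have hpe : ¬ pe (b :: l ++ [a]) a b := by
    cases l with
    | nil => exact absurd rfl hl
    | cons c l =>
      have hb : b ∉ c :: l ++ [a] := (List.nodup_cons.1 hnd).1
      rintro ((⟨h1, h2⟩ | ⟨h1, h2⟩) | h)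
      · exact hb (by simp [h1.symm])
      · simp [h1] at hL
      · exact hb (pe_mem h).2
  have hab : ch (a :: (b :: l ++ [a])) a b = 1 := by
    have := ch_not_pe hpe
    simp only [List.cons_append, ch, Pi.add_apply] at this ⊢
    rw [this]
    simp [eg]
  have key : w + w a b • ch (a :: (b :: l ++ [a])) = 0 := by
    apply path_support _ hnd
    · intro u v
      simp only [Pi.add_apply, Pi.smul_apply]
      rw [hs, ch_symm]
    · intro v
      simp only [Pi.add_apply, Pi.smul_apply, Finset.sum_add_distrib, he, ← Finset.smul_sum]
      rw [ch_sum (F := F) a _ h]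
      have : (a :: (b :: l ++ [a])).getLast (by simp) = a := by
        rw [List.getLast_cons (by simp)]; simp
      rw [this]
      generalize w a b = x
      split_ifs <;> revert x <;> decide
    · intro u v huv
      have h1 : pe (a :: (b :: l ++ [a])) u v := by
        by_contra hc
        apply huv
        have h1 := ch_not_pe hc
        have h2 : w u v = 0 := by
          by_contra h2
          exact hc (hw u v h2)
        simp only [Pi.add_apply, Pi.smul_apply, h1, h2, smul_zero, add_zero]
      rcases h1 with (⟨rfl, rfl⟩ | ⟨rfl, rfl⟩) | h1
      · exfalso
        apply huv
        simp only [Pi.add_apply, Pi.smul_apply]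
        rw [hab]
        generalize w u v = x
        revert x; decide
      · exfalso
        apply huv
        simp only [Pi.add_apply, Pi.smul_apply]
        rw [ch_symm, hab, hs]
        generalize w v u = x
        revert x; decide
      · exact h1
  funext u v
  have := congrFun (congrFun key u) v
  simp only [Pi.add_apply, Pi.smul_apply, Pi.zero_apply] at this ⊢
  generalize w u v = x at *
  generalize w a b • ch (a :: (b :: l ++ [a])) u v = y at *
  revert x y; decide

lemma Sph.K {F : Finset (Finset X)} (hF : Sph F) (a b : X) (l : List X) (hl : l ≠ [])
    (hL : (a :: b :: l).Nodup)
    (S D : Finset X → ZMod 2) (hS : bd F S = ch (a :: (b :: l ++ [a])))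
    (h : ∀ u v, pe (a :: (b :: l ++ [a])) u v → ed F u v)
    (hD : ∀ u v, bd F D u v ≠ 0 → pe (a :: (b :: l ++ [a])) u v ∨
      ∃ f ∈ F, u ∈ f ∧ v ∈ f ∧ S f = 1) : ∃ k, ∀ f ∈ F, S f = 0 → D f = k := by
  obtain ⟨c, hc⟩ := cycle_support a b l hl hL h (bd F (D * (S + 1))) (bd_symm _ _)
    (bd_even hF.card3 _) (by
      intro u v huv
      by_contra hp
      have hSe := ch_not_pe hp
      rw [← hS] at hSe
      obtain ⟨f, hf, g, hg, hfg, uf, vf, ug, vg, hall, hB⟩ := hF.edge (bd_ed huv)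
      have hD' : bd F D u v ≠ 0 → ∃ f ∈ F, u ∈ f ∧ v ∈ f ∧ S f = 1 :=
        fun h => (hD u v h).resolve_left hp
      have h3 : bd F D u v ≠ 0 → S f = 1 ∨ S g = 1 := by
        intro h
        obtain ⟨k, hk, uk, vk, hk1⟩ := hD' h
        rcases hall k hk uk vk with rfl | rfl
        · exact Or.inl hk1
        · exact Or.inr hk1
      rw [hB] at hSe huv h3
      simp only [Pi.mul_apply, Pi.add_apply, Pi.one_apply] at huv
      generalize S f = x at *
      generalize S g = y at *
      generalize D f = z at *
      generalize D g = t at *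
      revert x y z t; decide)
  have h0 : bd F (D * (S + 1) + c • S) = 0 := by
    rw [bd_add, bd_smul, hc, hS]
    funext u v
    simp only [Pi.add_apply, Pi.smul_apply, Pi.zero_apply]
    exact CharTwo.add_self_eq_zero _
  have h1 := hF.conn _ h0
  by_cases hne : ∃ f ∈ F, S f = 0
  · obtain ⟨f0, hf0, hS0⟩ := hne
    refine ⟨D f0, fun f hf hSf => ?_⟩
    have := h1 f hf f0 hf0
    simpa [hSf, hS0] using this
  · refine ⟨0, fun f hf h => absurd ⟨f, hf, h⟩ hne⟩

end sphere


section gs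
variable {X : Type} [Fintype X] [DecidableEq X]

def Dn (E : X → X → Prop) (t : X → ℝ) (v s : X) : Prop := s = v ∨ (E v s ∧ t s < t v)

structure GS (W : X → Prop) (E : X → X → Prop) (L : List X) (p0 z : X) (x t : X → ℝ) : Prop where
  xinj : ∀ u v, W u → W v → x u = x v → u = v
  tinj : ∀ u v, W u → W v → t u = t v → u = v
  C : ∀ u v w s s', W u → W v → W w → E u w → t u < t v → t v < t w → Dn E t v s → Dn E t v s' →
    ¬ (x s < x u ∧ x u < x s')
  sorted : L.Pairwise (fun a b => x a < x b)
  lo : ∀ v, W v → x p0 ≤ x v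
  hi : ∀ v, W v → x v ≤ x z
  unc : ∀ p ∈ L, ∀ v, W v → t p < t v → ∀ s s', Dn E t v s → Dn E t v s' →
    ¬ (x s < x p ∧ x p < x s')
  e0 : ∀ v, W v → v ≠ p0 → v ≠ z → t p0 < t v
  ez : ∀ v, W v → v ≠ p0 → v ≠ z → t z < t v

lemma avoid_real (A : Finset ℝ) {a b : ℝ} (h : a < b) : ∃ c, a < c ∧ c < b ∧ c ∉ A := by
  have : (Set.Ioo a b \ (A : Set ℝ)).Nonempty :=
    ((Set.Ioo_infinite h).sdiff A.finite_toSet).nonempty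
  obtain ⟨c, ⟨h1, h2⟩, h3⟩ := this
  exact ⟨c, h1, h2, h3⟩

lemma gs_addlast {W W' : X → Prop} {E E' : X → X → Prop} {p0 p1 p2 z : X} {r : List X}
    {x' t' : X → ℝ} (g : GS W' E' (p0 :: p2 :: r) p0 z x' t')
    (hp1 : ¬ W' p1) (hL : ∀ p ∈ p0 :: p2 :: r, W' p) (hz : z ∈ p0 :: p2 :: r)
    (hW : ∀ v, W v → W' v ∨ v = p1)
    (hE' : ∀ u w, E' u w → W' u ∧ W' w)
    (hE : ∀ u w, E u w → E' u w ∨ (u = p1 ∧ (w = p0 ∨ w = p2)) ∨ (w = p1 ∧ (u = p0 ∨ u = p2))) :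
    ∃ x t, GS W E (p0 :: p1 :: p2 :: r) p0 z x t ∧ ∀ v, W v → v ≠ p1 → t v < t p1 := by
  have hw0 : W' p0 := hL p0 (by simp)
  have hw2 : W' p2 := hL p2 (by simp)
  have hwz : W' z := hL z hz
  have hlt : x' p0 < x' p2 := by
    have := g.sorted
    simp only [List.pairwise_cons] at this
    exact this.1 p2 (by simp)
  obtain ⟨ξ, h1, h2, h3⟩ := avoid_real (Finset.univ.image x') hlt
  obtain ⟨M, hM⟩ := (Finset.univ.image t').finite_toSet.bddAbove
  have hne : ∀ v, W' v → v ≠ p1 := fun v hv h => hp1 (h ▸ hv)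
  have hx : ∀ v, W' v → Function.update x' p1 ξ v = x' v := fun v hv => by
    rw [Function.update_of_ne (hne v hv)]
  have ht : ∀ v, W' v → Function.update t' p1 (M + 1) v = t' v := fun v hv => by
    rw [Function.update_of_ne (hne v hv)]
  have hξ : ∀ v, x' v ≠ ξ := fun v h => h3 (by simp only [Finset.mem_image]; exact ⟨v, Finset.mem_univ _, h⟩)
  have hMM : ∀ v, t' v < M + 1 := fun v => by
    have : t' v ≤ M := hM (by simp)
    linarith
  set x := Function.update x' p1 ξ with hxd
  set t := Function.update t' p1 (M + 1) with htd
  have hx1 : x p1 = ξ := Function.update_self ..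
  have ht1 : t p1 = M + 1 := Function.update_self ..
  have hlast : ∀ v, W v → v ≠ p1 → t v < t p1 := by
    intro v hv hvp
    rw [ht1, ht v ((hW v hv).resolve_right hvp)]
    exact hMM v
  have hlast' : ∀ v, W' v → t v < t p1 := by
    intro v hv
    rw [ht1, ht v hv]
    exact hMM v
  have hEE : ∀ u w, W' u → W' w → E u w → E' u w := by
    intro u w hu hw h
    rcases hE u w h with h | h | h
    · exact h
    · exact absurd h.1 (hne u hu)
    · exact absurd h.1 (hne w hw)
  have hD : ∀ v s, W' v → Dn E t v s → Dn E' t' v s ∧ W' s := by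
    intro v s hv h
    rcases h with rfl | ⟨h, h'⟩
    · exact ⟨Or.inl rfl, hv⟩
    · have hs : s ≠ p1 := by
        rintro rfl
        exact absurd (hlast' v hv) (by linarith)
      have h4 : E' v s := by
        rcases hE v s h with h | h | h
        · exact h
        · exact absurd h.1 (hne v hv)
        · exact absurd h.1 hs
      have hs' := (hE' _ _ h4).2
      rw [ht v hv, ht s hs'] at h'
      exact ⟨Or.inr ⟨h4, h'⟩, hs'⟩
  have hD1 : ∀ s, Dn E t p1 s → s = p1 ∨ s = p0 ∨ s = p2 := by
    rintro s (rfl | ⟨h, h'⟩)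
    · exact Or.inl rfl
    · rcases hE _ _ h with h | h | h
      · exact absurd (hE' _ _ h).1 hp1
      · exact Or.inr h.2
      · exact Or.inl h.1
  refine ⟨x, t, ⟨?_, ?_, ?_, ?_, ?_, ?_, ?_, ?_, ?_⟩, hlast⟩
  · intro u v hu hv h
    rcases hW u hu with hu | rfl <;> rcases hW v hv with hv | rfl
    · rw [hx u hu, hx v hv] at h; exact g.xinj u v hu hv h
    · rw [hx u hu, hx1] at h; exact absurd h (hξ u)
    · rw [hx v hv, hx1] at h; exact absurd h.symm (hξ v)
    · rfl
  · intro u v hu hv h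
    rcases hW u hu with hu | rfl <;> rcases hW v hv with hv | rfl
    · rw [ht u hu, ht v hv] at h; exact g.tinj u v hu hv h
    · exact absurd h (hlast' u hu).ne
    · exact absurd h.symm (hlast' v hv).ne
    · rfl
  · intro u v w s s' hu hv hw huw h1 h2 hs hs'
    have hv1 : v ≠ p1 := by
      rintro rfl
      rcases hW w hw with hw | rfl
      · linarith [hlast' w hw]
      · exact lt_irrefl _ h2
    have hu1 : u ≠ p1 := by
      rintro rfl
      linarith [hlast v hv hv1]
    have hu' := (hW u hu).resolve_right hu1
    have hv' := (hW v hv).resolve_right hv1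
    obtain ⟨ds, ws⟩ := hD v s hv' hs
    obtain ⟨ds', ws'⟩ := hD v s' hv' hs'
    rw [hx s ws, hx s' ws', hx u hu']
    rw [ht u hu', ht v hv'] at h1
    rcases hW w hw with hw' | rfl
    · rw [ht v hv', ht w hw'] at h2
      exact g.C u v w s s' hu' hv' hw' (hEE u w hu' hw' huw) h1 h2 ds ds'
    · have : u = p0 ∨ u = p2 := by
        rcases hE _ _ huw with h | h | h
        · exact absurd (hE' _ _ h).2 hp1
        · exact absurd h.1 hu1
        · exact h.2
      refine g.unc u ?_ v hv' h1 s s' ds ds'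
      rcases this with rfl | rfl <;> simp
  · have hs := g.sorted
    have hmono : (p0 :: p2 :: r).Pairwise (fun a b => x a < x b) := by
      refine hs.imp_of_mem ?_
      intro a b ha hb hab
      rw [hx a (hL a ha), hx b (hL b hb)]; exact hab
    simp only [List.pairwise_cons] at hmono ⊢
    obtain ⟨m1, m2, m3⟩ := hmono
    have e0 : x p0 < x p1 := by rw [hx p0 hw0, hx1]; exact h1
    have e2 : x p1 < x p2 := by rw [hx p2 hw2, hx1]; exact h2
    refine ⟨?_, ?_, m2, m3⟩
    · intro a ha
      rcases List.mem_cons.1 ha with rfl | ha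
      · exact e0
      · exact m1 a ha
    · intro a ha
      rcases List.mem_cons.1 ha with rfl | ha
      · exact e2
      · exact lt_trans e2 (m2 a ha)
  · intro v hv
    rw [hx p0 hw0]
    rcases hW v hv with hv | rfl
    · rw [hx v hv]; exact g.lo v hv
    · rw [hx1]; exact h1.le
  · intro v hv
    rw [hx z hwz]
    rcases hW v hv with hv | rfl
    · rw [hx v hv]; exact g.hi v hv
    · rw [hx1]; exact h2.le.trans (g.hi _ hw2)
  · intro p hp v hv hpv s s' hs hs'
    have hp1' : p ≠ p1 := by
      rintro rfl
      by_cases h : v = p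
      · subst h; exact lt_irrefl _ hpv
      · linarith [hlast v hv h]
    have hpL : p ∈ p0 :: p2 :: r := by
      simp only [List.mem_cons] at hp ⊢; tauto
    have hpW := hL p hpL
    rcases hW v hv with hv' | rfl
    · obtain ⟨ds, ws⟩ := hD v s hv' hs
      obtain ⟨ds', ws'⟩ := hD v s' hv' hs'
      rw [hx s ws, hx s' ws', hx p hpW]
      rw [ht p hpW, ht v hv'] at hpv
      exact g.unc p hpL v hv' hpv s s' ds ds'
    · rintro ⟨k1, k2⟩
      have b1 : x p0 ≤ x s := by
        rcases hD1 s hs with rfl | rfl | rfl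
        · rw [hx p0 hw0, hx1]; exact h1.le
        · exact le_rfl
        · rw [hx _ hw0, hx _ hw2]; exact hlt.le
      have b2 : x s' ≤ x p2 := by
        rcases hD1 s' hs' with rfl | rfl | rfl
        · rw [hx p2 hw2, hx1]; exact h2.le
        · rw [hx _ hw0, hx _ hw2]; exact hlt.le
        · exact le_rfl
      have k3 : x p0 < x p := by linarith
      have k4 : x p < x p2 := by linarith
      rw [hx p0 hw0, hx p hpW] at k3
      rw [hx p2 hw2, hx p hpW] at k4
      have hs := g.sorted
      simp only [List.pairwise_cons] at hs
      simp only [List.mem_cons] at hpL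
      rcases hpL with rfl | rfl | h
      · exact lt_irrefl _ k3
      · exact lt_irrefl _ k4
      · linarith [hs.2.1 p h]
  · intro v hv h h'
    rcases hW v hv with hv' | rfl
    · rw [ht p0 hw0, ht v hv']; exact g.e0 v hv' h h'
    · exact hlast' p0 hw0
  · intro v hv h h'
    rcases hW v hv with hv' | rfl
    · rw [ht z hwz, ht v hv']; exact g.ez v hv' h h'
    · exact hlast' z hwz

lemma gs_addedge {W W' : X → Prop} {E E' : X → X → Prop} {p0 p1 p2 q z : X} {r : List X}
    {x t : X → ℝ} (g : GS W' E' (p0 :: p1 :: q :: p2 :: r) p0 z x t)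
    (hl : ∀ v, W' v → v ≠ p1 → t v < t p1)
    (hW : ∀ v, W v → W' v) (hW' : ∀ p ∈ p0 :: p1 :: q :: p2 :: r, W' p)
    (hq : E' p1 q) (hq1 : q ≠ p1)
    (hE' : ∀ u w, E' u w → W' u ∧ W' w)
    (hE : ∀ u w, E u w → E' u w ∨ (u = p1 ∧ w = p2) ∨ (u = p2 ∧ w = p1)) :
    GS W E (p0 :: p1 :: p2 :: r) p0 z x t := by
  have hsub : (p0 :: p1 :: p2 :: r).Sublist (p0 :: p1 :: q :: p2 :: r) :=
    (((List.Sublist.refl (p2 :: r)).cons q).cons_cons p1).cons_cons p0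
  have hnl : ∀ u v, W' u → W' v → t u < t v → u ≠ p1 := by
    rintro u v hu hv h rfl
    by_cases h' : v = u
    · subst h'; exact lt_irrefl _ h
    · linarith [hl v hv h']
  have hD : ∀ v s, W' v → v ≠ p1 → Dn E t v s → Dn E' t v s := by
    intro v s hv hv1 h
    rcases h with rfl | ⟨h, h'⟩
    · exact Or.inl rfl
    · rcases hE _ _ h with h | h | h
      · exact Or.inr ⟨h, h'⟩
      · exact absurd h.1 hv1
      · exfalso
        rw [h.2] at h'
        linarith [hl v hv hv1]
  have hDq : Dn E' t p1 q := Or.inr ⟨hq, hl q (hE' _ _ hq).2 hq1⟩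
  have hD1 : ∀ s, Dn E t p1 s → Dn E' t p1 s ∨ s = p2 := by
    intro s h
    rcases h with rfl | ⟨h, h'⟩
    · exact Or.inl (Or.inl rfl)
    · rcases hE _ _ h with h | h | h
      · exact Or.inl (Or.inr ⟨h, h'⟩)
      · exact Or.inr h.2
      · exfalso; rw [h.2] at h'; exact lt_irrefl _ h'
  have hs := g.sorted
  simp only [List.pairwise_cons] at hs
  obtain ⟨s0, s1, s2, s3, _⟩ := hs
  refine ⟨fun u v hu hv => g.xinj u v (hW u hu) (hW v hv),
    fun u v hu hv => g.tinj u v (hW u hu) (hW v hv), ?_, g.sorted.sublist hsub,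
    fun v hv => g.lo v (hW v hv), fun v hv => g.hi v (hW v hv), ?_,
    fun v hv => g.e0 v (hW v hv), fun v hv => g.ez v (hW v hv)⟩
  · intro u v w s s' hu hv hw huw h1 h2 hs hs'
    have hv1 := hnl v w (hW v hv) (hW w hw) h2
    have hu1 := hnl u v (hW u hu) (hW v hv) h1
    have ds := hD v s (hW v hv) hv1 hs
    have ds' := hD v s' (hW v hv) hv1 hs'
    rcases hE _ _ huw with h | h | h
    · exact g.C u v w s s' (hW u hu) (hW v hv) (hW w hw) h h1 h2 ds ds'
    · exact absurd h.1 hu1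
    · exact g.unc u (by simp [h.1]) v (hW v hv) h1 s s' ds ds'
  · intro p hp v hv hpv s s' hs hs'
    have hpL : p ∈ p0 :: p1 :: q :: p2 :: r := hsub.subset hp
    by_cases hv1 : v = p1
    · subst hv1
      have u := g.unc p hpL v (hW v hv) hpv
      have hpne : p ≠ v := by rintro rfl; exact lt_irrefl _ hpv
      have hq2 : x q < x p2 := s2 p2 (by simp)
      rintro ⟨k1, k2⟩
      rcases hD1 s hs with ds | rfl <;> rcases hD1 s' hs' with ds' | rfl
      · exact u s s' ds ds' ⟨k1, k2⟩
      · apply u s q ds hDq ⟨k1, ?_⟩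
        simp only [List.mem_cons] at hp
        rcases hp with rfl | rfl | rfl | hp
        · exact s0 q (by simp)
        · exact absurd rfl hpne
        · exact absurd k2 (lt_irrefl _)
        · linarith [s3 p hp]
      · exact u q s' hDq ds' ⟨by linarith, k2⟩
      · linarith
    · exact g.unc p hpL v (hW v hv) hpv s s' (hD v s (hW v hv) hv1 hs) (hD v s' (hW v hv) hv1 hs')

end gs


lemma mono_avoid (A B : Finset ℝ) {a b a' b' : ℝ} (h : a < b) (h' : a' < b') :
    ∃ f : ℝ → ℝ, StrictMonoOn f (Set.Icc a b) ∧ f a = a' ∧ f b = b' ∧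
      ∀ s ∈ A, a < s → s < b → f s ∉ B := by
  obtain ⟨θ, h1, h2, h3⟩ := avoid_real ((A ×ˢ B).image (fun q =>
    (q.2 - a' - (b' - a') * ((q.1 - a) / (b - a))) /
      (((q.1 - a) / (b - a)) * (1 - (q.1 - a) / (b - a))))) (sub_pos.2 h')
  have hab : 0 < b - a := sub_pos.2 h
  refine ⟨fun s => a' + (b' - a') * ((s - a) / (b - a)) +
    θ * (((s - a) / (b - a)) * (1 - (s - a) / (b - a))), ?_, ?_, ?_, ?_⟩
  · intro s hs t ht hst
    have e1 : (s - a) / (b - a) < (t - a) / (b - a) := by gcongr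
    have e2 : 0 ≤ (s - a) / (b - a) := div_nonneg (by linarith [hs.1]) hab.le
    have e3 : (t - a) / (b - a) ≤ 1 := (div_le_one hab).2 (by linarith [ht.2])
    simp only
    generalize (s - a) / (b - a) = l at *
    generalize (t - a) / (b - a) = m at *
    have : 0 < (m - l) * ((b' - a') + θ * (1 - l - m)) := by
      apply mul_pos (by linarith)
      nlinarith
    nlinarith
  · simp
  · simp [div_self hab.ne']
  · intro s hs h4 h5 hB
    apply h3
    rw [Finset.mem_image]
    refine ⟨(s, _), Finset.mem_product.2 ⟨hs, hB⟩, ?_⟩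
    simp only
    have e1 : 0 < (s - a) / (b - a) := div_pos (by linarith) hab
    have e2 : (s - a) / (b - a) < 1 := (div_lt_one hab).2 (by linarith)
    generalize (s - a) / (b - a) = l at *
    have : 0 < l * (1 - l) := mul_pos e1 (by linarith)
    rw [div_eq_iff this.ne']
    ring

section gs
variable {X : Type} [Fintype X] [DecidableEq X]

lemma gs_glue {W W1 W2 : X → Prop} {E E1 E2 : X → X → Prop} {p0 p1 q z : X} {m r : List X}
    {x1 t1 x2 t2 : X → ℝ} (g1 : GS W1 E1 (p1 :: (m ++ [q])) p1 q x1 t1)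
    (g2 : GS W2 E2 (p0 :: p1 :: q :: r) p0 z x2 t2)
    (hW : ∀ v, W v → W1 v ∨ W2 v) (h12 : ∀ v, W1 v → W2 v → v = p1 ∨ v = q)
    (hE : ∀ u w, E u w → E1 u w ∨ E2 u w)
    (hE1 : ∀ u w, E1 u w → W1 u ∧ W1 w) (hE2 : ∀ u w, E2 u w → W2 u ∧ W2 w)
    (hc : E2 p1 q) (hc' : E2 q p1)
    (hL1 : ∀ p ∈ p1 :: (m ++ [q]), W1 p) (hL2 : ∀ p ∈ p0 :: p1 :: q :: r, W2 p)
    (hz : z ∈ p0 :: p1 :: q :: r) :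
    ∃ x t, GS W E (p0 :: p1 :: (m ++ q :: r)) p0 z x t := by
  classical
  have w0 : W2 p0 := hL2 _ (by simp)
  have w1 : W2 p1 := hL2 _ (by simp)
  have wq : W2 q := hL2 _ (by simp)
  have wz : W2 z := hL2 _ hz
  have v1 : W1 p1 := hL1 _ (by simp)
  have vq : W1 q := hL1 _ (by simp)
  have s1 := g1.sorted
  have s2 := g2.sorted
  simp only [List.pairwise_cons] at s1 s2
  have lt1 : x1 p1 < x1 q := s1.1 q (by simp)
  have lt2 : x2 p1 < x2 q := s2.2.1 q (by simp)
  obtain ⟨φ, hφ, hφ1, hφq, hφa⟩ := mono_avoid (Finset.univ.image x1) (Finset.univ.image x2) lt1 lt2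
  obtain ⟨M2, hM2⟩ := (Finset.univ.image t2).finite_toSet.bddAbove
  obtain ⟨M1, hM1⟩ := (Finset.univ.image t1).finite_toSet.bddBelow
  obtain ⟨x, hxd⟩ : ∃ x : X → ℝ, x = fun v => if W2 v then x2 v else φ (x1 v) := ⟨_, rfl⟩
  obtain ⟨t, htd⟩ : ∃ t : X → ℝ, t = fun v => if W2 v then t2 v else t1 v + (M2 - M1 + 1) := ⟨_, rfl⟩
  have hx2 : ∀ v, W2 v → x v = x2 v := fun v hv => by simp [hxd, hv]
  have ht2 : ∀ v, W2 v → t v = t2 v := fun v hv => by simp [htd, hv]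
  have hti : ∀ v, ¬ W2 v → t v = t1 v + (M2 - M1 + 1) := fun v hv => by simp [htd, hv]
  have hx1 : ∀ v, W1 v → x v = φ (x1 v) := by
    intro v hv
    by_cases h : W2 v
    · rw [hx2 v h]
      rcases h12 v hv h with rfl | rfl
      · exact hφ1.symm
      · exact hφq.symm
    · simp [hxd, h]
  have hlate : ∀ u v, W2 u → ¬ W2 v → t u < t v := by
    intro u v hu hv
    rw [ht2 u hu, hti v hv]
    have a1 : t2 u ≤ M2 := hM2 (by simp)
    have a2 : M1 ≤ t1 v := hM1 (by simp)
    linarith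
  have hord : ∀ u v, W1 u → W1 v → ¬ W2 v → t u < t v → t1 u < t1 v := by
    intro u v hu hv hv2 h
    have hv1 : v ≠ p1 := by rintro rfl; exact hv2 w1
    have hvq : v ≠ q := by rintro rfl; exact hv2 wq
    by_cases h2 : W2 u
    · rcases h12 u hu h2 with rfl | rfl
      · exact g1.e0 v hv hv1 hvq
      · exact g1.ez v hv hv1 hvq
    · rw [hti u h2, hti v hv2] at h; linarith
  have hicc : ∀ v, W1 v → x1 v ∈ Set.Icc (x1 p1) (x1 q) := fun v hv => ⟨g1.lo v hv, g1.hi v hv⟩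
  have hxlt : ∀ u v, W1 u → W1 v → (x u < x v ↔ x1 u < x1 v) := by
    intro u v hu hv
    rw [hx1 u hu, hx1 v hv]
    exact hφ.lt_iff_lt (hicc u hu) (hicc v hv)
  have hxle : ∀ u v, W1 u → W1 v → x1 u ≤ x1 v → x u ≤ x v := by
    intro u v hu hv h
    rw [hx1 u hu, hx1 v hv]
    exact (hφ.le_iff_le (hicc u hu) (hicc v hv)).2 h
  have hlo1 : ∀ v, W1 v → x2 p1 ≤ x v := fun v hv => by
    rw [← hx2 p1 w1]; exact hxle p1 v v1 hv (g1.lo v hv)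
  have hhi1 : ∀ v, W1 v → x v ≤ x2 q := fun v hv => by
    rw [← hx2 q wq]; exact hxle v q hv vq (g1.hi v hv)
  have hD2 : ∀ v s, W2 v → Dn E t v s → W2 s ∧ Dn E2 t2 v s := by
    intro v s hv h
    rcases h with rfl | ⟨h, h'⟩
    · exact ⟨hv, Or.inl rfl⟩
    · have hs : W2 s := by
        by_contra hs
        linarith [hlate v s hv hs]
      refine ⟨hs, Or.inr ⟨?_, by rwa [ht2 s hs, ht2 v hv] at h'⟩⟩
      rcases hE _ _ h with h | h
      · obtain ⟨a1, a2⟩ := hE1 _ _ h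
        rcases h12 v a1 hv with rfl | rfl <;> rcases h12 s a2 hs with rfl | rfl
        · exact absurd h' (lt_irrefl _)
        · exact hc
        · exact hc'
        · exact absurd h' (lt_irrefl _)
      · exact h
  have hD1 : ∀ v s, W1 v → ¬ W2 v → Dn E t v s → W1 s ∧ Dn E1 t1 v s := by
    intro v s hv hv2 h
    rcases h with rfl | ⟨h, h'⟩
    · exact ⟨hv, Or.inl rfl⟩
    · rcases hE _ _ h with h | h
      · exact ⟨(hE1 _ _ h).2, Or.inr ⟨h, hord s v (hE1 _ _ h).2 hv hv2 h'⟩⟩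
      · exact absurd (hE2 _ _ h).1 hv2
  have hint : ∀ v, W1 v → ¬ W2 v → ∀ u, x v ≠ x2 u := by
    intro v hv hv2 u h
    have hv1 : v ≠ p1 := by rintro rfl; exact hv2 w1
    have hvq : v ≠ q := by rintro rfl; exact hv2 wq
    rw [hx1 v hv] at h
    refine hφa (x1 v) (by simp) ?_ ?_ (by rw [h]; simp)
    · exact lt_of_le_of_ne (g1.lo v hv) (fun h => hv1 (g1.xinj _ _ hv v1 h.symm))
    · exact lt_of_le_of_ne (g1.hi v hv) (fun h => hvq (g1.xinj _ _ hv vq h))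
  have hWi : ∀ v, W v → W2 v ∨ (W1 v ∧ ¬ W2 v) := by
    intro v hv
    by_cases h : W2 v
    · exact Or.inl h
    · exact Or.inr ⟨(hW v hv).resolve_right h, h⟩
  refine ⟨x, t, ⟨?_, ?_, ?_, ?_, ?_, ?_, ?_, ?_, ?_⟩⟩
  · intro u v hu hv h
    rcases hWi u hu with hu | ⟨hu, hu2⟩ <;> rcases hWi v hv with hv | ⟨hv, hv2⟩
    · rw [hx2 u hu, hx2 v hv] at h; exact g2.xinj u v hu hv h
    · rw [hx2 u hu] at h; exact absurd h.symm (hint v hv hv2 u)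
    · rw [hx2 v hv] at h; exact absurd h (hint u hu hu2 v)
    · rw [hx1 u hu, hx1 v hv] at h
      exact g1.xinj u v hu hv (hφ.injOn (hicc u hu) (hicc v hv) h)
  · intro u v hu hv h
    rcases hWi u hu with hu | ⟨hu, hu2⟩ <;> rcases hWi v hv with hv | ⟨hv, hv2⟩
    · rw [ht2 u hu, ht2 v hv] at h; exact g2.tinj u v hu hv h
    · exact absurd h (hlate u v hu hv2).ne
    · exact absurd h.symm (hlate v u hv hu2).ne
    · rw [hti u hu2, hti v hv2] at h
      exact g1.tinj u v hu hv (by linarith)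
  · intro u v w s s' hu hv hw huw h1 h2 hs hs'
    have early : ∀ a b, t a < t b → W2 b → W2 a := by
      intro a b h hb
      by_contra ha
      linarith [hlate b a hb ha]
    rcases hWi w hw with hw | ⟨hw, hw2⟩
    · have hv2 := early v w h2 hw
      have hu2 := early u v h1 hv2
      obtain ⟨ws, ds⟩ := hD2 v s hv2 hs
      obtain ⟨ws', ds'⟩ := hD2 v s' hv2 hs'
      have huw2 : E2 u w := by
        have : Dn E t w u → E2 u w := fun h => by
          rcases hE _ _ huw with h | h
          · obtain ⟨a1, a2⟩ := hE1 _ _ h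
            rcases h12 u a1 hu2 with rfl | rfl <;> rcases h12 w a2 hw with rfl | rfl
            · exact absurd (h1.trans h2) (lt_irrefl _)
            · exact hc
            · exact hc'
            · exact absurd (h1.trans h2) (lt_irrefl _)
          · exact h
        rcases hE _ _ huw with h | h
        · obtain ⟨a1, a2⟩ := hE1 _ _ h
          rcases h12 u a1 hu2 with rfl | rfl <;> rcases h12 w a2 hw with rfl | rfl
          · exact absurd (h1.trans h2) (lt_irrefl _)
          · exact hc
          · exact hc'
          · exact absurd (h1.trans h2) (lt_irrefl _)
        · exact h
      rw [hx2 s ws, hx2 s' ws', hx2 u hu2]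
      rw [ht2 u hu2, ht2 v hv2] at h1
      rw [ht2 w hw, ht2 v hv2] at h2
      exact g2.C u v w s s' hu2 hv2 hw huw2 h1 h2 ds ds'
    · have huw1 : E1 u w := (hE _ _ huw).resolve_right (fun h => hw2 (hE2 _ _ h).2)
      have hu1 := (hE1 _ _ huw1).1
      rcases hWi v hv with hv | ⟨hv, hv2⟩
      · have hu2 := early u v h1 hv
        obtain ⟨ws, ds⟩ := hD2 v s hv hs
        obtain ⟨ws', ds'⟩ := hD2 v s' hv hs'
        rw [hx2 s ws, hx2 s' ws', hx2 u hu2]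
        rw [ht2 u hu2, ht2 v hv] at h1
        refine g2.unc u ?_ v hv h1 s s' ds ds'
        rcases h12 u hu1 hu2 with rfl | rfl <;> simp
      · obtain ⟨ws, ds⟩ := hD1 v s hv hv2 hs
        obtain ⟨ws', ds'⟩ := hD1 v s' hv hv2 hs'
        rw [hxlt s u ws hu1, hxlt u s' hu1 ws']
        exact g1.C u v w s s' hu1 hv hw huw1 (hord u v hu1 hv hv2 h1) (hord v w hv hw hw2 h2) ds ds'
  · have c1 : (p1 :: (m ++ [q])).Pairwise (fun a b => x a < x b) := by
      refine g1.sorted.imp_of_mem ?_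
      intro a b ha hb hab
      exact (hxlt a b (hL1 a ha) (hL1 b hb)).2 hab
    have c2 : (p0 :: p1 :: q :: r).Pairwise (fun a b => x a < x b) := by
      refine g2.sorted.imp_of_mem ?_
      intro a b ha hb hab
      rw [hx2 a (hL2 a ha), hx2 b (hL2 b hb)]; exact hab
    simp only [List.pairwise_cons, List.pairwise_append] at c1 c2 ⊢
    obtain ⟨a1, a2, a3, a4⟩ := c1
    obtain ⟨b1, b2, b3, b4⟩ := c2
    have hm1 : ∀ a ∈ m, x p1 < x a := fun a ha => a1 a (by simp [ha])
    have hmq : ∀ a ∈ m, x a < x q := fun a ha => a4 a ha q (by simp)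
    have h01 : x p0 < x p1 := b1 p1 (by simp)
    refine ⟨?_, ?_, a2, ⟨b3, b4⟩, ?_⟩
    · intro a ha
      simp only [List.mem_cons, List.mem_append] at ha
      rcases ha with rfl | ha | ha | ha
      · exact h01
      · exact h01.trans (hm1 a ha)
      · exact b1 a (by simp [ha])
      · exact b1 a (by simp [ha])
    · intro a ha
      simp only [List.mem_cons, List.mem_append] at ha
      rcases ha with ha | ha | ha
      · exact hm1 a ha
      · exact b2 a (by simp [ha])
      · exact b2 a (by simp [ha])
    · intro a ha b hb
      simp only [List.mem_cons] at hb
      rcases hb with rfl | hb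
      · exact hmq a ha
      · exact (hmq a ha).trans (b3 b hb)
  · intro v hv
    rw [hx2 p0 w0]
    rcases hWi v hv with hv | ⟨hv, hv2⟩
    · rw [hx2 v hv]; exact g2.lo v hv
    · exact (g2.lo p1 w1).trans (hlo1 v hv)
  · intro v hv
    rw [hx2 z wz]
    rcases hWi v hv with hv | ⟨hv, hv2⟩
    · rw [hx2 v hv]; exact g2.hi v hv
    · exact (hhi1 v hv).trans (g2.hi q wq)
  · intro p hp v hv hpv s s' hs hs'
    have hp' : p ∈ p1 :: (m ++ [q]) ∨ p ∈ p0 :: p1 :: q :: r := by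
      simp only [List.mem_cons, List.mem_append] at hp ⊢
      tauto
    rcases hWi v hv with hv | ⟨hv, hv2⟩
    · have hp2 : W2 p := by
        by_contra h
        linarith [hlate v p hv h]
      have hpL : p ∈ p0 :: p1 :: q :: r := by
        rcases hp' with h | h
        · rcases h12 p (hL1 p h) hp2 with rfl | rfl <;> simp
        · exact h
      obtain ⟨ws, ds⟩ := hD2 v s hv hs
      obtain ⟨ws', ds'⟩ := hD2 v s' hv hs'
      rw [hx2 s ws, hx2 s' ws', hx2 p hp2]
      rw [ht2 p hp2, ht2 v hv] at hpv
      exact g2.unc p hpL v hv hpv s s' ds ds'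
    · obtain ⟨ws, ds⟩ := hD1 v s hv hv2 hs
      obtain ⟨ws', ds'⟩ := hD1 v s' hv hv2 hs'
      have case1 : p ∈ p1 :: (m ++ [q]) → ¬(x s < x p ∧ x p < x s') := by
        intro h
        have hp1 := hL1 p h
        rw [hxlt s p ws hp1, hxlt p s' hp1 ws']
        exact g1.unc p h v hv (hord p v hp1 hv hv2 hpv) s s' ds ds'
      rcases hp' with h | h
      · exact case1 h
      · rintro ⟨k1, k2⟩
        have l1 := hlo1 s ws
        have l2 := hhi1 s' ws'
        rw [hx2 p (hL2 p h)] at k1 k2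
        simp only [List.mem_cons] at h
        rcases h with rfl | rfl | rfl | h
        · linarith [s2.1 p1 (by simp)]
        · linarith
        · linarith
        · linarith [s2.2.2.1 p h]
  · intro v hv h h'
    rcases hWi v hv with hv | ⟨hv, hv2⟩
    · rw [ht2 p0 w0, ht2 v hv]; exact g2.e0 v hv h h'
    · exact hlate p0 v w0 hv2
  · intro v hv h h'
    rcases hWi v hv with hv | ⟨hv, hv2⟩
    · rw [ht2 z wz, ht2 v hv]; exact g2.ez v hv h h'
    · exact hlate z v wz hv2

end gs

set_option linter.unusedSectionVars false
set_option linter.unusedVariables false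

section rec
variable {X : Type} [Fintype X] [DecidableEq X]

def Wd (F : Finset (Finset X)) (S : Finset X → ZMod 2) (L : List X) (v : X) : Prop :=
  v ∈ L ∨ ∃ f ∈ F, S f = 1 ∧ v ∈ f

def EE (F : Finset (Finset X)) (S : Finset X → ZMod 2) (p0 : X) (L : List X) (u v : X) : Prop :=
  (u ≠ v ∧ ∃ f ∈ F, S f = 1 ∧ u ∈ f ∧ v ∈ f) ∨ pe (L ++ [p0]) u v

lemma EE_W {F : Finset (Finset X)} {S : Finset X → ZMod 2} {p0 : X} {l : List X} {u v : X}
    (h : EE F S p0 (p0 :: l) u v) : Wd F S (p0 :: l) u ∧ Wd F S (p0 :: l) v := by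
  rcases h with ⟨_, f, hf, h1, h2, h3⟩ | h
  · exact ⟨Or.inr ⟨f, hf, h1, h2⟩, Or.inr ⟨f, hf, h1, h3⟩⟩
  · have := pe_mem h
    simp only [List.mem_append, List.mem_cons, List.not_mem_nil, or_false] at this
    refine ⟨Or.inl ?_, Or.inl ?_⟩ <;> simp only [List.mem_cons] <;> tauto

lemma pe_symm {L : List X} {u v : X} (h : pe L u v) : pe L v u := by
  induction L with
  | nil => exact h.elim
  | cons a l ih =>
    cases l with
    | nil => exact h.elim
    | cons b l =>
      rcases h with h | h
      · left; tauto
      · exact Or.inr (ih h)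

lemma ch_nodup_pe {L : List X} (hL : L.Nodup) {u v : X} (h : pe L u v) : ch L u v = 1 := by
  induction L with
  | nil => exact h.elim
  | cons a l ih =>
    cases l with
    | nil => exact h.elim
    | cons b l =>
      have ha : a ∉ b :: l := (List.nodup_cons.1 hL).1
      simp only [ch, Pi.add_apply]
      rcases h with h | h
      · have hn : ¬ pe (b :: l) u v := by
          intro h'
          have := pe_mem h'
          rcases h with ⟨rfl, rfl⟩ | ⟨rfl, rfl⟩
          · exact ha this.1
          · exact ha this.2
        rw [ch_not_pe hn]
        simp [eg, h]
      · rw [ih (List.nodup_cons.1 hL).2 h]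
        have := pe_mem h
        have : ¬ ((u = a ∧ v = b) ∨ (u = b ∧ v = a)) := by
          rintro (⟨rfl, rfl⟩ | ⟨rfl, rfl⟩)
          · exact ha this.1
          · exact ha this.2
        simp [eg, this]

lemma ch_closed_pe {a b : X} {l : List X} (hl : l ≠ []) (hL : (a :: b :: l).Nodup) {u v : X}
    (h : pe (a :: (b :: l ++ [a])) u v) : ch (a :: (b :: l ++ [a])) u v = 1 := by
  have hnd : (b :: l ++ [a]).Nodup :=
    (List.perm_append_singleton a (b :: l)).nodup_iff.2 hL
  have hpe : ¬ pe (b :: l ++ [a]) a b := by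
    cases l with
    | nil => exact absurd rfl hl
    | cons c l =>
      have hb : b ∉ c :: l ++ [a] := (List.nodup_cons.1 hnd).1
      rintro ((⟨h1, h2⟩ | ⟨h1, h2⟩) | h)
      · exact hb (by simp [h1.symm])
      · simp [h1] at hL
      · exact hb (pe_mem h).2
  have e : ch (a :: (b :: l ++ [a])) u v = eg a b u v + ch (b :: l ++ [a]) u v := rfl
  rw [e]
  by_cases hab : (u = a ∧ v = b) ∨ (u = b ∧ v = a)
  · have : ¬ pe (b :: l ++ [a]) u v := by
      rcases hab with ⟨rfl, rfl⟩ | ⟨rfl, rfl⟩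
      · exact hpe
      · exact fun h => hpe (pe_symm h)
    rw [ch_not_pe this]
    simp [eg, hab]
  · have : pe (b :: l ++ [a]) u v := h.resolve_left hab
    rw [ch_nodup_pe hnd this]
    simp [eg, hab]

lemma face3 {f : Finset X} (h : f.card = 3) {p q : X} (hp : p ∈ f) (hq : q ∈ f) (hpq : p ≠ q) :
    ∃ r, r ≠ p ∧ r ≠ q ∧ f = {p, q, r} := by
  obtain ⟨a, b, c, h1, h2, h3, rfl⟩ := Finset.card_eq_three.1 h
  simp only [Finset.mem_insert, Finset.mem_singleton] at hp hq
  rcases hp with rfl | rfl | rfl <;> rcases hq with rfl | rfl | rfl <;>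
    first
    | exact absurd rfl hpq
    | exact ⟨_, h2.symm, h3.symm, rfl⟩
    | exact ⟨_, h3.symm, h2.symm, by ext; simp; tauto⟩
    | exact ⟨_, h1.symm, h3, by ext; simp; tauto⟩
    | exact ⟨_, h3, h1.symm, by ext; simp; tauto⟩
    | exact ⟨_, h1, h2, by ext; simp; tauto⟩
    | exact ⟨_, h2, h1, by ext; simp; tauto⟩

lemma bd_single {F : Finset (Finset X)} {f : Finset X} (hf : f ∈ F) {p q r : X} (hpq : p ≠ q)
    (hrp : r ≠ p) (hrq : r ≠ q) (h : f = {p, q, r}) :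
    bd F (Pi.single f 1) = eg p q + eg p r + eg q r := by
  funext u v
  have : bd F (Pi.single f 1) u v = if u ≠ v ∧ u ∈ f ∧ v ∈ f then 1 else 0 := by
    unfold bd
    by_cases huv : u = v
    · simp [huv]
    · simp [huv, Finset.sum_pi_single, hf]
  rw [this, h]
  simp only [Pi.add_apply, eg, Finset.mem_insert, Finset.mem_singleton]
  by_cases u1 : u = p
  · subst u1
    by_cases v1 : v = u
    · simp [v1, hpq, hrp.symm, hrq]
    · by_cases v2 : v = q
      · subst v2; simp [hpq, hrp.symm, hrq.symm, hrp]
      · by_cases v3 : v = r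
        · subst v3; simp [hpq, hrp.symm, hrq, hrp]
        · simp [v1, v2, v3]
  · by_cases u2 : u = q
    · subst u2
      by_cases v1 : v = p
      · subst v1; simp [u1, hrp.symm, hrq.symm]
      · by_cases v2 : v = u
        · simp [v2, u1, hrq.symm]
        · by_cases v3 : v = r
          · subst v3; simp [u1, hrq.symm, hrp, hrq]
          · simp [v1, v2, v3]
    · by_cases u3 : u = r
      · subst u3
        by_cases v1 : v = p
        · subst v1; simp [u1, u2, hpq]
        · by_cases v2 : v = q
          · subst v2; simp [u1, u2, v1]
          · simp [u1, u2, v1, v2, eq_comm]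
      · simp [u1, u2, u3]

def NF (F : Finset (Finset X)) (S : Finset X → ZMod 2) : ℕ := (F.filter (fun f => S f = 1)).card

lemma NF_lt {F : Finset (Finset X)} {S S' : Finset X → ZMod 2}
    (h : ∀ f ∈ F, S' f = 1 → S f = 1) {f : Finset X} (hf : f ∈ F) (h1 : S f = 1) (h0 : S' f = 0) :
    NF F S' < NF F S := by
  apply Finset.card_lt_card
  rw [Finset.ssubset_iff_of_subset]
  · exact ⟨f, by simp [hf, h1], by simp [h0]⟩
  · intro g hg
    simp only [Finset.mem_filter] at hg ⊢
    exact ⟨hg.1, h g hg.1 hg.2⟩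

lemma cyc_face {F : Finset (Finset X)} (hF : Sph F) {S : Finset X → ZMod 2} {a b : X} {l : List X}
    (hl : l ≠ []) (hL : (a :: b :: l).Nodup) (hS : bd F S = ch (a :: (b :: l ++ [a]))) {u v : X}
    (h : pe (a :: (b :: l ++ [a])) u v) :
    ed F u v ∧ ∃ f ∈ F, ∃ g ∈ F, u ∈ f ∧ v ∈ f ∧ u ∈ g ∧ v ∈ g ∧ S f = 1 ∧ S g = 0 ∧
      ∀ k ∈ F, u ∈ k → v ∈ k → k = f ∨ k = g := by
  have h1 := ch_closed_pe hl hL h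
  rw [← hS] at h1
  have he : ed F u v := bd_ed (by rw [h1]; decide)
  obtain ⟨f, hf, g, hg, hfg, uf, vf, ug, vg, hall, hB⟩ := hF.edge he
  rw [hB] at h1
  refine ⟨he, ?_⟩
  rcases zt (S f) with h2 | h2
  · refine ⟨g, hg, f, hf, ug, vg, uf, vf, ?_, h2, fun k hk h h' => (hall k hk h h').symm⟩
    rw [h2] at h1; simpa using h1
  · refine ⟨f, hf, g, hg, uf, vf, ug, vg, h2, ?_, hall⟩
    rw [h2] at h1; revert h1; generalize S g = y; revert y; decide

lemma pe_next {L : List X} {v : X} (h : v ∈ L) (a : X) : ∃ u, pe (L ++ [a]) v u := by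
  induction L with
  | nil => simp at h
  | cons b l ih =>
    rcases List.mem_cons.1 h with rfl | h
    · cases l with
      | nil => exact ⟨a, Or.inl (Or.inl ⟨rfl, rfl⟩)⟩
      | cons c l => exact ⟨c, Or.inl (Or.inl ⟨rfl, rfl⟩)⟩
    · obtain ⟨u, hu⟩ := ih h
      cases l with
      | nil => simp at h
      | cons c l => exact ⟨u, Or.inr hu⟩

lemma cyc_mem_face {F : Finset (Finset X)} (hF : Sph F) {S : Finset X → ZMod 2} {a b : X} {l : List X}
    (hl : l ≠ []) (hL : (a :: b :: l).Nodup) (hS : bd F S = ch (a :: (b :: l ++ [a]))) {v : X}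
    (h : v ∈ a :: b :: l) : (∃ f ∈ F, v ∈ f ∧ S f = 1) ∧ (∃ f ∈ F, v ∈ f ∧ S f = 0) := by
  obtain ⟨u, hu⟩ := pe_next h a
  obtain ⟨_, f, hf, g, hg, h1, h2, h3, h4, h5, h6, _⟩ := cyc_face hF hl hL hS hu
  exact ⟨⟨f, hf, h1, h5⟩, ⟨g, hg, h3, h6⟩⟩

lemma off_const {F : Finset (Finset X)} (hF : Sph F) {S : Finset X → ZMod 2} {a : X} {l : List X}
    (hS : bd F S = ch (a :: (l ++ [a]))) {v : X} (h : v ∉ a :: l) :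
    ∀ f ∈ F, ∀ g ∈ F, v ∈ f → v ∈ g → S f = S g := by
  apply hF.link
  intro u
  rw [hS]
  apply ch_not_pe
  intro hp
  apply h
  have := (pe_mem hp).1
  simp only [List.mem_cons, List.mem_append, List.not_mem_nil, or_false] at this ⊢
  tauto

def GenP (F : Finset (Finset X)) (n : ℕ) : Prop :=
  ∀ (S : Finset X → ZMod 2) (p0 : X) (l : List X) (z : X), NF F S = n →
    bd F S = ch (p0 :: (l ++ [p0])) → (p0 :: l).Nodup → l ≠ [] → (∃ f ∈ F, S f = 0) →
    (p0 :: l).getLast? = some z →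
    ∃ x t, GS (Wd F S (p0 :: l)) (EE F S p0 (p0 :: l)) (p0 :: l) p0 z x t

def LastP (F : Finset (Finset X)) (n : ℕ) : Prop :=
  ∀ (S : Finset X → ZMod 2) (p0 p1 p2 : X) (r : List X) (z : X), NF F S = n →
    bd F S = ch (p0 :: (p1 :: p2 :: r ++ [p0])) → (p0 :: p1 :: p2 :: r).Nodup →
    (∃ f ∈ F, S f = 0) → (p0 :: p1 :: p2 :: r).getLast? = some z →
    (∀ q ∈ r, ∀ f ∈ F, S f = 1 → p1 ∈ f → q ∉ f) →
    ∃ x t, GS (Wd F S (p0 :: p1 :: p2 :: r)) (EE F S p0 (p0 :: p1 :: p2 :: r))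
      (p0 :: p1 :: p2 :: r) p0 z x t ∧ ∀ v, Wd F S (p0 :: p1 :: p2 :: r) v → v ≠ p1 → t v < t p1

lemma zcalc4 : ∀ A B C D : ZMod 2, A + (B + D) + (B + A + C) = C + D := by decide

lemma zcalc5 : ∀ A B C D E : ZMod 2, E + (B + D) + (B + A + C) = E + (A + (C + D)) := by decide

set_option maxHeartbeats 1000000 in
lemma last_step {F : Finset (Finset X)} (hF : Sph F) (n : ℕ) (hG : ∀ m < n, GenP F m)
    (hLa : ∀ m < n, LastP F m) : LastP F n := by
  intro S p0 p1 p2 r z hn hS hnd hf0 hz hch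
  have h12 : p1 ≠ p2 := by rintro rfl; simp at hnd
  have h01 : p0 ≠ p1 := by rintro rfl; simp at hnd
  have h02 : p0 ≠ p2 := by rintro rfl; simp at hnd
  have hpe12 : pe (p0 :: (p1 :: p2 :: r ++ [p0])) p1 p2 := Or.inr (Or.inl (Or.inl ⟨rfl, rfl⟩))
  obtain ⟨he, f, hf, g, hg, a1, a2, a3, a4, a5, a6, a7⟩ :=
    cyc_face hF (by simp) hnd hS hpe12
  obtain ⟨q, q1, q2, hfq⟩ := face3 (hF.card3 f hf) a1 a2 h12
  have hqf : q ∈ f := by rw [hfq]; simp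
  have hqr : q ∉ r := fun h => hch q h f hf a5 a1 hqf
  obtain ⟨S', hS'⟩ : ∃ S' : Finset X → ZMod 2, S' = S + Pi.single f 1 := ⟨_, rfl⟩
  have S'f : S' f = 0 := by rw [hS']; simp [a5]; decide
  have S'g : ∀ k, k ≠ f → S' k = S k := by
    intro k hk; rw [hS']; simp [Pi.single_apply, hk]
  have S'le : ∀ k, S' k = 1 → S k = 1 := by
    intro k hk
    by_cases h : k = f
    · rw [h, a5]
    · rwa [S'g k h] at hk
  have S1 : ∀ k, S k = 1 → k = f ∨ S' k = 1 := by
    intro k hk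
    by_cases h : k = f
    · exact Or.inl h
    · right; rw [S'g k h]; exact hk
  have hNF : NF F S' < n := by rw [← hn]; exact NF_lt (fun k _ => S'le k) hf a5 S'f
  have hbd : bd F S' = ch (p0 :: (p1 :: p2 :: r ++ [p0])) + (eg p1 p2 + eg p1 q + eg p2 q) := by
    rw [hS', bd_add, hS, bd_single hf h12 q1 q2 hfq]
  have f0' : ∃ f ∈ F, S' f = 0 := ⟨f, hf, S'f⟩
  by_cases hq0 : q = p0
  · subst hq0
    have hbd' : bd F S' = ch (q :: (p2 :: r ++ [q])) := by
      rw [hbd]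
      simp only [List.cons_append, ch]
      rw [eg_swap q p1, eg_swap q p2]
      funext u v
      simp only [Pi.add_apply]
      generalize eg p1 q u v = A
      generalize eg p1 p2 u v = B
      generalize eg p2 q u v = C
      generalize ch (p2 :: (r ++ [q])) u v = D
      exact zcalc4 A B C D
    have hnd' : (q :: p2 :: r).Nodup := by
      clear hch hG hLa S1 S'le S'g hS' a7 hn hNF hS hbd f0' hf0 hbd'; simp only [List.nodup_cons, List.mem_cons] at hnd ⊢; tauto
    have hz' : (q :: p2 :: r).getLast? = some z := by
      simpa [List.getLast?_cons_cons] using hz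
    obtain ⟨x', t', hgs⟩ := hG _ hNF S' q (p2 :: r) z rfl hbd' hnd' (by simp) f0' hz'
    have hp1L : p1 ∉ q :: p2 :: r := by
      clear hch hG hLa S1 S'le S'g hS' a7 hn hNF hS hbd f0' hf0 hbd'; simp only [List.nodup_cons, List.mem_cons] at hnd ⊢; tauto
    have hp1f : ∀ k ∈ F, p1 ∈ k → S' k = 0 := by
      intro k hk hk1
      rw [off_const hF hbd' hp1L k hk f hf hk1 a1, S'f]
    refine gs_addlast hgs ?_ (fun p hp => Or.inl hp) (List.mem_of_getLast? hz') ?_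
      (fun u w h => EE_W h) ?_
    · rintro (h | ⟨k, hk, h1, h2⟩)
      · exact hp1L h
      · rw [hp1f k hk h2] at h1; exact absurd h1 (by decide)
    · rintro v (h | ⟨k, hk, h1, h2⟩)
      · clear hch hgs hG hLa S1 S'le S'g hS' a7 hn hNF hS hbd f0' hf0 hbd'
        simp only [Wd, List.mem_cons] at h ⊢; tauto
      · rcases S1 k h1 with rfl | h1
        · rw [hfq] at h2
          clear hch hgs hG hLa S1 S'le S'g hS' a7 hn hNF hS hbd f0' hf0 hbd'
          simp only [Finset.mem_insert, Finset.mem_singleton, Wd, List.mem_cons] at h2 ⊢; tauto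
        · exact Or.inl (Or.inr ⟨k, hk, h1, h2⟩)
    · rintro u w (⟨h, k, hk, h1, h2, h3⟩ | h)
      · rcases S1 k h1 with rfl | h1
        · rw [hfq] at h2 h3
          simp only [Finset.mem_insert, Finset.mem_singleton] at h2 h3
          have e1 : EE F S' q (q :: p2 :: r) q p2 := Or.inr (Or.inl (Or.inl ⟨rfl, rfl⟩))
          have e2 : EE F S' q (q :: p2 :: r) p2 q := Or.inr (Or.inl (Or.inr ⟨rfl, rfl⟩))
          clear hch hgs hG hLa S1 S'le S'g hS' hp1f a7 hn hNF hS hbd hbd' f0' hf0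
          rcases h2 with h2 | h2 | h2 <;> rcases h3 with h3 | h3 | h3
          · exact absurd (h2.trans h3.symm) h
          · exact Or.inr (Or.inl ⟨h2, Or.inr h3⟩)
          · exact Or.inr (Or.inl ⟨h2, Or.inl h3⟩)
          · exact Or.inr (Or.inr ⟨h3, Or.inr h2⟩)
          · exact absurd (h2.trans h3.symm) h
          · left; rw [h2, h3]; exact e2
          · exact Or.inr (Or.inr ⟨h3, Or.inl h2⟩)
          · left; rw [h2, h3]; exact e1
          · exact absurd (h2.trans h3.symm) h
        · exact Or.inl (Or.inl ⟨h, k, hk, h1, h2, h3⟩)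
      · rcases h with h | h | h
        · rcases h with h | h
          · exact Or.inr (Or.inr ⟨h.2, Or.inl h.1⟩)
          · exact Or.inr (Or.inl ⟨h.1, Or.inl h.2⟩)
        · rcases h with h | h
          · exact Or.inr (Or.inl ⟨h.1, Or.inr h.2⟩)
          · exact Or.inr (Or.inr ⟨h.2, Or.inr h.1⟩)
        · exact Or.inl (Or.inr (Or.inr h))
  · have hqL : q ∉ p0 :: p1 :: p2 :: r := by
      simp only [List.mem_cons, not_or]; exact ⟨hq0, q1, q2, hqr⟩
    have hbd' : bd F S' = ch (p0 :: (p1 :: q :: (p2 :: r) ++ [p0])) := by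
      rw [hbd]
      simp only [List.cons_append, ch]
      rw [eg_swap q p2]
      funext u v
      simp only [Pi.add_apply]
      generalize eg p1 q u v = A
      generalize eg p1 p2 u v = B
      generalize eg p2 q u v = C
      generalize ch (p2 :: (r ++ [p0])) u v = D
      generalize eg p0 p1 u v = E
      exact zcalc5 A B C D E
    have hnd' : (p0 :: p1 :: q :: p2 :: r).Nodup := by
      clear hch hG hLa S1 S'le S'g hS' a7 hn hNF hS hbd f0' hf0 hbd'; simp only [List.nodup_cons, List.mem_cons] at hnd hqL ⊢; tauto
    have hz' : (p0 :: p1 :: q :: p2 :: r).getLast? = some z := by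
      simpa [List.getLast?_cons_cons] using hz
    obtain ⟨x, t, hgs, hlast⟩ := hLa _ hNF S' p0 p1 q (p2 :: r) z rfl hbd' hnd' f0' hz' (by
      intro q' hq' k hk hSk h1 h2
      rcases List.mem_cons.1 hq' with rfl | hq'
      · rcases a7 k hk h1 h2 with rfl | rfl
        · rw [S'f] at hSk; exact absurd hSk (by decide)
        · have := S'le _ hSk
          rw [a6] at this; exact absurd this (by decide)
      · exact hch q' hq' k hk (S'le k hSk) h1 h2)
    have hWW : ∀ v, Wd F S (p0 :: p1 :: p2 :: r) v → Wd F S' (p0 :: p1 :: q :: p2 :: r) v := by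
      rintro v (h | ⟨k, hk, h1, h2⟩)
      · clear hch hgs hG hLa S1 S'le S'g hS' a7 hn hNF hS hbd f0' hf0 hbd'
        simp only [Wd, List.mem_cons] at h ⊢; tauto
      · rcases S1 k h1 with rfl | h1
        · rw [hfq] at h2
          clear hch hgs hG hLa S1 S'le S'g hS' a7 hn hNF hS hbd f0' hf0 hbd'
          simp only [Finset.mem_insert, Finset.mem_singleton, Wd, List.mem_cons] at h2 ⊢; tauto
        · exact Or.inr ⟨k, hk, h1, h2⟩
    refine ⟨x, t, gs_addedge (q := q) hgs hlast hWW (fun p hp => Or.inl hp) ?_ q1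
      (fun u w h => EE_W h) ?_, fun v hv => hlast v (hWW v hv)⟩
    · exact Or.inr (Or.inr (Or.inl (Or.inl ⟨rfl, rfl⟩)))
    · rintro u w (⟨h, k, hk, h1, h2, h3⟩ | h)
      · rcases S1 k h1 with rfl | h1
        · rw [hfq] at h2 h3
          simp only [Finset.mem_insert, Finset.mem_singleton] at h2 h3
          have e1 : EE F S' p0 (p0 :: p1 :: q :: p2 :: r) p1 q :=
            Or.inr (Or.inr (Or.inl (Or.inl ⟨rfl, rfl⟩)))
          have e2 : EE F S' p0 (p0 :: p1 :: q :: p2 :: r) q p1 :=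
            Or.inr (Or.inr (Or.inl (Or.inr ⟨rfl, rfl⟩)))
          have e3 : EE F S' p0 (p0 :: p1 :: q :: p2 :: r) q p2 :=
            Or.inr (Or.inr (Or.inr (Or.inl (Or.inl ⟨rfl, rfl⟩))))
          have e4 : EE F S' p0 (p0 :: p1 :: q :: p2 :: r) p2 q :=
            Or.inr (Or.inr (Or.inr (Or.inl (Or.inr ⟨rfl, rfl⟩))))
          rcases h2 with h2 | h2 | h2 <;> rcases h3 with h3 | h3 | h3
          · exact absurd (h2.trans h3.symm) h
          · exact Or.inr (Or.inl ⟨h2, h3⟩)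
          · left; rw [h2, h3]; exact e1
          · exact Or.inr (Or.inr ⟨h2, h3⟩)
          · exact absurd (h2.trans h3.symm) h
          · left; rw [h2, h3]; exact e4
          · left; rw [h2, h3]; exact e2
          · left; rw [h2, h3]; exact e3
          · exact absurd (h2.trans h3.symm) h
        · exact Or.inl (Or.inl ⟨h, k, hk, h1, h2, h3⟩)
      · rcases h with h | h | h
        · exact Or.inl (Or.inr (Or.inl h))
        · exact Or.inr h
        · exact Or.inl (Or.inr (Or.inr (Or.inr (Or.inr h))))

end rec

set_option linter.unusedSectionVars false
set_option linter.unusedVariables false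

section rec
variable {X : Type} [Fintype X] [DecidableEq X]

lemma bd_one {F : Finset (Finset X)} (hF : Sph F) : bd F 1 = 0 := by
  funext u v
  by_cases h : ed F u v
  · obtain ⟨f, hf, g, hg, hfg, uf, vf, ug, vg, hall, hB⟩ := hF.edge h
    rw [hB]; simp; decide
  · exact bd_not_ed h

/-- normalised filling of a cycle -/
lemma Sph.cyc0 {F : Finset (Finset X)} (hF : Sph F) (a : X) (l : List X)
    (h : ∀ u v, pe (a :: (l ++ [a])) u v → ed F u v) (f0 : Finset X) :
    ∃ B, bd F B = ch (a :: (l ++ [a])) ∧ B f0 = 0 := by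
  obtain ⟨B, hB⟩ := hF.cyc a l h
  refine ⟨B + (B f0) • 1, ?_, ?_⟩
  · rw [bd_add, bd_smul, bd_one hF, hB]; simp
  · simp; exact CharTwo.add_self_eq_zero _

lemma gen_base {F : Finset (Finset X)} (hF : Sph F) (S : Finset X → ZMod 2) (a b : X)
    (hS : bd F S = ch (a :: ([b] ++ [a]))) (hab : a ≠ b) (hf0 : ∃ f ∈ F, S f = 0) :
    ∃ x t, GS (Wd F S [a, b]) (EE F S a [a, b]) [a, b] a b x t := by
  have h0 : bd F S = 0 := by
    rw [hS]
    simp only [List.cons_append, List.nil_append, ch]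
    rw [eg_swap b a, add_zero]
    funext u v
    exact CharTwo.add_self_eq_zero _
  obtain ⟨f0, hf, hS0⟩ := hf0
  have hz : ∀ f ∈ F, S f = 0 := fun f hf' => by rw [hF.conn S h0 f hf' f0 hf, hS0]
  have hW : ∀ v, Wd F S [a, b] v → v = a ∨ v = b := by
    rintro v (h | ⟨f, hf, h1, _⟩)
    · simpa using h
    · rw [hz f hf] at h1; exact absurd h1 (by decide)
  have hba : b ≠ a := hab.symm
  refine ⟨fun v => if v = a then 0 else 1, fun v => if v = a then 0 else 1, ?_, ?_, ?_, ?_, ?_, ?_, ?_, ?_, ?_⟩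
  · intro u v hu hv h
    rcases hW u hu with rfl | rfl <;> rcases hW v hv with rfl | rfl <;> simp_all
  · intro u v hu hv h
    rcases hW u hu with rfl | rfl <;> rcases hW v hv with rfl | rfl <;> simp_all
  · intro u v w s s' hu hv hw _ h1 h2
    exfalso
    rcases hW u hu with rfl | rfl <;> rcases hW v hv with rfl | rfl <;>
      rcases hW w hw with rfl | rfl <;> simp_all [lt_irrefl] <;> linarith
  · simp [hba]
  · intro v hv; simp only [if_true]; split_ifs <;> norm_num
  · intro v hv; simp only [if_neg hba]; split_ifs <;> norm_num
  · intro p hp v hv h s s' _ _ h1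
    obtain ⟨h1, h2⟩ := h1
    split_ifs at h1 h2 <;> linarith
  · intro v hv h1 h2
    rcases hW v hv with h | h <;> contradiction
  · intro v hv h1 h2
    rcases hW v hv with h | h <;> contradiction

lemma zc1 : ∀ A B C D E : ZMod 2, A + (B + C) + (B + D) = A + (D + C) := by decide
lemma zle {a s : ZMod 2} (h : a = 1 → s = 1) (h2 : s + a = 1) : s = 1 := by
  revert a s; decide

lemma gen_step {F : Finset (Finset X)} (hF : Sph F) (n : ℕ) (hG : ∀ m < n, GenP F m)
    (hLa : LastP F n) : GenP F n := by
  intro S p0 l z hn hS hnd hl hf0 hz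
  match l, hl with
  | [b], _ =>
    have hb : z = b := by simpa [eq_comm] using hz
    subst hb
    exact gen_base hF S p0 z hS (by rintro rfl; simp at hnd) hf0
  | p1 :: p2 :: r, _ =>
    by_cases hch : ∀ q ∈ r, ∀ f ∈ F, S f = 1 → p1 ∈ f → q ∉ f
    · obtain ⟨x, t, h, _⟩ := hLa S p0 p1 p2 r z hn hS hnd hf0 hz hch
      exact ⟨x, t, h⟩
    · push Not at hch
      obtain ⟨q, hq, f, hf, hSf, h1f, hqf⟩ := hch
      obtain ⟨r1, r2, rfl⟩ := List.append_of_mem hq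
      obtain ⟨f0, hf0F, hSf0⟩ := hf0
      have hq1 : p1 ≠ q := by rintro rfl; simp at hnd
      have hsplit : ∀ u v, pe (p0 :: (p1 :: p2 :: (r1 ++ q :: r2) ++ [p0])) u v ↔
          pe [p0, p1] u v ∨ pe (p1 :: (p2 :: r1 ++ [q])) u v ∨ pe (q :: (r2 ++ [p0])) u v := by
        intro u v
        have e : p0 :: (p1 :: p2 :: (r1 ++ q :: r2) ++ [p0]) =
          (p0 :: p1 :: p2 :: r1) ++ q :: (r2 ++ [p0]) := by simp
        rw [e, pe_append]
        simp [pe, or_assoc]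
      have hsplit1 : ∀ u v, pe (p1 :: ((p2 :: r1 ++ [q]) ++ [p1])) u v ↔
          pe (p1 :: (p2 :: r1 ++ [q])) u v ∨ pe [q, p1] u v := by
        intro u v
        have e : p1 :: ((p2 :: r1 ++ [q]) ++ [p1]) = (p1 :: p2 :: r1) ++ q :: [p1] := by simp
        rw [e, pe_append]
        rfl
      have hped : ∀ u v, pe (p0 :: (p1 :: p2 :: (r1 ++ q :: r2) ++ [p0])) u v → ed F u v :=
        fun u v h => (cyc_face hF (by simp) hnd hS h).1
      have hped1 : ∀ u v, pe (p1 :: ((p2 :: r1 ++ [q]) ++ [p1])) u v → ed F u v := by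
        intro u v h
        rcases (hsplit1 u v).1 h with h | h
        · exact hped u v ((hsplit u v).2 (Or.inr (Or.inl h)))
        · rcases h with (⟨rfl, rfl⟩ | ⟨rfl, rfl⟩) | h
          · exact ⟨hq1.symm, f, hf, hqf, h1f⟩
          · exact ⟨hq1, f, hf, h1f, hqf⟩
          · exact h.elim
      obtain ⟨A, hA, hA0⟩ := hF.cyc0 p1 _ hped1 f0
      have hAS : ∀ k ∈ F, A k = 1 → S k = 1 := by
        obtain ⟨k0, hk0⟩ := hF.K p0 p1 _ (by simp) hnd S A hS hped (by
          intro u v h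
          rw [hA] at h
          have : pe (p1 :: ((p2 :: r1 ++ [q]) ++ [p1])) u v := by
            by_contra hc; exact h (ch_not_pe hc)
          rcases (hsplit1 u v).1 this with h | h
          · exact Or.inl ((hsplit u v).2 (Or.inr (Or.inl h)))
          · right
            rcases h with (⟨rfl, rfl⟩ | ⟨rfl, rfl⟩) | h
            · exact ⟨f, hf, hqf, h1f, hSf⟩
            · exact ⟨f, hf, h1f, hqf, hSf⟩
            · exact h.elim)
        intro k hk hAk
        rcases zt (S k) with h | h
        · have e1 := hk0 k hk h
          have e2 := hk0 f0 hf0F hSf0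
          rw [← e2, hA0, hAk] at e1
          exact absurd e1 (by decide)
        · exact h
      have hS2 : bd F (S + A) = ch (p0 :: (p1 :: q :: r2 ++ [p0])) := by
        rw [bd_add, hS, hA]
        have e1 : p0 :: (p1 :: p2 :: (r1 ++ q :: r2) ++ [p0]) =
          (p0 :: p1 :: p2 :: r1) ++ q :: (r2 ++ [p0]) := by simp
        have e2 : p1 :: ((p2 :: r1 ++ [q]) ++ [p1]) = (p1 :: p2 :: r1) ++ q :: [p1] := by simp
        rw [e1, e2, ch_append, ch_append (p1 :: p2 :: r1)]
        have e3 : ch (p0 :: p1 :: p2 :: r1 ++ [q]) = eg p0 p1 + ch (p1 :: p2 :: r1 ++ [q]) := rfl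
        have e4 : ch (p0 :: (p1 :: q :: r2 ++ [p0])) = eg p0 p1 + (eg p1 q + ch (q :: (r2 ++ [p0]))) := rfl
        have e5 : ch [q, p1] = eg p1 q := by rw [eg_swap]; simp [ch]
        rw [e3, e4, e5]
        funext u v
        simp only [Pi.add_apply]
        generalize eg p0 p1 u v = a
        generalize ch (p1 :: p2 :: r1 ++ [q]) u v = b
        generalize ch (q :: (r2 ++ [p0])) u v = c
        generalize eg p1 q u v = d
        rw [add_assoc a b c]
        exact zc1 a b c d 0
      have hnd1 : (p1 :: (p2 :: (r1 ++ [q]))).Nodup := by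
        refine List.Nodup.sublist ?_ hnd
        refine List.Sublist.cons _ (List.Sublist.cons_cons _ (List.Sublist.cons_cons _ ?_))
        exact List.Sublist.append_left (by simp) _
      have hnd2 : (p0 :: p1 :: q :: r2).Nodup := by
        refine List.Nodup.sublist ?_ hnd
        refine List.Sublist.cons_cons _ (List.Sublist.cons_cons _ (List.Sublist.cons _ ?_))
        exact List.sublist_append_right _ _
      have hS2S : ∀ k ∈ F, (S + A) k = 1 → S k = 1 := fun k hk h => zle (hAS k hk) h
      have hS2A : ∀ k ∈ F, (S + A) k = 1 → A k = 0 := by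
        intro k hk h
        have h1 := hS2S k hk h
        simp only [Pi.add_apply, h1] at h
        simpa using h
      have hAS2 : ∀ k ∈ F, A k = 1 → (S + A) k = 0 := by
        intro k hk h
        simp only [Pi.add_apply, h, hAS k hk h]; decide
      have hz2 : (p0 :: p1 :: q :: r2).getLast? = some z := by
        have e : p0 :: p1 :: p2 :: (r1 ++ q :: r2) = (p0 :: p1 :: p2 :: r1) ++ q :: r2 := rfl
        rw [e, List.getLast?_append_cons] at hz
        simpa [List.getLast?_cons_cons] using hz
      have hF1 : ∀ v ∈ p1 :: (p2 :: (r1 ++ [q])), ∃ f ∈ F, A f = 1 ∧ v ∈ f := by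
        intro v hv
        obtain ⟨⟨k, hk, hk1, hk2⟩, _⟩ := cyc_mem_face hF (by simp) hnd1 hA hv
        exact ⟨k, hk, hk2, hk1⟩
      have hF2 : ∀ v ∈ p0 :: p1 :: q :: r2, ∃ f ∈ F, (S + A) f = 1 ∧ v ∈ f := by
        intro v hv
        obtain ⟨⟨k, hk, hk1, hk2⟩, _⟩ := cyc_mem_face hF (by simp) hnd2 hS2 hv
        exact ⟨k, hk, hk2, hk1⟩
      obtain ⟨ka, hka, ka1, _⟩ := hF1 p1 (by simp)
      obtain ⟨kb, hkb, kb1, _⟩ := hF2 p1 (by simp)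
      obtain ⟨x1, t1, g1⟩ := hG (NF F A) (by
        rw [← hn]; exact NF_lt hAS hkb (hS2S kb hkb kb1) (hS2A kb hkb kb1)) A p1 _ q rfl hA hnd1
        (by simp) ⟨f0, hf0F, hA0⟩ (by
          have e : (p1 :: (p2 :: r1 ++ [q])) = (p1 :: p2 :: r1) ++ [q] := rfl
          rw [e, List.getLast?_append_cons]; rfl)
      obtain ⟨x2, t2, g2⟩ := hG (NF F (S + A)) (by
        rw [← hn]; exact NF_lt hS2S hka (hAS ka hka ka1) (hAS2 ka hka ka1)) (S + A) p0 _ z rfl hS2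
        hnd2 (by simp) ⟨f0, hf0F, by simp [hSf0, hA0]⟩ hz2
      have hW1f : ∀ v, Wd F A (p1 :: (p2 :: (r1 ++ [q]))) v → ∃ f ∈ F, A f = 1 ∧ v ∈ f := by
        rintro v (h | h)
        · exact hF1 v h
        · exact h
      have hW2f : ∀ v, Wd F (S + A) (p0 :: p1 :: q :: r2) v → ∃ f ∈ F, (S + A) f = 1 ∧ v ∈ f := by
        rintro v (h | h)
        · exact hF2 v h
        · exact h
      refine gs_glue (m := p2 :: r1) g1 g2 ?_ ?_ ?_ (fun u w h => EE_W h) (fun u w h => EE_W h) ?_ ?_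
        (fun p hp => Or.inl hp) (fun p hp => Or.inl hp) (List.mem_of_getLast? hz2)
      · rintro v (h | ⟨k, hk, h1, h2⟩)
        · have : v ∈ p1 :: (p2 :: (r1 ++ [q])) ∨ v ∈ p0 :: p1 :: q :: r2 := by
            clear * - h
            simp only [List.mem_cons, List.mem_append] at h ⊢
            tauto
          exact this.imp Or.inl Or.inl
        · rcases zt (A k) with h3 | h3
          · exact Or.inr (Or.inr ⟨k, hk, by simp [h1, h3], h2⟩)
          · exact Or.inl (Or.inr ⟨k, hk, h3, h2⟩)
      · intro v hv1 hv2
        obtain ⟨k1, hk1, a1, b1⟩ := hW1f v hv1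
        obtain ⟨k2, hk2, a2, b2⟩ := hW2f v hv2
        have m1 : v ∈ p1 :: (p2 :: r1 ++ [q]) := by
          by_contra hc
          have := off_const hF hA hc k1 hk1 k2 hk2 b1 b2
          rw [a1, hS2A k2 hk2 a2] at this
          exact absurd this (by decide)
        have m2 : v ∈ p0 :: (p1 :: q :: r2) := by
          by_contra hc
          have := off_const hF hS2 hc k1 hk1 k2 hk2 b1 b2
          rw [a2, hAS2 k1 hk1 a1] at this
          exact absurd this (by decide)
        clear * - m1 m2 hnd
        simp only [List.mem_cons, List.mem_append, List.nodup_cons, List.nodup_append,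
          List.not_mem_nil, or_false] at m1 m2 hnd
        rcases m2 with rfl | rfl | rfl | m2
        · exfalso; tauto
        · exact Or.inl rfl
        · exact Or.inr rfl
        · exfalso
          rcases m1 with rfl | (rfl | m1) | rfl
          · tauto
          · tauto
          · exact hnd.2.2.2.2.2 v m1 v (Or.inr m2) rfl
          · tauto
      · rintro u w (⟨h, k, hk, h1, h2, h3⟩ | h)
        · rcases zt (A k) with h4 | h4
          · exact Or.inr (Or.inl ⟨h, k, hk, by simp [h1, h4], h2, h3⟩)
          · exact Or.inl (Or.inl ⟨h, k, hk, h4, h2, h3⟩)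
        · rcases (hsplit u w).1 h with h | h | h
          · right; right
            rcases h with h | h
            · exact Or.inl h
            · exact h.elim
          · exact Or.inl (Or.inr ((hsplit1 u w).2 (Or.inl h)))
          · exact Or.inr (Or.inr (Or.inr (Or.inr h)))
      · exact Or.inr (Or.inr (Or.inl (Or.inl ⟨rfl, rfl⟩)))
      · exact Or.inr (Or.inr (Or.inl (Or.inr ⟨rfl, rfl⟩)))

lemma gen_all {F : Finset (Finset X)} (hF : Sph F) (n : ℕ) : LastP F n ∧ GenP F n := by
  induction n using Nat.strong_induction_on with
  | _ n ih =>
    have h1 := last_step hF n (fun m hm => (ih m hm).2) (fun m hm => (ih m hm).1)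
    exact ⟨h1, gen_step hF n (fun m hm => (ih m hm).2) h1⟩

/-- planar redrawing of the region bounded by a quadrilateral together with a diagonal -/
lemma redraw {F : Finset (Finset X)} (hF : Sph F) (S : Finset X → ZMod 2) {a b c d : X}
    (hnd : [d, a, b, c].Nodup) (hS : bd F S = ch (d :: ([a, b, c] ++ [d])))
    (hf0 : ∃ f ∈ F, S f = 0) {U : Type} [Fintype U] (i : U → X) (hi : Function.Injective i)
    (hU : ∀ u, ∃ f ∈ F, S f = 1 ∧ i u ∈ f)
    (H : SimpleGraph U)
    (hH : ∀ u v, H.Adj u v → (∃ f ∈ F, S f = 1 ∧ i u ∈ f ∧ i v ∈ f) ∨ (i u = a ∧ i v = c) ∨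
      (i u = c ∧ i v = a)) : IsPlanar H := by
  obtain ⟨f0, hf0⟩ := hf0
  by_cases hch : ∃ f ∈ F, S f = 1 ∧ a ∈ f ∧ c ∈ f
  · obtain ⟨x, t, g⟩ := (gen_all hF (NF F S)).2 S d [a, b, c] c rfl hS hnd (by simp) ⟨f0, hf0⟩ rfl
    have hE : ∀ u v, H.Adj u v → EE F S d [d, a, b, c] (i u) (i v) := by
      intro u v h
      refine Or.inl ⟨hi.ne h.ne, ?_⟩
      rcases hH u v h with h | ⟨h1, h2⟩ | ⟨h1, h2⟩
      · exact h
      · rw [h1, h2]; exact hch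
      · rw [h1, h2]
        obtain ⟨f, hf, h3, h4, h5⟩ := hch
        exact ⟨f, hf, h3, h5, h4⟩
    have hW : ∀ u, Wd F S [d, a, b, c] (i u) := fun u => Or.inr (hU u)
    refine draw H (x ∘ i) (t ∘ i) (fun u v h => hi (g.xinj _ _ (hW u) (hW v) h))
      (fun u v h => hi (g.tinj _ _ (hW u) (hW v) h)) ?_
    intro u v w huw h1 h2 s s' hs hs'
    refine g.C _ _ _ _ _ (hW u) (hW v) (hW w) (hE u w huw) h1 h2 ?_ ?_
    · rcases hs with rfl | hs
      · exact Or.inl rfl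
      · exact Or.inr ⟨hE _ _ hs.1, hs.2⟩
    · rcases hs' with rfl | hs'
      · exact Or.inl rfl
      · exact Or.inr ⟨hE _ _ hs'.1, hs'.2⟩
  · obtain ⟨x, t, g, hlast⟩ := (gen_all hF (NF F S)).1 S d a b [c] c rfl hS hnd ⟨f0, hf0⟩ rfl (by
      intro q hq f hf h1 h2 h3
      have : q = c := by simpa using hq
      subst this
      exact hch ⟨f, hf, h1, h2, h3⟩)
    have hE : ∀ u v, H.Adj u v → EE F S d [d, a, b, c] (i u) (i v) ∨ (i u = a ∧ i v = c) ∨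
      (i u = c ∧ i v = a) := by
      intro u v h
      rcases hH u v h with h' | h'
      · exact Or.inl (Or.inl ⟨hi.ne h.ne, h'⟩)
      · exact Or.inr h'
    have hW : ∀ u, Wd F S [d, a, b, c] (i u) := fun u => Or.inr (hU u)
    have hne : ∀ u v, t (i u) < t (i v) → i u ≠ a := by
      intro u v h hu
      by_cases hv : i v = a
      · rw [hu, hv] at h; exact lt_irrefl _ h
      · have := hlast _ (hW v) hv
        rw [hu] at h; linarith
    refine draw H (x ∘ i) (t ∘ i) (fun u v h => hi (g.xinj _ _ (hW u) (hW v) h))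
      (fun u v h => hi (g.tinj _ _ (hW u) (hW v) h)) ?_
    intro u v w huw h1 h2 s s' hs hs'
    have hD : ∀ s, (s = v ∨ (H.Adj v s ∧ (t ∘ i) s < (t ∘ i) v)) →
        Dn (EE F S d [d, a, b, c]) t (i v) (i s) := by
      rintro s (rfl | ⟨h, h'⟩)
      · exact Or.inl rfl
      · rcases hE _ _ h with h | h | h
        · exact Or.inr ⟨h, h'⟩
        · exact absurd h.1 (hne v w h2)
        · exact absurd h.2 (hne s v h')
    rcases hE u w huw with h | h | h
    · exact g.C _ _ _ _ _ (hW u) (hW v) (hW w) h h1 h2 (hD s hs) (hD s' hs')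
    · exact absurd h.1 (hne u v h1)
    · exact g.unc (i u) (by rw [h.1]; simp) _ (hW v) h1 _ _ (hD s hs) (hD s' hs')

end rec

set_option linter.unusedSectionVars false
set_option linter.unusedVariables false

lemma oo_cyc (a b c : ℝ × ℝ) : oo b c a = oo a b c := by simp only [oo]; ring
lemma oo_swap (a b c : ℝ × ℝ) : oo b a c = - oo a b c := by simp only [oo]; ring
lemma oo_swap' (a b c : ℝ × ℝ) : oo a c b = - oo a b c := by simp only [oo]; ring
lemma oo_sum (a b c p : ℝ × ℝ) : oo a b p + oo b c p + oo c a p = oo a b c := by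
  simp only [oo]; ring

lemma seg_of_bary {A B C k : ℝ × ℝ} (hD : 0 < oo A B C) (h0 : oo B C k = 0)
    (h1 : 0 ≤ oo C A k) (h2 : 0 ≤ oo A B k) : k ∈ segment ℝ B C := by
  have hs := oo_sum A B C k
  have e1 : oo A B C * k.1 = oo B C k * A.1 + oo C A k * B.1 + oo A B k * C.1 := by
    simp only [oo]; ring
  have e2 : oo A B C * k.2 = oo B C k * A.2 + oo C A k * B.2 + oo A B k * C.2 := by
    simp only [oo]; ring
  have h3 : oo C A k = oo A B C - oo A B k := by linarith
  rw [h0, h3] at e1 e2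
  refine seg_mem (oo A B k / oo A B C) (div_nonneg h2 hD.le) ?_ ?_ ?_
  · rw [div_le_one hD]; linarith
  · field_simp; linarith
  · field_simp; linarith

lemma pasch_half {A B C g r : ℝ × ℝ} (hD : 0 < oo A B C) (hg : 0 ≤ oo A B g)
    (hg1 : 0 < oo B C g) (hg2 : 0 < oo C A g) (hr : oo A B g ≤ oo A B r)
    (hb : oo B C r ≤ 0) (hc : 0 < oo C A r ∨ oo B C g * (oo C A g - oo C A r) ≤
      oo C A g * (oo B C g - oo B C r)) :
    ∃ k, k ∈ segment ℝ g r ∧ k ∈ segment ℝ B C := by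
  have hd : 0 < oo B C g - oo B C r := by linarith
  set s := oo B C g / (oo B C g - oo B C r) with hs
  have hsd : s * (oo B C g - oo B C r) = oo B C g := by rw [hs]; field_simp
  have s0 : 0 ≤ s := div_nonneg hg1.le hd.le
  have s1 : s ≤ 1 := by rw [hs, div_le_one hd]; linarith
  obtain ⟨k, hk⟩ : ∃ k : ℝ × ℝ, k = ((1 - s) * g.1 + s * r.1, (1 - s) * g.2 + s * r.2) := ⟨_, rfl⟩
  have kx : k.1 = (1 - s) * g.1 + s * r.1 := by rw [hk]
  have ky : k.2 = (1 - s) * g.2 + s * r.2 := by rw [hk]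
  have a1 := oo_aff (m := A) (M := B) kx ky
  have a2 := oo_aff (m := B) (M := C) kx ky
  have a3 := oo_aff (m := C) (M := A) kx ky
  refine ⟨k, seg_mem s s0 s1 kx ky, seg_of_bary hD ?_ ?_ ?_⟩
  · rw [a2]; linarith
  · rw [a3]
    rcases hc with hc | hc
    · have := mul_nonneg s0 hc.le
      have := mul_nonneg (by linarith : 0 ≤ 1 - s) hg2.le
      linarith
    · have : s * (oo C A g - oo C A r) ≤ oo C A g := by
        rw [hs, div_mul_eq_mul_div, div_le_iff₀ hd]
        exact hc
      linarith
  · rw [a1]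
    have := mul_nonneg s0 (hg.trans hr)
    have := mul_nonneg (by linarith : 0 ≤ 1 - s) hg
    linarith

lemma oo_mirror (a b c : ℝ × ℝ) : oo (-a.1, a.2) (-b.1, b.2) (-c.1, c.2) = - oo a b c := by
  simp only [oo]; ring

lemma mirror_seg {k a b : ℝ × ℝ} (h : k ∈ segment ℝ (-a.1, a.2) (-b.1, b.2)) :
    ((-k.1, k.2) : ℝ × ℝ) ∈ segment ℝ a b := by
  obtain ⟨t, h0, h1, hx, hy⟩ := mem_seg h
  refine seg_mem t h0 h1 ?_ ?_
  · simp only at hx ⊢; rw [hx]; ring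
  · exact hy

lemma pasch {A B C g r : ℝ × ℝ} (hD : 0 < oo A B C) (hg : 0 ≤ oo A B g)
    (hg1 : 0 < oo B C g) (hg2 : 0 < oo C A g) (hr : oo A B g ≤ oo A B r)
    (h1 : ∀ k, k ∈ segment ℝ g r → k ∈ segment ℝ B C → False)
    (h2 : ∀ k, k ∈ segment ℝ g r → k ∈ segment ℝ C A → False) :
    0 < oo B C r ∧ 0 < oo C A r := by
  by_contra hcon
  by_cases hb : oo B C r ≤ 0 ∧ (0 < oo C A r ∨ oo B C g * (oo C A g - oo C A r) ≤
      oo C A g * (oo B C g - oo B C r))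
  · obtain ⟨k, k1, k2⟩ := pasch_half hD hg hg1 hg2 hr hb.1 hb.2
    exact h1 k k1 k2
  · have hc : oo C A r ≤ 0 := by
      by_contra hc
      push Not at hc
      rcases lt_or_ge 0 (oo B C r) with h | h
      · exact hcon ⟨h, hc⟩
      · exact hb ⟨h, Or.inl hc⟩
    have hd : 0 < oo B C r ∨ oo C A g * (oo B C g - oo B C r) ≤
        oo B C g * (oo C A g - oo C A r) := by
      rcases lt_or_ge 0 (oo B C r) with h | h
      · exact Or.inl h
      · right
        by_contra h'
        exact hb ⟨h, Or.inr (not_le.1 h').le⟩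
    let M : ℝ × ℝ → ℝ × ℝ := fun p => (-p.1, p.2)
    have hM : ∀ a b c, oo (M b) (M a) (M c) = oo a b c := by
      intro a b c
      rw [oo_swap, oo_mirror]; ring
    obtain ⟨k, k1, k2⟩ := pasch_half (A := M B) (B := M A) (C := M C) (g := M g) (r := M r)
      (by rw [hM]; exact hD) (by rw [hM]; exact hg) (by rw [hM]; exact hg2) (by rw [hM]; exact hg1)
      (by rw [hM, hM]; exact hr) (by rw [hM]; exact hc) (by simp only [hM]; exact hd)
    exact h2 _ (mirror_seg k1) (by rw [segment_symm]; exact mirror_seg k2)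

lemma cross_pt {a b c d : ℝ × ℝ} (h1 : oo a b c * oo a b d < 0) (h2 : oo c d a * oo c d b < 0) :
    ∃ k, k ∈ segment ℝ a b ∧ k ∈ segment ℝ c d := by
  have hrel : oo c d a - oo c d b = - (oo a b c - oo a b d) := by simp only [oo]; ring
  have hne : oo a b c - oo a b d ≠ 0 := by
    intro h
    have : oo a b c = oo a b d := by linarith
    rw [this] at h1
    nlinarith [mul_self_nonneg (oo a b d)]
  have par : ∀ x y : ℝ, x * y < 0 → 0 ≤ x / (x - y) ∧ x / (x - y) ≤ 1 := by
    intro x y h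
    rcases mul_neg_iff.1 h with ⟨hx, hy⟩ | ⟨hx, hy⟩
    · have : 0 < x - y := by linarith
      exact ⟨div_nonneg hx.le this.le, (div_le_one this).2 (by linarith)⟩
    · have : x - y < 0 := by linarith
      exact ⟨div_nonneg_of_nonpos hx.le this.le, (div_le_one_of_neg this).2 (by linarith)⟩
  obtain ⟨p0, p1⟩ := par _ _ h1
  obtain ⟨q0, q1⟩ := par _ _ h2
  set t := oo a b c / (oo a b c - oo a b d) with ht
  refine ⟨((1 - t) * c.1 + t * d.1, (1 - t) * c.2 + t * d.2), ?_, seg_mem t p0 p1 rfl rfl⟩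
  refine seg_mem _ q0 q1 ?_ ?_
  · rw [hrel, ht]
    field_simp
    simp only [oo]; ring
  · rw [hrel, ht]
    field_simp
    simp only [oo]; ring

lemma line_seg {a b k : ℝ × ℝ} (hk : k ∈ segment ℝ a b) (p q : ℝ × ℝ) :
    ∃ t, 0 ≤ t ∧ t ≤ 1 ∧ oo p q k = (1 - t) * oo p q a + t * oo p q b := by
  obtain ⟨t, h0, h1, hx, hy⟩ := mem_seg hk
  exact ⟨t, h0, h1, oo_aff hx hy⟩

lemma seg_sub {a b g r k : ℝ × ℝ} (hg : g ∈ segment ℝ a b) (hr : r ∈ segment ℝ a b)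
    (hk : k ∈ segment ℝ g r) : k ∈ segment ℝ a b :=
  (convex_segment a b).segment_subset hg hr hk

set_option linter.unusedSectionVars false
set_option linter.unusedVariables false

/-- exit lemma -/
lemma exit2 (a1 b1 a2 b2 : ℝ) (h1 : 0 < a1) (h2 : 0 < a2) (h : ¬ (0 < b1 ∧ 0 < b2)) :
    ∃ s : ℝ, 0 ≤ s ∧ s ≤ 1 ∧ (((1-s)*a1+s*b1 = 0 ∧ 0 ≤ (1-s)*a2+s*b2) ∨
      ((1-s)*a2+s*b2 = 0 ∧ 0 ≤ (1-s)*a1+s*b1)) := by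
  have one : ∀ a1 b1 a2 b2 : ℝ, 0 < a1 → 0 < a2 → b1 ≤ 0 →
      (0 < b2 ∨ a1 * (a2 - b2) ≤ a2 * (a1 - b1)) →
      ∃ s : ℝ, 0 ≤ s ∧ s ≤ 1 ∧ ((1-s)*a1+s*b1 = 0 ∧ 0 ≤ (1-s)*a2+s*b2) := by
    intro a1 b1 a2 b2 h1 h2 hb hc
    have hd : 0 < a1 - b1 := by linarith
    obtain ⟨s, hs⟩ : ∃ s, s = a1 / (a1 - b1) := ⟨_, rfl⟩
    have hsd : s * (a1 - b1) = a1 := by rw [hs]; field_simp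
    have s0 : 0 ≤ s := by rw [hs]; exact div_nonneg h1.le hd.le
    have s1 : s ≤ 1 := by rw [hs, div_le_one hd]; linarith
    refine ⟨s, s0, s1, by linarith, ?_⟩
    rcases hc with hc | hc
    · have := mul_nonneg s0 hc.le
      have := mul_nonneg (by linarith : 0 ≤ 1 - s) h2.le
      linarith
    · have : s * (a2 - b2) ≤ a2 := by
        rw [hs, div_mul_eq_mul_div, div_le_iff₀ hd]; exact hc
      linarith
  by_cases hb : b1 ≤ 0 ∧ (0 < b2 ∨ a1 * (a2 - b2) ≤ a2 * (a1 - b1))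
  · obtain ⟨s, s0, s1, h⟩ := one a1 b1 a2 b2 h1 h2 hb.1 hb.2
    exact ⟨s, s0, s1, Or.inl h⟩
  · have hc : b2 ≤ 0 := by
      by_contra hc
      push Not at hc
      rcases lt_or_ge 0 b1 with h' | h'
      · exact h ⟨h', hc⟩
      · exact hb ⟨h', Or.inl hc⟩
    have hd : 0 < b1 ∨ a2 * (a1 - b1) ≤ a1 * (a2 - b2) := by
      rcases lt_or_ge 0 b1 with h | h
      · exact Or.inl h
      · right
        by_contra h'
        exact hb ⟨h, Or.inr (not_le.1 h').le⟩
    obtain ⟨s, s0, s1, h⟩ := one a2 b2 a1 b1 h2 h1 hc hd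
    exact ⟨s, s0, s1, Or.inr h⟩

lemma seg_combo {a b k : ℝ × ℝ} {c x y : ℝ} (hc : 0 < c) (hx : 0 ≤ x) (hy : 0 ≤ y) (hxy : x + y = c)
    (h1 : c * k.1 = x * a.1 + y * b.1) (h2 : c * k.2 = x * a.2 + y * b.2) : k ∈ segment ℝ a b := by
  have hx' : x = c - y := by linarith
  subst hx'
  refine seg_mem (y / c) (div_nonneg hy hc.le) ((div_le_one hc).2 (by linarith)) ?_ ?_ <;>
  · field_simp
    linarith

/-- wedge lemma -/
lemma wedge {u h p t g r : ℝ × ℝ} (e : ℝ) (hD : 0 < e * oo u h p)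
    (ht1 : 0 < e * oo u h t) (ht2 : 0 ≤ e * oo p u t)
    (hg1 : 0 < e * oo u h g) (hg2 : 0 < e * oo h p g) (hg3 : e * oo u t g = 0)
    (hr : e * oo u t r < 0)
    (h1 : ∀ k, k ∈ segment ℝ g r → k ∈ segment ℝ u h → False)
    (h2 : ∀ k, k ∈ segment ℝ g r → k ∈ segment ℝ h p → False) :
    0 < e * oo u h r ∧ 0 < e * oo h p r := by
  by_contra hcon
  obtain ⟨s, s0, s1, hs⟩ := exit2 _ _ _ _ hg1 hg2 hcon
  obtain ⟨k, hk⟩ : ∃ k : ℝ × ℝ, k = ((1 - s) * g.1 + s * r.1, (1 - s) * g.2 + s * r.2) := ⟨_, rfl⟩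
  have kx : k.1 = (1 - s) * g.1 + s * r.1 := by rw [hk]
  have ky : k.2 = (1 - s) * g.2 + s * r.2 := by rw [hk]
  have kseg := seg_mem s s0 s1 kx ky
  have a1 := oo_aff (m := u) (M := h) kx ky
  have a2 := oo_aff (m := h) (M := p) kx ky
  have a3 := oo_aff (m := u) (M := t) kx ky
  have k3 : e * oo u t k ≤ 0 := by
    rw [a3]
    have := mul_nonneg s0 (by linarith : 0 ≤ -(e * oo u t r))
    have h4 : (1 - s) * (e * oo u t g) = 0 := by rw [hg3]; ring
    linarith
  have hsum := oo_sum u h p k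
  have key : (e * oo u h p) * (e * oo u t k) = (e * oo p u t) * (e * oo u h k) -
      (e * oo u h t) * (e * oo p u k) := by simp only [oo]; ring
  have bx : e * oo u h p * k.1 = e * oo h p k * u.1 + e * oo p u k * h.1 + e * oo u h k * p.1 := by
    simp only [oo]; ring
  have bY : e * oo u h p * k.2 = e * oo h p k * u.2 + e * oo p u k * h.2 + e * oo u h k * p.2 := by
    simp only [oo]; ring
  have hsum' : e * oo u h k + e * oo h p k + e * oo p u k = e * oo u h p := by rw [← hsum]; ring
  have hpk : ∀ z, (e * oo u h k = z → 0 ≤ z → 0 ≤ e * oo p u k) := by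
    intro z hz hz0
    by_contra hneg
    push Not at hneg
    have p1 : (e * oo u h p) * (e * oo u t k) ≤ 0 := mul_nonpos_of_nonneg_of_nonpos hD.le k3
    have p2 : 0 ≤ (e * oo p u t) * (e * oo u h k) := mul_nonneg ht2 (by rw [hz]; exact hz0)
    have p3 : (e * oo u h t) * (e * oo p u k) < 0 := mul_neg_of_pos_of_neg ht1 hneg
    linarith
  rcases hs with ⟨z1, z2⟩ | ⟨z1, z2⟩
  · have y1 : e * oo u h k = 0 := by rw [a1, ← z1]; ring
    have y2 : 0 ≤ e * oo h p k := by rw [a2]; linarith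
    refine h1 k kseg (seg_combo hD y2 (hpk 0 y1 le_rfl) (by linarith) ?_ ?_)
    · rw [bx, y1]; ring
    · rw [bY, y1]; ring
  · have y1 : e * oo h p k = 0 := by rw [a2, ← z1]; ring
    have y2 : 0 ≤ e * oo u h k := by rw [a1]; linarith
    refine h2 k kseg (seg_combo hD (hpk _ rfl y2) y2 (by linarith) ?_ ?_)
    · rw [bx, y1]; ring
    · rw [bY, y1]; ring

structure Geo {Y : Type} (P : Y → ℝ × ℝ) (G : SimpleGraph Y) : Prop where
  gp : ∀ a b c, a ≠ b → a ≠ c → b ≠ c → oo (P a) (P b) (P c) ≠ 0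
  yi : ∀ a b, a ≠ b → (P a).2 ≠ (P b).2
  nc : ∀ a b c d, G.Adj a b → G.Adj c d → a ≠ c → a ≠ d → b ≠ c → b ≠ d →
    ∀ k, k ∈ segment ℝ (P a) (P b) → k ∈ segment ℝ (P c) (P d) → False
  mx : ∀ u v, u ≠ v → ¬ G.Adj u v → ∃ x y k, G.Adj x y ∧ x ≠ u ∧ x ≠ v ∧ y ≠ u ∧ y ≠ v ∧
    k ∈ segment ℝ (P u) (P v) ∧ k ∈ segment ℝ (P x) (P y)

lemma seg_fork {a b d k : ℝ × ℝ} (h : oo a b d ≠ 0) (h1 : k ∈ segment ℝ a b)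
    (h2 : k ∈ segment ℝ a d) : k = a := by
  obtain ⟨t, t0, t1, hx, hy⟩ := mem_seg h2
  have h3 := oo_seg h1
  rw [oo_aff hx hy] at h3
  have h4 : oo a b a = 0 := by simp only [oo]; ring
  rw [h4] at h3
  have : t = 0 := by
    have : t * oo a b d = 0 := by linarith
    rcases mul_eq_zero.1 this with h' | h'
    · exact h'
    · exact absurd h' h
  subst this
  exact seg_zero hx hy

namespace Geo
variable {Y : Type} {P : Y → ℝ × ℝ} {G : SimpleGraph Y}

lemma inj (hG : Geo P G) {a b : Y} (h : P a = P b) : a = b := by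
  by_contra hne
  exact hG.yi a b hne (by rw [h])

lemma on (hG : Geo P G) {a b z : Y} (hab : a ≠ b) (h : P z ∈ segment ℝ (P a) (P b)) :
    z = a ∨ z = b := by
  by_contra hne
  push Not at hne
  exact hG.gp a b z hab hne.1.symm hne.2.symm (oo_seg h)

lemma meet (hG : Geo P G) {a b c d : Y} (h1 : G.Adj a b) (h2 : G.Adj c d) {k : ℝ × ℝ}
    (k1 : k ∈ segment ℝ (P a) (P b)) (k2 : k ∈ segment ℝ (P c) (P d)) :
    ((c = a ∧ d = b) ∨ (c = b ∧ d = a)) ∨ ∃ e, (e = a ∨ e = b) ∧ (e = c ∨ e = d) ∧ k = P e := by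
  have fork : ∀ a b d, G.Adj a b → G.Adj a d → b ≠ d → k ∈ segment ℝ (P a) (P b) →
      k ∈ segment ℝ (P a) (P d) → k = P a := fun a b d ha hb hbd ka kb =>
    seg_fork (hG.gp a b d ha.ne hb.ne hbd) ka kb
  by_cases hac : a = c
  · subst hac
    by_cases hbd : b = d
    · left; left; exact ⟨rfl, hbd.symm⟩
    · right; exact ⟨a, Or.inl rfl, Or.inl rfl, fork a b d h1 h2 hbd k1 k2⟩
  by_cases had : a = d
  · subst had
    by_cases hbc : b = c
    · left; right; exact ⟨hbc.symm, rfl⟩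
    · right
      rw [segment_symm] at k2
      exact ⟨a, Or.inl rfl, Or.inr rfl, fork a b c h1 h2.symm hbc k1 k2⟩
  by_cases hbc : b = c
  · subst hbc
    right
    rw [segment_symm] at k1
    exact ⟨b, Or.inr rfl, Or.inl rfl, fork b a d h1.symm h2 had k1 k2⟩
  by_cases hbd : b = d
  · subst hbd
    right
    rw [segment_symm] at k1 k2
    exact ⟨b, Or.inr rfl, Or.inr rfl, fork b a c h1.symm h2.symm hac k1 k2⟩
  exact (hG.nc a b c d h1 h2 hac had hbc hbd k k1 k2).elim

end Geo

lemma angmin {Y : Type} (P : Y → ℝ × ℝ) (e : ℝ) (he : e ≠ 0) (u v : ℝ × ℝ) (s : Finset Y) (hs : s.Nonempty)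
    (h : ∀ w ∈ s, 0 < e * oo u v (P w)) : ∃ w ∈ s, ∀ w' ∈ s, 0 ≤ e * oo u (P w) (P w') := by
  let dt : ℝ × ℝ → ℝ := fun p => (v.1 - u.1) * (p.1 - u.1) + (v.2 - u.2) * (p.2 - u.2)
  obtain ⟨w, hw, hmax⟩ := s.exists_max_image (fun w => dt (P w) / (e * oo u v (P w))) hs
  refine ⟨w, hw, fun w' hw' => ?_⟩
  have h1 := hmax w' hw'
  rw [div_le_div_iff₀ (h w' hw') (h w hw)] at h1
  have hpos : 0 < (v.1 - u.1)^2 + (v.2 - u.2)^2 := by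
    have := h w hw
    by_contra hn
    have e1 : v.1 - u.1 = 0 := by nlinarith [sq_nonneg (v.1 - u.1), sq_nonneg (v.2 - u.2)]
    have e2 : v.2 - u.2 = 0 := by nlinarith [sq_nonneg (v.1 - u.1), sq_nonneg (v.2 - u.2)]
    simp only [oo, e1, e2] at this
    norm_num at this
  have key : ((v.1 - u.1)^2 + (v.2 - u.2)^2) * (e * oo u (P w) (P w')) =
      dt (P w) * (e * oo u v (P w')) - dt (P w') * (e * oo u v (P w)) := by
    simp only [oo, dt]; ring
  by_contra hneg
  push Not at hneg
  have := mul_neg_of_pos_of_neg hpos hneg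
  linarith

set_option linter.unusedSectionVars false
set_option linter.unusedVariables false

namespace Geo
variable {Y : Type} [Fintype Y] [DecidableEq Y] {P : Y → ℝ × ℝ} {G : SimpleGraph Y}

/-- first crossing -/
lemma first (hG : Geo P G) {u z : Y} (huz : u ≠ z) (hadj : ¬ G.Adj u z) :
    ∃ p q h t, G.Adj p q ∧ p ≠ u ∧ p ≠ z ∧ q ≠ u ∧ q ≠ z ∧ 0 < t ∧ t < 1 ∧
      h ∈ segment ℝ (P p) (P q) ∧ h.1 = (1-t) * (P u).1 + t * (P z).1 ∧
      h.2 = (1-t) * (P u).2 + t * (P z).2 ∧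
      ∀ x y, G.Adj x y → x ≠ u → y ≠ u → ∀ k, k ∈ segment ℝ (P u) h → k ∈ segment ℝ (P x) (P y) →
        (x = p ∧ y = q) ∨ (x = q ∧ y = p) := by
  classical
  let good : Y × Y → ℝ → Prop := fun e t => G.Adj e.1 e.2 ∧ e.1 ≠ u ∧ e.1 ≠ z ∧ e.2 ≠ u ∧ e.2 ≠ z ∧
    0 ≤ t ∧ t ≤ 1 ∧ (((1-t) * (P u).1 + t * (P z).1, (1-t) * (P u).2 + t * (P z).2) : ℝ × ℝ) ∈
      segment ℝ (P e.1) (P e.2)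
  let tau : Y × Y → ℝ := fun e => oo (P e.1) (P e.2) (P u) /
    (oo (P e.1) (P e.2) (P u) - oo (P e.1) (P e.2) (P z))
  have htau : ∀ e t, good e t → t = tau e := by
    rintro ⟨x, y⟩ t ⟨h1, h2, h3, h4, h5, h6, h7, h8⟩
    simp only at h1 h2 h3 h4 h5 h8
    have h9 := oo_seg h8
    rw [oo_aff (t := t) rfl rfl] at h9
    have ne := hG.gp x y u h1.ne h2 h4
    simp only [tau]
    have ne2 : oo (P x) (P y) (P u) - oo (P x) (P y) (P z) ≠ 0 := by
      intro h
      have : oo (P x) (P y) (P z) = oo (P x) (P y) (P u) := by linarith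
      rw [this] at h9
      apply ne; linarith
    rw [eq_div_iff ne2]
    linarith
  let Q : Finset (Y × Y) := Finset.univ.filter (fun e => ∃ t, good e t)
  have hQ : Q.Nonempty := by
    obtain ⟨x, y, k, h1, h2, h3, h4, h5, k1, k2⟩ := hG.mx u z huz hadj
    obtain ⟨t, t0, t1, hx, hy⟩ := mem_seg k1
    refine ⟨(x, y), Finset.mem_filter.2 ⟨Finset.mem_univ _, t, h1, h2, h3, h4, h5, t0, t1, ?_⟩⟩
    have : k = ((1-t) * (P u).1 + t * (P z).1, (1-t) * (P u).2 + t * (P z).2) := Prod.ext hx hy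
    rwa [← this]
  obtain ⟨⟨p, q⟩, he, hmin⟩ := Q.exists_min_image tau hQ
  obtain ⟨t, ht⟩ := (Finset.mem_filter.1 he).2
  have htt := htau _ _ ht
  obtain ⟨h1, h2, h3, h4, h5, h6, h7, h8⟩ := ht
  simp only at h1 h2 h3 h4 h5 h8
  have t0 : t ≠ 0 := by
    rintro rfl
    have : P u ∈ segment ℝ (P p) (P q) := by convert h8 using 1; ext <;> simp
    rcases hG.on h1.ne this with h | h
    · exact h2 h.symm
    · exact h4 h.symm
  have t1 : t ≠ 1 := by
    rintro rfl
    have : P z ∈ segment ℝ (P p) (P q) := by convert h8 using 1; ext <;> simp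
    rcases hG.on h1.ne this with h | h
    · exact h3 h.symm
    · exact h5 h.symm
  have t0' : 0 < t := lt_of_le_of_ne h6 t0.symm
  have t1' : t < 1 := lt_of_le_of_ne h7 t1
  refine ⟨p, q, _, t, h1, h2, h3, h4, h5, t0', t1', h8, rfl, rfl, ?_⟩
  intro x y hxy hx hy k k1 k2
  obtain ⟨s, s0, s1, kx, ky⟩ := mem_seg k1
  simp only at kx ky
  have kx' : k.1 = (1 - s*t) * (P u).1 + (s*t) * (P z).1 := by rw [kx]; ring
  have ky' : k.2 = (1 - s*t) * (P u).2 + (s*t) * (P z).2 := by rw [ky]; ring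
  have st1 : s * t ≤ t := by nlinarith
  have st0 : 0 ≤ s * t := mul_nonneg s0 h6
  have kuz : k ∈ segment ℝ (P u) (P z) := seg_mem (s*t) st0 (by linarith) kx' ky'
  have hkz : k ≠ P z := by
    intro h
    rw [h] at ky'
    have : (1 - s*t) * ((P u).2 - (P z).2) = 0 := by linarith
    rcases mul_eq_zero.1 this with h' | h'
    · linarith
    · exact hG.yi u z huz (by linarith)
  have hxz : x ≠ z := by
    rintro rfl
    rw [segment_symm] at kuz
    exact hkz (seg_fork (hG.gp x u y hx hxy.ne hy.symm) kuz k2)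
  have hyz : y ≠ z := by
    rintro rfl
    rw [segment_symm] at kuz k2
    exact hkz (seg_fork (hG.gp y u x hy hxy.ne.symm hx.symm) kuz k2)
  have kk : k = ((1-s*t) * (P u).1 + (s*t) * (P z).1, (1-s*t) * (P u).2 + (s*t) * (P z).2) :=
    Prod.ext kx' ky'
  have hgood : good (x, y) (s*t) := ⟨hxy, hx, hxz, hy, hyz, st0, by linarith, by rw [← kk]; exact k2⟩
  have := hmin (x, y) (Finset.mem_filter.2 ⟨Finset.mem_univ _, _, hgood⟩)
  rw [← htau _ _ hgood, ← htt] at this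
  have hst : s * t = t := le_antisymm st1 this
  rw [hst] at kk
  rw [← kk] at h8
  rcases hG.meet h1 hxy h8 k2 with h | ⟨e, e1, e2, e3⟩
  · exact h
  · exfalso
    rw [e3] at kuz
    rcases hG.on huz kuz with h | h
    · subst h; rcases e2 with h | h
      · exact hx h.symm
      · exact hy h.symm
    · subst h; rcases e2 with h | h
      · exact hxz h.symm
      · exact hyz h.symm

lemma seg_lin {a b k : ℝ × ℝ} (al be : ℝ) (hk : k ∈ segment ℝ a b) : ∃ t, 0 ≤ t ∧ t ≤ 1 ∧
    al * k.1 + be * k.2 = (1-t) * (al * a.1 + be * a.2) + t * (al * b.1 + be * b.2) := by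
  obtain ⟨t, t0, t1, hx, hy⟩ := mem_seg hk
  exact ⟨t, t0, t1, by rw [hx, hy]; ring⟩

/-- Lemma V -/
lemma lemV (hG : Geo P G) (al be : ℝ) {u z : Y}
    (hz : al * (P u).1 + be * (P u).2 < al * (P z).1 + be * (P z).2) :
    ∃ w, G.Adj u w ∧ al * (P u).1 + be * (P u).2 < al * (P w).1 + be * (P w).2 := by
  classical
  by_cases hadj : G.Adj u z
  · exact ⟨z, hadj, hz⟩
  have huz : u ≠ z := by rintro rfl; exact lt_irrefl _ hz
  obtain ⟨p, q, h, t, hpq, pu, pz, qu, qz, t0, t1, hpqh, hx, hy, free⟩ := hG.first huz hadj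
  have hl : al * (P u).1 + be * (P u).2 < al * h.1 + be * h.2 := by
    rw [hx, hy]; nlinarith
  -- choose p
  wlog hp : al * h.1 + be * h.2 ≤ al * (P p).1 + be * (P p).2 generalizing p q
  · refine this q p hpq.symm qu qz pu pz (by rw [segment_symm]; exact hpqh) ?_ ?_
    · intro x y h1 h2 h3 k h4 h5
      exact (free x y h1 h2 h3 k h4 h5).symm
    · obtain ⟨s, s0, s1, hs⟩ := seg_lin al be hpqh
      by_contra hq
      push Not at hp hq
      rcases eq_or_lt_of_le s0 with h' | h'
      · subst h'; linarith
      · have := mul_lt_mul_of_pos_left hq h'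
        have := mul_le_mul_of_nonneg_left hp.le (by linarith : 0 ≤ 1 - s)
        linarith
  have hup : ∀ w, oo (P u) h w = t * oo (P u) (P z) w := by
    intro w; simp only [oo, hx, hy]; ring
  obtain ⟨e, he⟩ : ∃ e, e = oo (P u) h (P p) := ⟨_, rfl⟩
  have he0 : e ≠ 0 := by
    rw [he, hup]
    exact mul_ne_zero t0.ne' (hG.gp u z p huz pu.symm pz.symm)
  have hD : 0 < e * oo (P u) h (P p) := by rw [← he]; exact mul_self_pos.2 he0
  have hzn : e * oo h (P p) (P z) < 0 := by
    have e1 : t * (e * oo h (P p) (P z)) = - ((1-t) * (e * oo (P u) h (P p))) := by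
      simp only [oo, hx, hy]; ring
    by_contra hn
    push Not at hn
    have := mul_nonneg t0.le hn
    have := mul_pos (by linarith : 0 < 1 - t) hD
    linarith
  -- the set T
  let T : Finset Y := Finset.univ.filter (fun w => 0 < e * oo (P u) h (P w) ∧
    0 ≤ e * oo h (P p) (P w) ∧ 0 ≤ e * oo (P p) (P u) (P w))
  have memT : ∀ w, w ∈ T ↔ (0 < e * oo (P u) h (P w) ∧
    0 ≤ e * oo h (P p) (P w) ∧ 0 ≤ e * oo (P p) (P u) (P w)) := by
    intro w; simp [T]
  have pT : p ∈ T := by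
    rw [memT]
    refine ⟨hD, ?_, ?_⟩ <;> · apply le_of_eq; simp only [oo]; ring
  have Tl : ∀ w ∈ T, al * (P u).1 + be * (P u).2 < al * (P w).1 + be * (P w).2 := by
    intro w hw
    obtain ⟨w1, w2, w3⟩ := (memT w).1 hw
    have bx : e * oo (P u) h (P p) * (al * (P w).1 + be * (P w).2 - (al * (P u).1 + be * (P u).2)) =
        e * oo (P p) (P u) (P w) * (al * h.1 + be * h.2 - (al * (P u).1 + be * (P u).2)) +
        e * oo (P u) h (P w) * (al * (P p).1 + be * (P p).2 - (al * (P u).1 + be * (P u).2)) := by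
      simp only [oo]; ring
    have m1 := mul_nonneg w3 (by linarith : 0 ≤ (al * h.1 + be * h.2 - (al * (P u).1 + be * (P u).2)))
    have m2 := mul_pos w1 (by linarith : 0 < (al * (P p).1 + be * (P p).2 - (al * (P u).1 + be * (P u).2)))
    have := pos_of_mul_pos_right (by rw [bx]; linarith :
      0 < e * oo (P u) h (P p) * (al * (P w).1 + be * (P w).2 - (al * (P u).1 + be * (P u).2))) hD.le
    linarith
  obtain ⟨w, hwT, hmin⟩ := angmin P e he0 (P u) h T ⟨p, pT⟩ (fun w hw => ((memT w).1 hw).1)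
  refine ⟨w, ?_, Tl w hwT⟩
  by_contra hna
  have huw : u ≠ w := by rintro rfl; exact lt_irrefl _ (Tl u hwT)
  obtain ⟨w1, w2, w3⟩ := (memT w).1 hwT
  obtain ⟨x, y, g, hxy, xu, xw, yu, yw, g1, g2⟩ := hG.mx u w huw hna
  have hg0 := oo_seg g1
  -- endpoint r
  wlog hr : e * oo (P u) (P w) (P x) < 0 generalizing x y
  · refine this y x hxy.symm yu yw xu xw (by rw [segment_symm]; exact g2) ?_
    push Not at hr
    have hx0 : 0 < e * oo (P u) (P w) (P x) :=
      lt_of_le_of_ne hr (mul_ne_zero he0 (hG.gp u w x huw xu.symm xw.symm)).symm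
    obtain ⟨s, s0, s1, hs⟩ := line_seg g2 (P u) (P w)
    rw [hg0] at hs
    have hs' : 0 = (1 - s) * (e * oo (P u) (P w) (P x)) + s * (e * oo (P u) (P w) (P y)) := by
      linear_combination e * hs
    by_contra hn
    push Not at hn
    have hy0 : 0 < e * oo (P u) (P w) (P y) :=
      lt_of_le_of_ne hn (mul_ne_zero he0 (hG.gp u w y huw yu.symm yw.symm)).symm
    rcases eq_or_lt_of_le s0 with h' | h'
    · subst h'; linarith
    · have := mul_pos h' hy0
      have := mul_nonneg (by linarith : 0 ≤ 1 - s) hx0.le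
      linarith
  have xnT : x ∉ T := fun hxT => absurd (hmin x hxT) (not_le.2 hr)
  obtain ⟨s, s0, s1, gx, gy⟩ := mem_seg g1
  have s0' : s ≠ 0 := by
    rintro rfl
    rw [seg_zero gx gy] at g2
    rcases hG.on hxy.ne g2 with h | h
    · exact xu h.symm
    · exact yu h.symm
  have s1' : s ≠ 1 := by
    rintro rfl
    have : g = P w := by ext <;> simp [gx, gy]
    rw [this] at g2
    rcases hG.on hxy.ne g2 with h | h
    · exact xw h.symm
    · exact yw h.symm
  have s0'' : 0 < s := lt_of_le_of_ne s0 s0'.symm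
  have s1'' : s < 1 := lt_of_le_of_ne s1 s1'
  have hhu : 0 < e * oo h (P p) (P u) := by rw [oo_cyc]; exact hD
  have hg1 : 0 < e * oo (P u) h g := by
    rw [oo_aff gx gy]
    have : oo (P u) h (P u) = 0 := by simp only [oo]; ring
    rw [this]
    have := mul_pos s0'' w1
    linarith
  have hg2 : 0 < e * oo h (P p) g := by
    rw [oo_aff gx gy]
    have := mul_pos (by linarith : 0 < 1 - s) hhu
    have := mul_nonneg s0 w2
    linarith
  have hpseg : ∀ k, k ∈ segment ℝ h (P p) → k ∈ segment ℝ (P p) (P q) := fun k hk =>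
    seg_sub hpqh (left_mem_segment ℝ _ _) hk
  have hnpq : ¬ ((x = p ∧ y = q) ∨ (x = q ∧ y = p)) := by
    rintro (⟨rfl, rfl⟩ | ⟨rfl, rfl⟩)
    · exact xnT pT
    · -- g lies on the line
      rw [segment_symm] at g2
      have e1 := oo_seg g2
      have e2 := oo_seg hpqh
      obtain ⟨c, c0, c1, cx, cy⟩ := mem_seg hpqh
      have : oo h (P y) g = -((1 - c) * 0) - c * oo (P y) (P x) g := by
        simp only [oo, cx, cy]; ring
      rw [e1] at this
      rw [this] at hg2
      norm_num at hg2
  have gxsub : ∀ k, k ∈ segment ℝ g (P x) → k ∈ segment ℝ (P x) (P y) := fun k hk =>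
    seg_sub g2 (left_mem_segment ℝ _ _) hk
  have := wedge e hD w1 w3 hg1 hg2 (by rw [hg0]; ring) hr ?_ ?_
  · obtain ⟨r1, r2⟩ := this
    apply xnT
    rw [memT]
    refine ⟨r1, r2.le, ?_⟩
    have key : (e * oo (P u) h (P p)) * (e * oo (P u) (P w) (P x)) =
      (e * oo (P p) (P u) (P w)) * (e * oo (P u) h (P x)) -
      (e * oo (P u) h (P w)) * (e * oo (P p) (P u) (P x)) := by simp only [oo]; ring
    have k1 := mul_neg_of_pos_of_neg hD hr
    have k2 := mul_nonneg w3 r1.le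
    by_contra hn
    push Not at hn
    have := mul_neg_of_pos_of_neg w1 hn
    linarith
  · intro k k1 k2
    exact hnpq (free x y hxy xu yu k k2 (gxsub k k1))
  · intro k k1 k2
    rcases hG.meet hpq hxy (hpseg k k2) (gxsub k k1) with h' | ⟨f, f1, f2, rfl⟩
    · exact hnpq h'
    · have hfp : f = p := by
        rcases f1 with rfl | rfl
        · rfl
        · exfalso
          -- q in segment h p
          obtain ⟨c, c0, c1, hc⟩ := line_seg k2 (P u) (P z)
          obtain ⟨d, d0, d1, hd⟩ := line_seg hpqh (P u) (P z)
          have hh0 : oo (P u) (P z) h = 0 := by simp only [oo, hx, hy]; ring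
          rw [hh0] at hc hd
          have np := hG.gp u z p huz pu.symm pz.symm
          have nq := hG.gp u z f huz qu.symm qz.symm
          rw [hc] at hd nq
          have : (1 - d + d * c) * oo (P u) (P z) (P p) = 0 := by linarith
          rcases mul_eq_zero.1 this with h' | h'
          · have hdc : 0 ≤ d * c := mul_nonneg d0 c0
            have hd1 : d = 1 := by linarith
            have hc0 : c = 0 := by rw [hd1] at h'; linarith
            apply nq; rw [hc0]; ring
          · exact np h'
      subst hfp
      rcases f2 with h' | h'
      · subst h'; exact xnT pT
      · subst h'
        obtain ⟨c, c0, c1, hc⟩ := line_seg k1 (P u) (P w)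
        rw [hg0] at hc
        have hp0 := hmin f pT
        have hf : oo (P u) (P w) (P f) ≠ 0 := hG.gp u w f huw pu.symm yw.symm
        rw [hc] at hp0 hf
        have : c ≠ 0 := by rintro rfl; apply hf; ring
        have := mul_neg_of_pos_of_neg (lt_of_le_of_ne c0 this.symm) hr
        linarith
end Geo

set_option linter.unusedSectionVars false
set_option linter.unusedVariables false

namespace Geo
variable {Y : Type} [Fintype Y] [DecidableEq Y] {P : Y → ℝ × ℝ} {G : SimpleGraph Y}

lemma ne_of_oo {a b c : Y} (h : 0 < oo (P a) (P b) (P c)) : a ≠ b ∧ a ≠ c ∧ b ≠ c := by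
  refine ⟨?_, ?_, ?_⟩ <;> rintro rfl <;> simp only [oo] at h <;> ring_nf at h <;>
    exact lt_irrefl _ h

/-- strictly inside -/
def ins (P : Y → ℝ × ℝ) (u v w z : Y) : Prop :=
  0 < oo (P u) (P v) (P z) ∧ 0 < oo (P v) (P w) (P z) ∧ 0 < oo (P w) (P u) (P z)

lemma lemF (hG : Geo P G) {u v w0 : Y} (huv : G.Adj u v) (hw0 : 0 < oo (P u) (P v) (P w0)) :
    ∃ w, G.Adj u w ∧ G.Adj v w ∧ 0 < oo (P u) (P v) (P w) ∧ ∀ z, ¬ ins P u v w z := by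
  classical
  let N : Finset Y := Finset.univ.filter (fun w => G.Adj u w ∧ 0 < oo (P u) (P v) (P w))
  have hN : N.Nonempty := by
    have e : ∀ z, oo (P u) (P v) z = ((P u).2 - (P v).2) * z.1 + ((P v).1 - (P u).1) * z.2 -
      (((P u).2 - (P v).2) * (P u).1 + ((P v).1 - (P u).1) * (P u).2) := by
      intro z; simp only [oo]; ring
    obtain ⟨w, h1, h2⟩ := hG.lemV ((P u).2 - (P v).2) ((P v).1 - (P u).1) (u := u) (z := w0) (by
      rw [e] at hw0; linarith)
    exact ⟨w, Finset.mem_filter.2 ⟨Finset.mem_univ _, h1, by rw [e]; linarith⟩⟩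
  obtain ⟨w, hw, hmin⟩ := angmin P 1 one_ne_zero (P u) (P v) N hN (fun w hw => by
    rw [one_mul]; exact (Finset.mem_filter.1 hw).2.2)
  obtain ⟨-, huw, hD⟩ := Finset.mem_filter.1 hw
  obtain ⟨nuv, nuw, nvw⟩ := ne_of_oo hD
  have hmin' : ∀ w', G.Adj u w' → 0 < oo (P u) (P v) (P w') → 0 ≤ oo (P u) (P w) (P w') := by
    intro w' h1 h2
    have := hmin w' (Finset.mem_filter.2 ⟨Finset.mem_univ _, h1, h2⟩)
    rwa [one_mul] at this
  have hD' : 0 < oo (P v) (P w) (P u) := by rw [oo_cyc]; exact hD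
  have emp : ∀ z, ¬ ins P u v w z := by
    by_contra hcon
    push Not at hcon
    obtain ⟨z0, hz0⟩ := hcon
    let T : Finset Y := Finset.univ.filter (fun z => ins P u v w z)
    obtain ⟨z, hzT, hmax⟩ := T.exists_max_image (fun z => oo (P v) (P w) (P z))
      ⟨z0, Finset.mem_filter.2 ⟨Finset.mem_univ _, hz0⟩⟩
    obtain ⟨-, z1, z2, z3⟩ := Finset.mem_filter.1 hzT
    obtain ⟨-, nuz, nvz⟩ := ne_of_oo z1
    have nwz := (ne_of_oo z2).2.2
    have hna : ¬ G.Adj u z := by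
      intro h
      have := hmin' z h z1
      rw [oo_swap] at z3
      linarith
    obtain ⟨x, y, g, hxy, xu, xz, yu, yz, g1, g2⟩ := hG.mx u z nuz hna
    obtain ⟨s, s0, s1, gx, gy⟩ := mem_seg g1
    have s0' : s ≠ 0 := by
      rintro rfl
      rw [seg_zero gx gy] at g2
      rcases hG.on hxy.ne g2 with h | h
      · exact xu h.symm
      · exact yu h.symm
    have s1' : s ≠ 1 := by
      rintro rfl
      have : g = P z := by ext <;> simp [gx, gy]
      rw [this] at g2
      rcases hG.on hxy.ne g2 with h | h
      · exact xz h.symm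
      · exact yz h.symm
    have s0'' : 0 < s := lt_of_le_of_ne s0 s0'.symm
    have s1'' : s < 1 := lt_of_le_of_ne s1 s1'
    have hsum := oo_sum (P u) (P v) (P w) (P z)
    have hgz : oo (P v) (P w) (P z) < oo (P v) (P w) g := by
      rw [oo_aff gx gy, oo_cyc (P u) (P v) (P w)]
      have : oo (P v) (P w) (P z) < oo (P u) (P v) (P w) := by linarith
      nlinarith
    wlog hr : oo (P v) (P w) g ≤ oo (P v) (P w) (P x) generalizing x y
    · refine this y x hxy.symm yu yz xu xz (by rw [segment_symm]; exact g2) ?_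
      obtain ⟨c, c0, c1, hc⟩ := line_seg g2 (P v) (P w)
      by_contra hq
      push Not at hr hq
      rcases eq_or_lt_of_le c0 with h' | h'
      · subst h'; linarith
      · have := mul_lt_mul_of_pos_left hq h'
        have := mul_le_mul_of_nonneg_left hr.le (by linarith : 0 ≤ 1 - c)
        linarith
    have pos : ∀ k, k ∈ segment ℝ g (P x) → 0 < oo (P v) (P w) k := by
      intro k hk
      obtain ⟨c, c0, c1, hc⟩ := line_seg hk (P v) (P w)
      rw [hc]
      have h1 : 0 < oo (P v) (P w) g := by linarith
      nlinarith
    have nv : ∀ k, k ∈ segment ℝ g (P x) → k ≠ P v ∧ k ≠ P w := by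
      intro k hk
      constructor <;>
      · rintro rfl
        have := pos _ hk
        simp only [oo] at this
        ring_nf at this
        exact lt_irrefl _ this
    have sub : ∀ k, k ∈ segment ℝ g (P x) → k ∈ segment ℝ (P x) (P y) := fun k hk =>
      seg_sub g2 (left_mem_segment ℝ _ _) hk
    have blk : ∀ c, (c = v ∨ c = w) → G.Adj u c → ∀ k, k ∈ segment ℝ g (P x) →
        k ∈ segment ℝ (P u) (P c) → False := by
      intro c hc huc k k1 k2
      rcases hG.meet huc hxy k2 (sub k k1) with (h | h) | ⟨f, f1, f2, rfl⟩
      · exact xu h.1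
      · exact yu h.2
      · rcases f1 with rfl | rfl
        · rcases f2 with h | h
          · exact xu h.symm
          · exact yu h.symm
        · rcases hc with rfl | rfl
          · exact (nv _ k1).1 rfl
          · exact (nv _ k1).2 rfl
    obtain ⟨r1, r2⟩ := pasch (A := P v) (B := P w) (C := P u) (g := g) (r := P x) hD'
      (by linarith) (by
        rw [oo_aff gx gy]
        have : oo (P w) (P u) (P u) = 0 := by simp only [oo]; ring
        rw [this]; nlinarith) (by
        rw [oo_aff gx gy]
        have : oo (P u) (P v) (P u) = 0 := by simp only [oo]; ring
        rw [this]; nlinarith) hr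
      (fun k k1 k2 => blk w (Or.inr rfl) huw k k1 (by rw [segment_symm]; exact k2))
      (fun k k1 k2 => blk v (Or.inl rfl) huv k k1 k2)
    have hxT : x ∈ T := Finset.mem_filter.2 ⟨Finset.mem_univ _, r2, by linarith, r1⟩
    have := hmax x hxT
    linarith
  refine ⟨w, huw, ?_, hD, emp⟩
  by_contra hvw
  obtain ⟨x, y, g, hxy, xv, xw, yv, yw, g1, g2⟩ := hG.mx v w nvw hvw
  have hg0 := oo_seg g1
  wlog hr : 0 < oo (P v) (P w) (P x) generalizing x y
  · refine this y x hxy.symm yv yw xv xw (by rw [segment_symm]; exact g2) ?_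
    push Not at hr
    obtain ⟨c, c0, c1, hc⟩ := line_seg g2 (P v) (P w)
    rw [hg0] at hc
    have hx0 : oo (P v) (P w) (P x) < 0 :=
      lt_of_le_of_ne hr (hG.gp v w x nvw xv.symm xw.symm)
    by_contra hq
    have hy0 : oo (P v) (P w) (P y) < 0 :=
      lt_of_le_of_ne (not_lt.1 hq) (hG.gp v w y nvw yv.symm yw.symm)
    rcases eq_or_lt_of_le c0 with h' | h'
    · subst h'; linarith
    · have := mul_neg_of_pos_of_neg h' hy0
      have := mul_nonneg (by linarith : 0 ≤ 1 - c) (neg_nonneg.2 hr)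
      linarith
  have hyn : oo (P v) (P w) (P y) < 0 := by
    obtain ⟨c, c0, c1, hc⟩ := line_seg g2 (P v) (P w)
    rw [hg0] at hc
    have hc0 : 0 < c := by
      rcases eq_or_lt_of_le c0 with h' | h'
      · subst h'; linarith
      · exact h'
    by_contra hq
    have hy0 : 0 < oo (P v) (P w) (P y) :=
      lt_of_le_of_ne (not_lt.1 hq) (hG.gp v w y nvw yv.symm yw.symm).symm
    have := mul_pos hc0 hy0
    have := mul_nonneg (by linarith : 0 ≤ 1 - c) hr.le
    linarith
  obtain ⟨s, s0, s1, gx, gy⟩ := mem_seg g1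
  have s0' : s ≠ 0 := by
    rintro rfl
    rw [seg_zero gx gy] at g2
    rcases hG.on hxy.ne g2 with h | h
    · exact xv h.symm
    · exact yv h.symm
  have s1' : s ≠ 1 := by
    rintro rfl
    have : g = P w := by ext <;> simp [gx, gy]
    rw [this] at g2
    rcases hG.on hxy.ne g2 with h | h
    · exact xw h.symm
    · exact yw h.symm
  have s0'' : 0 < s := lt_of_le_of_ne s0 s0'.symm
  have s1'' : s < 1 := lt_of_le_of_ne s1 s1'
  have hgw : 0 < oo (P w) (P u) g := by
    rw [oo_aff gx gy]
    have : oo (P w) (P u) (P w) = 0 := by simp only [oo]; ring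
    rw [this]
    have : oo (P w) (P u) (P v) = oo (P u) (P v) (P w) := by simp only [oo]; ring
    rw [this]; nlinarith
  have hgv : 0 < oo (P u) (P v) g := by
    rw [oo_aff gx gy]
    have : oo (P u) (P v) (P v) = 0 := by simp only [oo]; ring
    rw [this]; nlinarith
  have yu : y ≠ u := by rintro rfl; linarith
  by_cases xu : x = u
  · subst xu
    obtain ⟨c, c0, c1, cx, cy⟩ := mem_seg g2
    have e1 := oo_aff (m := P x) (M := P v) cx cy
    have e2 := oo_aff (m := P w) (M := P x) cx cy
    have i1 : oo (P x) (P v) (P x) = 0 := by simp only [oo]; ring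
    have i2 : oo (P w) (P x) (P x) = 0 := by simp only [oo]; ring
    rw [i1] at e1
    rw [i2] at e2
    have p1 : 0 < oo (P x) (P v) (P y) := by
      by_contra h
      have := mul_nonneg c0 (by linarith : 0 ≤ - oo (P x) (P v) (P y))
      linarith
    have p2 : 0 < oo (P w) (P x) (P y) := by
      by_contra h
      have := mul_nonneg c0 (by linarith : 0 ≤ - oo (P w) (P x) (P y))
      linarith
    have := hmin' y hxy p1
    rw [oo_swap] at p2
    linarith
  · have sub : ∀ k, k ∈ segment ℝ g (P x) → k ∈ segment ℝ (P x) (P y) := fun k hk =>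
      seg_sub g2 (left_mem_segment ℝ _ _) hk
    obtain ⟨r1, r2⟩ := pasch (A := P v) (B := P w) (C := P u) (g := g) (r := P x) hD'
      hg0.ge hgw hgv (by rw [hg0]; exact hr.le)
      (fun k k1 k2 => hG.nc w u x y huw.symm hxy xw.symm yw.symm (Ne.symm xu) yu.symm k k2 (sub k k1))
      (fun k k1 k2 => hG.nc u v x y huv hxy (Ne.symm xu) yu.symm xv.symm yv.symm k k2 (sub k k1))
    exact emp x ⟨r2, hr, r1⟩

lemma uniqF (hG : Geo P G) {u v w w' : Y} (huw : G.Adj u w) (hvw : G.Adj v w)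
    (huw' : G.Adj u w') (hvw' : G.Adj v w')
    (h : 0 < oo (P u) (P v) (P w)) (h' : 0 < oo (P u) (P v) (P w'))
    (e : ∀ z, ¬ ins P u v w z) (e' : ∀ z, ¬ ins P u v w' z) : w = w' := by
  by_contra hne
  obtain ⟨nuv, nuw, nvw⟩ := ne_of_oo h
  obtain ⟨-, nuw', nvw'⟩ := ne_of_oo h'
  have a1 := hG.gp v w w' nvw nvw' hne
  have a2 := hG.gp w u w' nuw.symm hne nuw'
  have i1 : oo (P v) (P w') (P w) = - oo (P v) (P w) (P w') := oo_swap' _ _ _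
  have i2 : oo (P w') (P u) (P w) = - oo (P w) (P u) (P w') := by simp only [oo]; ring
  have i3 : oo (P u) (P w) (P w') = - oo (P w) (P u) (P w') := by simp only [oo]; ring
  have i4 : oo (P u) (P w) (P v) = - oo (P u) (P v) (P w) := by simp only [oo]; ring
  have i5 : oo (P v) (P w') (P u) = oo (P u) (P v) (P w') := by simp only [oo]; ring
  have i6 : oo (P v) (P w) (P u) = oo (P u) (P v) (P w) := by simp only [oo]; ring
  have i7 : oo (P u) (P w') (P v) = - oo (P u) (P v) (P w') := by simp only [oo]; ring
  have i8 : oo (P u) (P w') (P w) = oo (P w) (P u) (P w') := by simp only [oo]; ring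
  rcases lt_or_gt_of_ne a1 with b1 | b1 <;> rcases lt_or_gt_of_ne a2 with b2 | b2
  · exact e' w ⟨h, by rw [i1]; linarith, by rw [i2]; linarith⟩
  · obtain ⟨k, k1, k2⟩ := cross_pt (a := P v) (b := P w) (c := P u) (d := P w')
      (by rw [i6]; exact mul_neg_of_pos_of_neg h b1)
      (by rw [i7, i8]; exact mul_neg_of_neg_of_pos (by linarith) b2)
    exact hG.nc v w u w' hvw huw' nuv.symm nvw' nuw.symm hne k k1 k2
  · obtain ⟨k, k1, k2⟩ := cross_pt (a := P u) (b := P w) (c := P v) (d := P w')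
      (by rw [i3, i4]; exact mul_neg_of_neg_of_pos (by linarith) (by linarith))
      (by rw [i5, i1]; exact mul_neg_of_pos_of_neg h' (by linarith))
    exact hG.nc u w v w' huw hvw' nuv nuw' nvw.symm hne k k1 k2
  · exact e w' ⟨h', b1, b2⟩
end Geo

set_option linter.unusedSectionVars false
set_option linter.unusedVariables false

structure Geo2 {Y : Type} (P : Y → ℝ × ℝ) (G : SimpleGraph Y) (t1 t2 t3 : Y) : Prop extends Geo P G where
  e12 : G.Adj t1 t2
  e23 : G.Adj t2 t3
  e31 : G.Adj t3 t1
  pos : 0 < oo (P t1) (P t2) (P t3)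
  inn : ∀ z, z ≠ t1 → z ≠ t2 → z ≠ t3 → Geo.ins P t1 t2 t3 z
  ex : ∃ z, z ≠ t1 ∧ z ≠ t2 ∧ z ≠ t3

/-- inner oriented face -/
def tri {Y : Type} (P : Y → ℝ × ℝ) (G : SimpleGraph Y) (u v w : Y) : Prop :=
  G.Adj u v ∧ G.Adj v w ∧ G.Adj w u ∧ 0 < oo (P u) (P v) (P w) ∧ ∀ z, ¬ Geo.ins P u v w z

def outt {Y : Type} (t1 t2 t3 u v w : Y) : Prop :=
  (u = t1 ∧ v = t3 ∧ w = t2) ∨ (u = t3 ∧ v = t2 ∧ w = t1) ∨ (u = t2 ∧ v = t1 ∧ w = t3)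

def otri {Y : Type} (P : Y → ℝ × ℝ) (G : SimpleGraph Y) (t1 t2 t3 u v w : Y) : Prop :=
  tri P G u v w ∨ outt t1 t2 t3 u v w

open Classical in
noncomputable def faces {Y : Type} [Fintype Y] (P : Y → ℝ × ℝ) (G : SimpleGraph Y) (t1 t2 t3 : Y) :
    Finset (Finset Y) :=
  Finset.univ.filter (fun f => ∃ u v w, otri P G t1 t2 t3 u v w ∧ ∀ z, z ∈ f ↔ (z = u ∨ z = v ∨ z = w))

namespace Geo2
variable {Y : Type} [Fintype Y] [DecidableEq Y] {P : Y → ℝ × ℝ} {G : SimpleGraph Y} {t1 t2 t3 : Y}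

lemma rot {u v w : Y} (h : otri P G t1 t2 t3 u v w) : otri P G t1 t2 t3 v w u := by
  rcases h with ⟨a, b, c, d, e⟩ | h
  · refine Or.inl ⟨b, c, a, by rw [oo_cyc]; exact d, fun z hz => e z ⟨hz.2.2, hz.1, hz.2.1⟩⟩
  · right
    unfold outt at h ⊢
    tauto

lemma oadj (hG : Geo2 P G t1 t2 t3) {u v w : Y} (h : otri P G t1 t2 t3 u v w) :
    G.Adj u v ∧ G.Adj v w ∧ G.Adj w u := by
  rcases h with ⟨a, b, c, d, e⟩ | h
  · exact ⟨a, b, c⟩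
  · rcases h with ⟨rfl, rfl, rfl⟩ | ⟨rfl, rfl, rfl⟩ | ⟨rfl, rfl, rfl⟩
    · exact ⟨hG.e31.symm, hG.e23.symm, hG.e12.symm⟩
    · exact ⟨hG.e23.symm, hG.e12.symm, hG.e31.symm⟩
    · exact ⟨hG.e12.symm, hG.e31.symm, hG.e23.symm⟩

/-- nothing to the left of an outer edge -/
lemma out_left (hG : Geo2 P G t1 t2 t3) {u v w z : Y} (h : outt t1 t2 t3 u v w) :
    oo (P u) (P v) (P z) ≤ 0 := by
  have hp := hG.pos
  have key : ∀ a b, (oo (P b) (P a) (P z) ≥ 0) → oo (P a) (P b) (P z) ≤ 0 := by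
    intro a b h; rw [oo_swap]; linarith
  have z1 : ∀ a b, oo (P b) (P a) (P a) ≥ 0 := by
    intro a b; apply ge_of_eq; simp only [oo]; ring
  have z2 : ∀ a b, oo (P b) (P a) (P b) ≥ 0 := by
    intro a b; apply ge_of_eq; simp only [oo]; ring
  have c1 : oo (P t2) (P t3) (P t1) = oo (P t1) (P t2) (P t3) := oo_cyc _ _ _
  have c2 : oo (P t3) (P t1) (P t2) = oo (P t1) (P t2) (P t3) := by simp only [oo]; ring
  have hz : oo (P t1) (P t2) (P z) ≥ 0 ∧ oo (P t2) (P t3) (P z) ≥ 0 ∧ oo (P t3) (P t1) (P z) ≥ 0 := by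
    by_cases h1 : z = t1
    · subst h1; exact ⟨z2 _ _, by linarith, z1 _ _⟩
    by_cases h2 : z = t2
    · subst h2; exact ⟨z1 _ _, z2 _ _, by linarith⟩
    by_cases h3 : z = t3
    · subst h3; exact ⟨by linarith, z1 _ _, z2 _ _⟩
    obtain ⟨a, b, c⟩ := hG.inn z h1 h2 h3
    exact ⟨a.le, b.le, c.le⟩
  apply key
  rcases h with ⟨rfl, rfl, rfl⟩ | ⟨rfl, rfl, rfl⟩ | ⟨rfl, rfl, rfl⟩
  · exact hz.2.2
  · exact hz.2.1
  · exact hz.1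

lemma left_out (hG : Geo2 P G t1 t2 t3) {u v : Y} (huv : u ≠ v)
    (h : ∀ z, oo (P u) (P v) (P z) ≤ 0) : ∃ w, outt t1 t2 t3 u v w := by
  have n12 := hG.e12.ne
  have n23 := hG.e23.ne
  have n31 := hG.e31.ne
  have c1 : oo (P t2) (P t3) (P t1) = oo (P t1) (P t2) (P t3) := oo_cyc _ _ _
  have c2 : oo (P t3) (P t1) (P t2) = oo (P t1) (P t2) (P t3) := by simp only [oo]; ring
  have hp := hG.pos
  have mem : ∀ c d, (c = u ∧ d = v) ∨ (c = v ∧ d = u) → c = t1 ∨ c = t2 ∨ c = t3 := by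
    intro c d hc
    by_contra hn
    push Not at hn
    obtain ⟨a1, a2, a3⟩ := hG.inn c hn.1 hn.2.1 hn.2.2
    have hb : oo (P t2) (P t3) (P c) * oo (P u) (P v) (P t1) +
        oo (P t3) (P t1) (P c) * oo (P u) (P v) (P t2) +
        oo (P t1) (P t2) (P c) * oo (P u) (P v) (P t3) = 0 := by
      rcases hc with ⟨rfl, rfl⟩ | ⟨rfl, rfl⟩ <;> simp only [oo] <;> ring
    have m1 := mul_nonneg a2.le (neg_nonneg.2 (h t1))
    have m2 := mul_nonneg a3.le (neg_nonneg.2 (h t2))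
    have m3 := mul_nonneg a1.le (neg_nonneg.2 (h t3))
    have f1 : oo (P u) (P v) (P t1) = 0 := by
      have : oo (P t2) (P t3) (P c) * oo (P u) (P v) (P t1) = 0 := by linarith
      exact (mul_eq_zero.1 this).resolve_left a2.ne'
    have f2 : oo (P u) (P v) (P t2) = 0 := by
      have : oo (P t3) (P t1) (P c) * oo (P u) (P v) (P t2) = 0 := by linarith
      exact (mul_eq_zero.1 this).resolve_left a3.ne'
    have g1 : ∀ t, c ≠ t → oo (P u) (P v) (P t) = 0 → d = t := by
      intro t hct h0
      by_contra hdt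
      rcases hc with ⟨rfl, rfl⟩ | ⟨rfl, rfl⟩
      · exact hG.gp c d t huv hct hdt h0
      · exact hG.gp d c t huv hdt hct h0
    exact n12 ((g1 t1 hn.1 f1).symm.trans (g1 t2 hn.2.1 f2))
  have hu := mem u v (Or.inl ⟨rfl, rfl⟩)
  have hv := mem v u (Or.inr ⟨rfl, rfl⟩)
  unfold outt
  rcases hu with rfl | rfl | rfl <;> rcases hv with rfl | rfl | rfl
  · exact absurd rfl huv
  · have := h t3; linarith
  · exact ⟨t2, by tauto⟩
  · exact ⟨t3, by tauto⟩
  · exact absurd rfl huv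
  · have := h t1; linarith
  · have := h t2; linarith
  · exact ⟨t1, by tauto⟩
  · exact absurd rfl huv

lemma exl (hG : Geo2 P G t1 t2 t3) {u v : Y} (huv : G.Adj u v) :
    ∃ w, otri P G t1 t2 t3 u v w := by
  by_cases h : ∀ z, oo (P u) (P v) (P z) ≤ 0
  · obtain ⟨w, hw⟩ := hG.left_out huv.ne h
    exact ⟨w, Or.inr hw⟩
  · push Not at h
    obtain ⟨z, hz⟩ := h
    obtain ⟨w, a, b, c, d⟩ := hG.lemF huv hz
    exact ⟨w, Or.inl ⟨huv, b, a.symm, c, d⟩⟩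

lemma uniq (hG : Geo2 P G t1 t2 t3) {u v w w' : Y} (h : otri P G t1 t2 t3 u v w)
    (h' : otri P G t1 t2 t3 u v w') : w = w' := by
  rcases h with ⟨a, b, c, d, e⟩ | h <;> rcases h' with ⟨a', b', c', d', e'⟩ | h'
  · exact hG.uniqF c.symm b c'.symm b' d d' e e'
  · exact absurd (hG.out_left h' (z := w)) (not_le.2 d)
  · exact absurd (hG.out_left h (z := w')) (not_le.2 d')
  · have n12 := hG.e12.ne
    have n23 := hG.e23.ne
    have n31 := hG.e31.ne
    unfold outt at h h'
    rcases h with ⟨rfl, rfl, rfl⟩ | ⟨rfl, rfl, rfl⟩ | ⟨rfl, rfl, rfl⟩ <;>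
      rcases h' with ⟨h1, h2, h3⟩ | ⟨h1, h2, h3⟩ | ⟨h1, h2, h3⟩ <;> simp_all

lemma opp (hG : Geo2 P G t1 t2 t3) {u v w w' : Y} (h : otri P G t1 t2 t3 u v w)
    (h' : otri P G t1 t2 t3 v u w') : w ≠ w' := by
  rintro rfl
  have no : ∀ a b c, tri P G a b c → outt t1 t2 t3 b a c → False := by
    rintro a b c ⟨_, _, _, _, e⟩ h
    obtain ⟨z, z1, z2, z3⟩ := hG.ex
    obtain ⟨i1, i2, i3⟩ := hG.inn z z1 z2 z3
    apply e z
    rcases h with ⟨rfl, rfl, rfl⟩ | ⟨rfl, rfl, rfl⟩ | ⟨rfl, rfl, rfl⟩ <;>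
      exact ⟨by assumption, by assumption, by assumption⟩
  rcases h with h | h <;> rcases h' with h' | h'
  · have := h.2.2.2.1
    have := h'.2.2.2.1
    rw [oo_swap] at this
    linarith
  · exact no _ _ _ h h'
  · exact no _ _ _ h' h
  · have n12 := hG.e12.ne
    have n23 := hG.e23.ne
    have n31 := hG.e31.ne
    unfold outt at h h'
    rcases h with ⟨rfl, rfl, rfl⟩ | ⟨rfl, rfl, rfl⟩ | ⟨rfl, rfl, rfl⟩ <;>
      rcases h' with ⟨h1, h2, h3⟩ | ⟨h1, h2, h3⟩ | ⟨h1, h2, h3⟩ <;> first | exact n12 h1 | exact n12 h1.symm | exact n23 h1 | exact n23 h1.symm | exact n31 h1 | exact n31 h1.symm | exact n12 h2 | exact n12 h2.symm | exact n23 h2 | exact n23 h2.symm | exact n31 h2 | exact n31 h2.symm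

lemma mem_faces {f : Finset Y} : f ∈ faces P G t1 t2 t3 ↔
    ∃ u v w, otri P G t1 t2 t3 u v w ∧ f = {u, v, w} := by
  unfold faces
  simp only [Finset.mem_filter, Finset.mem_univ, true_and]
  constructor
  · rintro ⟨u, v, w, h, hf⟩
    exact ⟨u, v, w, h, by ext z; simp [hf]⟩
  · rintro ⟨u, v, w, h, rfl⟩
    exact ⟨u, v, w, h, by simp⟩

/-- faces through a vertex -/
lemma face_at {f : Finset Y} (hf : f ∈ faces P G t1 t2 t3) {v : Y} (hv : v ∈ f) :
    ∃ u w, otri P G t1 t2 t3 v u w ∧ f = {v, u, w} := by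
  obtain ⟨a, b, c, h, rfl⟩ := mem_faces.1 hf
  simp only [Finset.mem_insert, Finset.mem_singleton] at hv
  rcases hv with rfl | rfl | rfl
  · exact ⟨b, c, h, rfl⟩
  · exact ⟨c, a, rot h, by ext; simp; tauto⟩
  · exact ⟨a, b, rot (rot h), by ext; simp; tauto⟩

lemma face_edge {f : Finset Y} (hf : f ∈ faces P G t1 t2 t3) {u v : Y} (hu : u ∈ f) (hv : v ∈ f)
    (huv : u ≠ v) : ∃ w, (otri P G t1 t2 t3 u v w ∨ otri P G t1 t2 t3 v u w) ∧ f = {u, v, w} := by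
  obtain ⟨b, c, h, rfl⟩ := face_at hf hu
  simp only [Finset.mem_insert, Finset.mem_singleton] at hv
  rcases hv with rfl | rfl | rfl
  · exact absurd rfl huv
  · exact ⟨c, Or.inl h, rfl⟩
  · exact ⟨b, Or.inr (rot (rot h)), by ext; simp; tauto⟩

lemma ed_iff (hG : Geo2 P G t1 t2 t3) {u v : Y} : ed (faces P G t1 t2 t3) u v ↔ G.Adj u v := by
  constructor
  · rintro ⟨huv, f, hf, hu, hv⟩
    obtain ⟨w, h | h, rfl⟩ := face_edge hf hu hv huv
    · exact (hG.oadj h).1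
    · exact (hG.oadj h).1.symm
  · intro h
    obtain ⟨w, hw⟩ := hG.exl h
    exact ⟨h.ne, {u, v, w}, mem_faces.2 ⟨u, v, w, hw, rfl⟩, by simp, by simp⟩

lemma card3 (hG : Geo2 P G t1 t2 t3) {f : Finset Y} (hf : f ∈ faces P G t1 t2 t3) : f.card = 3 := by
  obtain ⟨u, v, w, h, rfl⟩ := mem_faces.1 hf
  obtain ⟨a, b, c⟩ := hG.oadj h
  exact Finset.card_eq_three.2 ⟨u, v, w, a.ne, c.ne.symm, b.ne, rfl⟩

lemma two_eq (hG : Geo2 P G t1 t2 t3) {u v w w' : Y} (h : otri P G t1 t2 t3 u v w)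
    (h' : otri P G t1 t2 t3 v u w') :
    (faces P G t1 t2 t3).filter (fun f => u ∈ f ∧ v ∈ f) = {{u, v, w}, {u, v, w'}} ∧
     ({u, v, w} : Finset Y) ≠ {u, v, w'} := by
  constructor
  · ext f
    simp only [Finset.mem_filter, Finset.mem_insert, Finset.mem_singleton]
    constructor
    · rintro ⟨hf, hu, hv⟩
      obtain ⟨c, hc | hc, rfl⟩ := face_edge hf hu hv (hG.oadj h).1.ne
      · left; rw [hG.uniq h hc]
      · right; rw [hG.uniq h' hc]
    · rintro (rfl | rfl)
      · exact ⟨mem_faces.2 ⟨u, v, w, h, rfl⟩, by simp, by simp⟩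
      · exact ⟨mem_faces.2 ⟨v, u, w', h', by ext; simp; tauto⟩, by simp, by simp⟩
  · intro he
    have : w ∈ ({u, v, w'} : Finset Y) := by rw [← he]; simp
    simp only [Finset.mem_insert, Finset.mem_singleton] at this
    obtain ⟨a, b, c⟩ := hG.oadj h
    rcases this with h1 | h1 | h1
    · exact c.ne h1
    · exact b.ne h1.symm
    · exact hG.opp h h' h1

lemma bd_eq (hG : Geo2 P G t1 t2 t3) (B : Finset Y → ZMod 2) {u v w w' : Y}
    (h : otri P G t1 t2 t3 u v w) (h' : otri P G t1 t2 t3 v u w') :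
    bd (faces P G t1 t2 t3) B u v = B {u, v, w} + B {u, v, w'} := by
  obtain ⟨h1, h2⟩ := hG.two_eq h h'
  unfold bd
  rw [if_neg (hG.oadj h).1.ne, h1, Finset.sum_pair h2]

/-- Claim R -/
lemma claimR (hG : Geo2 P G t1 t2 t3) {v u w u' : Y} (hvw : G.Adj v w)
    (ho : 0 < oo (P v) (P u) (P w)) (h : otri P G t1 t2 t3 v u u') :
    0 < oo (P v) (P u) (P u') ∧ (u' = w ∨ 0 < oo (P v) (P u') (P w)) := by
  rcases h with ⟨a, b, c, d, e⟩ | h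
  · refine ⟨d, ?_⟩
    by_contra hn
    push Not at hn
    obtain ⟨hne, hle⟩ := hn
    obtain ⟨n1, n2, n3⟩ := Geo.ne_of_oo ho
    have hlt : oo (P v) (P u') (P w) < 0 := lt_of_le_of_ne hle (hG.gp v u' w c.ne.symm n2 hne)
    have i1 : oo (P u') (P v) (P w) = - oo (P v) (P u') (P w) := oo_swap _ _ _
    have hneg : oo (P u) (P u') (P w) < 0 := by
      refine lt_of_le_of_ne ?_ (hG.gp u u' w b.ne n3 hne)
      by_contra hp
      exact e w ⟨ho, not_le.1 hp, by rw [i1]; linarith⟩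
    have i2 : oo (P v) (P w) (P u) = - oo (P v) (P u) (P w) := oo_swap' _ _ _
    have i3 : oo (P v) (P w) (P u') = - oo (P v) (P u') (P w) := oo_swap' _ _ _
    have i4 : oo (P u) (P u') (P v) = oo (P v) (P u) (P u') := oo_cyc _ _ _
    obtain ⟨k, k1, k2⟩ := cross_pt (a := P v) (b := P w) (c := P u) (d := P u')
      (by rw [i2, i3]; exact mul_neg_of_neg_of_pos (by linarith) (by linarith))
      (by rw [i4]; exact mul_neg_of_pos_of_neg d hneg)
    exact hG.nc v w u u' hvw b n1 c.ne.symm n3.symm (Ne.symm hne) k k1 k2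
  · exact absurd (hG.out_left h (z := w)) (not_le.2 ho)

/-- same vertical side -/
def sd (P : Y → ℝ × ℝ) (v p q : Y) : Prop := 0 < ((P p).2 - (P v).2) * ((P q).2 - (P v).2)

noncomputable def sl (P : Y → ℝ × ℝ) (v p : Y) : ℝ := ((P p).1 - (P v).1) / ((P p).2 - (P v).2)

lemma sl_lt {v p q : Y} (h : sd P v p q) : 0 < oo (P v) (P p) (P q) ↔ sl P v q < sl P v p := by
  unfold sd at h
  have hp : (P p).2 - (P v).2 ≠ 0 := left_ne_zero_of_mul h.ne'
  have hq : (P q).2 - (P v).2 ≠ 0 := right_ne_zero_of_mul h.ne'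
  have key : oo (P v) (P p) (P q) = (((P p).2 - (P v).2) * ((P q).2 - (P v).2)) *
      (sl P v p - sl P v q) := by
    simp only [oo, sl]; field_simp
  rw [key, mul_pos_iff_of_pos_left h, sub_pos]

lemma sd_mid {v u w u' : Y} (h : sd P v u w) (ho : 0 < oo (P v) (P u) (P w))
    (h1 : 0 < oo (P v) (P u) (P u')) (h2 : u' = w ∨ 0 < oo (P v) (P u') (P w)) :
    sd P v u u' ∧ sd P v u' w := by
  unfold sd at *
  have hw : 0 < ((P w).2 - (P v).2) * ((P w).2 - (P v).2) :=
    mul_self_pos.2 (right_ne_zero_of_mul h.ne')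
  have hu : 0 < ((P u).2 - (P v).2) * ((P u).2 - (P v).2) :=
    mul_self_pos.2 (left_ne_zero_of_mul h.ne')
  rcases h2 with rfl | h2
  · exact ⟨h, hw⟩
  · have key : oo (P v) (P u) (P w) * ((P u').2 - (P v).2) = oo (P v) (P u') (P w) * ((P u).2 - (P v).2)
        + oo (P v) (P u) (P u') * ((P w).2 - (P v).2) := by simp only [oo]; ring
    constructor
    · have k : oo (P v) (P u) (P w) * (((P u).2 - (P v).2) * ((P u').2 - (P v).2)) =
          oo (P v) (P u') (P w) * (((P u).2 - (P v).2) * ((P u).2 - (P v).2)) +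
          oo (P v) (P u) (P u') * (((P u).2 - (P v).2) * ((P w).2 - (P v).2)) := by
        linear_combination ((P u).2 - (P v).2) * key
      have m1 := mul_pos h2 hu
      have m2 := mul_pos h1 h
      exact pos_of_mul_pos_right (by rw [k]; linarith :
        0 < oo (P v) (P u) (P w) * (((P u).2 - (P v).2) * ((P u').2 - (P v).2))) ho.le
    · have k : oo (P v) (P u) (P w) * (((P u').2 - (P v).2) * ((P w).2 - (P v).2)) =
          oo (P v) (P u') (P w) * (((P u).2 - (P v).2) * ((P w).2 - (P v).2)) +
          oo (P v) (P u) (P u') * (((P w).2 - (P v).2) * ((P w).2 - (P v).2)) := by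
        linear_combination ((P w).2 - (P v).2) * key
      have m1 := mul_pos h2 h
      have m2 := mul_pos h1 hw
      exact pos_of_mul_pos_right (by rw [k]; linarith :
        0 < oo (P v) (P u) (P w) * (((P u').2 - (P v).2) * ((P w).2 - (P v).2))) ho.le
end Geo2

set_option linter.unusedSectionVars false
set_option linter.unusedVariables false

namespace Geo2
variable {Y : Type} [Fintype Y] [DecidableEq Y] {P : Y → ℝ × ℝ} {G : SimpleGraph Y} {t1 t2 t3 : Y}

/-- rotating around a vertex keeps the value -/
lemma step (hG : Geo2 P G t1 t2 t3) {v : Y} {B : Finset Y → ZMod 2}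
    (hB : ∀ u, bd (faces P G t1 t2 t3) B v u = 0) {u w x : Y}
    (h : otri P G t1 t2 t3 v u w) (h' : otri P G t1 t2 t3 v w x) : B {v, u, w} = B {v, w, x} := by
  have h2 : otri P G t1 t2 t3 w v u := rot (rot h)
  have := hG.bd_eq B h' h2
  rw [hB w] at this
  have e : ({v, w, u} : Finset Y) = {v, u, w} := by ext; simp; tauto
  rw [e] at this
  rcases zt (B {v, u, w}) with h3 | h3 <;> rcases zt (B {v, w, x}) with h4 | h4 <;>
    rw [h3, h4] at this <;> revert this <;> simp [h3, h4]

lemma link (hG : Geo2 P G t1 t2 t3) (v : Y) (B : Finset Y → ZMod 2)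
    (hB : ∀ u, bd (faces P G t1 t2 t3) B v u = 0) :
    ∀ f ∈ faces P G t1 t2 t3, ∀ g ∈ faces P G t1 t2 t3, v ∈ f → v ∈ g → B f = B g := by
  classical
  choose! L hL using fun u (h : G.Adj v u) => hG.exl h
  have hLadj : ∀ u, G.Adj v u → G.Adj v (L u) := fun u h => (hG.oadj (hL u h)).2.2.symm
  have st : ∀ u, G.Adj v u → B {v, u, L u} = B {v, L u, L (L u)} := fun u h =>
    hG.step hB (hL u h) (hL _ (hLadj u h))
  -- same side
  have ss0 : ∀ w, G.Adj v w → ∀ u, G.Adj v u → sd P v u w → 0 < oo (P v) (P u) (P w) →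
      B {v, u, L u} = B {v, w, L w} := by
    intro w hw
    by_contra hcon
    push Not at hcon
    obtain ⟨u0, a0, b0, c0, d0⟩ := hcon
    let S : Finset Y := Finset.univ.filter (fun u => G.Adj v u ∧ sd P v u w ∧
      0 < oo (P v) (P u) (P w) ∧ B {v, u, L u} ≠ B {v, w, L w})
    obtain ⟨u, hu, hmin⟩ := S.exists_min_image (sl P v)
      ⟨u0, Finset.mem_filter.2 ⟨Finset.mem_univ _, a0, b0, c0, d0⟩⟩
    obtain ⟨-, a, b, c, d⟩ := Finset.mem_filter.1 hu
    obtain ⟨r1, r2⟩ := hG.claimR hw c (hL u a)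
    obtain ⟨s1, s2⟩ := sd_mid b c r1 r2
    rcases r2 with r2 | r2
    · apply d; rw [st u a, r2]
    · have : L u ∈ S := Finset.mem_filter.2 ⟨Finset.mem_univ _, hLadj u a, s2, r2, by
        rw [← st u a]; exact d⟩
      have h1 := hmin _ this
      have h2 := (sl_lt s1).1 r1
      linarith
  have ss : ∀ w, G.Adj v w → ∀ u, G.Adj v u → sd P v u w → B {v, u, L u} = B {v, w, L w} := by
    intro w hw u hu hs
    by_cases huw : u = w
    · rw [huw]
    rcases lt_or_gt_of_ne (hG.gp v u w hu.ne hw.ne huw) with h | h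
    · refine (ss0 u hu w hw ?_ (by rw [oo_swap']; linarith)).symm
      unfold sd at *; linarith
    · exact ss0 w hw u hu hs h
  -- connecting
  have con : ∀ u w, G.Adj v u → G.Adj v w → (P u).2 < (P v).2 → (P v).2 < (P w).2 →
      B {v, u, L u} = B {v, w, L w} := by
    intro u0 w hu0 hw hu0v hwv
    let S : Finset Y := Finset.univ.filter (fun u => G.Adj v u ∧ (P u).2 < (P v).2)
    obtain ⟨u, hu, hmin⟩ := S.exists_min_image (sl P v)
      ⟨u0, Finset.mem_filter.2 ⟨Finset.mem_univ _, hu0, hu0v⟩⟩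
    obtain ⟨-, a, b⟩ := Finset.mem_filter.1 hu
    have up : (P v).2 < (P (L u)).2 := by
      by_contra hn
      have hlt : (P (L u)).2 < (P v).2 := lt_of_le_of_ne (not_lt.1 hn) (hG.yi _ _ (hLadj u a).ne.symm)
      have hsd : sd P v u (L u) := mul_pos_of_neg_of_neg (by linarith) (by linarith)
      rcases hL u a with ⟨_, _, _, d, _⟩ | ho
      · have h1 := hmin (L u) (Finset.mem_filter.2 ⟨Finset.mem_univ _, hLadj u a, hlt⟩)
        have h2 := (sl_lt hsd).1 d
        linarith
      · -- v is the top vertex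
        have hwn : w ≠ t1 ∧ w ≠ t2 ∧ w ≠ t3 := by
          rcases ho with ⟨h1, h2, h3⟩ | ⟨h1, h2, h3⟩ | ⟨h1, h2, h3⟩ <;> rw [h3] at hlt <;> rw [h2] at b <;>
            rw [h1] at hwv b hlt <;>
            refine ⟨?_, ?_, ?_⟩ <;> rintro rfl <;> linarith
        obtain ⟨i1, i2, i3⟩ := hG.inn w hwn.1 hwn.2.1 hwn.2.2
        have hp := hG.pos
        have key : oo (P t2) (P t3) (P w) * ((P t1).2 - (P w).2) +
          oo (P t3) (P t1) (P w) * ((P t2).2 - (P w).2) +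
          oo (P t1) (P t2) (P w) * ((P t3).2 - (P w).2) = 0 := by simp only [oo]; ring
        have hall : (P t1).2 - (P w).2 < 0 ∧ (P t2).2 - (P w).2 < 0 ∧ (P t3).2 - (P w).2 < 0 := by
          rcases ho with ⟨h1, h2, h3⟩ | ⟨h1, h2, h3⟩ | ⟨h1, h2, h3⟩ <;> rw [h3] at hlt <;> rw [h2] at b <;>
            rw [h1] at hwv b hlt <;>
            refine ⟨?_, ?_, ?_⟩ <;> linarith
        have m1 := mul_neg_of_pos_of_neg i2 hall.1
        have m2 := mul_neg_of_pos_of_neg i3 hall.2.1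
        have m3 := mul_neg_of_pos_of_neg i1 hall.2.2
        linarith
    calc B {v, u0, L u0} = B {v, u, L u} := ss u a u0 hu0 (mul_pos_of_neg_of_neg (by linarith) (by linarith))
      _ = B {v, L u, L (L u)} := st u a
      _ = B {v, w, L w} := ss w hw _ (hLadj u a) (mul_pos (by linarith) (by linarith))
  have all : ∀ u w, G.Adj v u → G.Adj v w → B {v, u, L u} = B {v, w, L w} := by
    intro u w hu hw
    rcases lt_or_gt_of_ne (hG.yi u v hu.ne.symm) with h1 | h1 <;>
      rcases lt_or_gt_of_ne (hG.yi w v hw.ne.symm) with h2 | h2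
    · exact ss w hw u hu (mul_pos_of_neg_of_neg (by linarith) (by linarith))
    · exact con u w hu hw h1 h2
    · exact (con w u hw hu h2 h1).symm
    · exact ss w hw u hu (mul_pos (by linarith) (by linarith))
  intro f hf g hg hvf hvg
  obtain ⟨u, u', hu, rfl⟩ := face_at hf hvf
  obtain ⟨w, w', hw, rfl⟩ := face_at hg hvg
  have a1 := (hG.oadj hu).1
  have a2 := (hG.oadj hw).1
  rw [hG.uniq hu (hL u a1), hG.uniq hw (hL w a2)]
  exact all u w a1 a2

lemma conn (hG : Geo2 P G t1 t2 t3) (B : Finset Y → ZMod 2) (hB : bd (faces P G t1 t2 t3) B = 0) :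
    ∀ f ∈ faces P G t1 t2 t3, ∀ g ∈ faces P G t1 t2 t3, B f = B g := by
  classical
  have hlink : ∀ v, ∀ f ∈ faces P G t1 t2 t3, ∀ g ∈ faces P G t1 t2 t3, v ∈ f → v ∈ g → B f = B g :=
    fun v => hG.link v B (fun u => by rw [hB]; rfl)
  obtain ⟨top, -, htop⟩ := Finset.univ.exists_max_image (fun v => (P v).2) ⟨t1, Finset.mem_univ _⟩
  have hlow : ∃ z, (P z).2 < (P top).2 := by
    by_contra hn
    push Not at hn
    have a := le_antisymm (htop t1 (Finset.mem_univ _)) (hn t1)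
    have b := le_antisymm (htop t2 (Finset.mem_univ _)) (hn t2)
    exact hG.yi t1 t2 hG.e12.ne (by rw [a, b])
  obtain ⟨z, hz⟩ := hlow
  obtain ⟨w, hw, -⟩ := hG.lemV 0 (-1) (u := top) (z := z) (by linarith)
  obtain ⟨w', hw'⟩ := hG.exl hw
  have hf0 : ({top, w, w'} : Finset Y) ∈ faces P G t1 t2 t3 := mem_faces.2 ⟨_, _, _, hw', rfl⟩
  have key : ∀ v, ∀ f ∈ faces P G t1 t2 t3, v ∈ f → B f = B {top, w, w'} := by
    by_contra hcon
    let S : Finset Y := Finset.univ.filter (fun v => ¬ ∀ f ∈ faces P G t1 t2 t3, v ∈ f → B f = B {top, w, w'})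
    have hS : S.Nonempty := by
      push Not at hcon
      obtain ⟨v, hv⟩ := hcon
      exact ⟨v, Finset.mem_filter.2 ⟨Finset.mem_univ _, by push Not; exact hv⟩⟩
    obtain ⟨v, hv, hmax⟩ := S.exists_max_image (fun v => (P v).2) hS
    have hv2 := (Finset.mem_filter.1 hv).2
    by_cases hvt : v = top
    · subst hvt
      exact hv2 (fun f hf hvf => hlink v f hf _ hf0 hvf (by simp))
    · have hlt : (P v).2 < (P top).2 :=
        lt_of_le_of_ne (htop v (Finset.mem_univ _)) (hG.yi _ _ hvt)
      obtain ⟨x, hx, hxy⟩ := hG.lemV 0 1 (u := v) (z := top) (by linarith)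
      obtain ⟨x', hx'⟩ := hG.exl hx
      have hg : ({v, x, x'} : Finset Y) ∈ faces P G t1 t2 t3 := mem_faces.2 ⟨_, _, _, hx', rfl⟩
      have hxS : x ∉ S := by
        intro h
        have := hmax x h
        linarith
      have hx2 : ∀ f ∈ faces P G t1 t2 t3, x ∈ f → B f = B {top, w, w'} := by
        by_contra h
        exact hxS (Finset.mem_filter.2 ⟨Finset.mem_univ _, h⟩)
      exact hv2 (fun f hf hvf => (hlink v f hf _ hg hvf (by simp)).trans (hx2 _ hg (by simp)))
  intro f hf g hg
  obtain ⟨u, v, x, h, rfl⟩ := mem_faces.1 hf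
  obtain ⟨u', v', x', h', rfl⟩ := mem_faces.1 hg
  rw [key u _ hf (by simp), key u' _ hg (by simp)]

noncomputable def ky (P : Y → ℝ × ℝ) (e : Y × Y) : ℝ ×ₗ ℝ := toLex ((P e.1).2, sl P e.1 e.2)

lemma h1 (hG : Geo2 P G t1 t2 t3) : ∀ (n : ℕ) (z : Y → Y → ZMod 2), (∀ u v, z u v = z v u) →
    (∀ u v, z u v ≠ 0 → G.Adj u v) → (∀ v, ∑ u, z v u = 0) →
    (∃ T : Finset (Y × Y), T.card ≤ n ∧ ∀ u v, z v u ≠ 0 → (P u).2 < (P v).2 →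
      ∀ e, ky P e ≤ ky P (v, u) → e ∈ T) →
    ∃ B, bd (faces P G t1 t2 t3) B = z := by
  classical
  intro n
  induction n with
  | zero =>
    rintro z hs he hsum ⟨T, hT, h⟩
    have hT0 : T = ∅ := Finset.card_eq_zero.1 (by omega)
    refine ⟨0, ?_⟩
    funext u v
    have : bd (faces P G t1 t2 t3) (0 : Finset Y → ZMod 2) u v = 0 := by simp [bd]
    rw [this]
    by_contra hz
    have hz : z u v ≠ 0 := fun h => hz h.symm
    have hne := (he u v hz).ne
    rcases lt_or_gt_of_ne (hG.yi u v hne) with h1 | h1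
    · have := h u v (by rw [hs]; exact hz) h1 (v, u) le_rfl
      rw [hT0] at this; simp at this
    · have := h v u hz h1 (u, v) le_rfl
      rw [hT0] at this; simp at this
  | succ n ih =>
    rintro z hs he hsum ⟨T, hT, h⟩
    let S : Finset (Y × Y) := Finset.univ.filter (fun e => z e.1 e.2 ≠ 0 ∧ (P e.2).2 < (P e.1).2)
    rcases S.eq_empty_or_nonempty with hS | hS
    · refine ih z hs he hsum ⟨∅, by simp, ?_⟩
      intro u v h1 h2
      have : (v, u) ∈ S := Finset.mem_filter.2 ⟨Finset.mem_univ _, h1, h2⟩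
      rw [hS] at this; simp at this
    obtain ⟨⟨v, u⟩, hvu, hmax⟩ := S.exists_max_image (ky P) hS
    obtain ⟨-, hz, hlt⟩ := Finset.mem_filter.1 hvu
    simp only at hz hlt
    have hvuadj := he _ _ hz
    -- second edge
    obtain ⟨w, hwu, hw⟩ : ∃ w, w ≠ u ∧ z v w ≠ 0 := by
      by_contra hcon
      push Not at hcon
      have := hsum v
      rw [Finset.sum_eq_single u (fun b _ hb => hcon b hb) (by simp)] at this
      exact hz this
    have hvw := he _ _ hw
    have hwv : (P w).2 < (P v).2 := by
      by_contra hn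
      have hlt' : (P v).2 < (P w).2 := lt_of_le_of_ne (not_lt.1 hn) (hG.yi _ _ hvw.ne)
      have := hmax (w, v) (Finset.mem_filter.2 ⟨Finset.mem_univ _, by simp only; rw [hs]; exact hw, hlt'⟩)
      rw [ky, ky, Prod.Lex.toLex_le_toLex] at this
      simp only at this
      rcases this with h | ⟨h, -⟩ <;> linarith
    have hsd : sd P v u w := mul_pos_of_neg_of_neg (by linarith) (by linarith)
    have hsd' : sd P v w u := mul_pos_of_neg_of_neg (by linarith) (by linarith)
    have ho : 0 < oo (P v) (P u) (P w) := by
      by_contra hn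
      have hneg : oo (P v) (P u) (P w) < 0 :=
        lt_of_le_of_ne (not_lt.1 hn) (hG.gp v u w hvuadj.ne hvw.ne hwu.symm)
      have h1 : sl P v u < sl P v w := (sl_lt hsd').1 (by rw [oo_swap']; linarith)
      have := hmax (v, w) (Finset.mem_filter.2 ⟨Finset.mem_univ _, hw, hwv⟩)
      rw [ky, ky, Prod.Lex.toLex_le_toLex] at this
      simp only at this
      rcases this with h | ⟨-, h⟩ <;> linarith
    obtain ⟨u', hu'⟩ := hG.exl hvuadj
    obtain ⟨r1, r2⟩ := hG.claimR hvw ho hu'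
    obtain ⟨s1, s2⟩ := sd_mid hsd ho r1 r2
    have hu'v : (P u').2 < (P v).2 := by
      by_contra hn
      unfold sd at s1
      have : ((P u).2 - (P v).2) * ((P u').2 - (P v).2) ≤ 0 :=
        mul_nonpos_of_nonpos_of_nonneg (by linarith) (by linarith)
      linarith
    have hsl := (sl_lt s1).1 r1
    obtain ⟨a1, a2, a3⟩ := hG.oadj hu'
    have hf : ({v, u, u'} : Finset Y) ∈ faces P G t1 t2 t3 := mem_faces.2 ⟨_, _, _, hu', rfl⟩
    have hbs := bd_single hf a1.ne a3.ne a2.ne.symm rfl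
    obtain ⟨D, hD⟩ : ∃ D : Y → Y → ZMod 2, D = bd (faces P G t1 t2 t3) (Pi.single {v, u, u'} 1) := ⟨_, rfl⟩
    have hDs : ∀ x y, D x y = D y x := fun x y => by rw [hD]; exact bd_symm _ _ _ _
    have hz1 : z v u = 1 := (zt _).resolve_left hz
    have hD1 : D v u = 1 := by
      rw [hD, hbs]; simp [eg, a1.ne, a1.ne.symm, a2.ne, a3.ne, a2.ne.symm, a3.ne.symm]
    suffices hsuf : ∃ B, bd (faces P G t1 t2 t3) B = z + D by
      obtain ⟨B, hB⟩ := hsuf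
      refine ⟨B + Pi.single {v, u, u'} 1, ?_⟩
      rw [bd_add, hB, ← hD]
      funext x y
      simp only [Pi.add_apply]
      rw [add_assoc, CharTwo.add_self_eq_zero, add_zero]
    refine ih (z + D) ?_ ?_ ?_ ?_
    · intro x y
      simp only [Pi.add_apply]
      rw [hs x y, hDs x y]
    · intro x y hxy
      simp only [Pi.add_apply] at hxy
      by_cases h0 : z x y = 0
      · rw [h0, zero_add, hD] at hxy
        exact (hG.ed_iff).1 (bd_ed hxy)
      · exact he _ _ h0
    · intro x
      simp only [Pi.add_apply]
      rw [Finset.sum_add_distrib, hsum x, hD, bd_even (fun f hf => hG.card3 hf), add_zero]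
    · refine ⟨T.erase (v, u), ?_, ?_⟩
      · have := h u v hz hlt (v, u) le_rfl
        rw [Finset.card_erase_of_mem this]; omega
      · intro x y hxy hlt' e hle
        simp only [Pi.add_apply] at hxy
        have hlt2 : ky P (y, x) < ky P (v, u) := by
          by_cases hDxy : D y x = 0
          · rw [hDxy, add_zero] at hxy
            have hm := hmax (y, x) (Finset.mem_filter.2 ⟨Finset.mem_univ _, hxy, hlt'⟩)
            refine lt_of_le_of_ne hm ?_
            intro heq
            simp only [ky, toLex_inj, Prod.mk.injEq] at heq
            have hyv : y = v := by
              by_contra hne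
              exact hG.yi _ _ hne heq.1
            subst hyv
            by_cases hxu : x = u
            · subst hxu; rw [hD1] at hDxy; exact one_ne_zero hDxy
            have hsdx : sd P y x u := mul_pos_of_neg_of_neg (by linarith) (by linarith)
            have hsdx' : sd P y u x := mul_pos_of_neg_of_neg (by linarith) (by linarith)
            have hyx := he _ _ hxy
            rcases lt_or_gt_of_ne (hG.gp y x u hyx.ne a1.ne hxu) with h1 | h1
            · have := (sl_lt hsdx').1 (by rw [oo_swap']; linarith)
              linarith [heq.2]
            · have := (sl_lt hsdx).1 h1
              linarith [heq.2]
          · rw [hD, hbs] at hDxy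
            have hcases : (y = v ∧ x = u) ∨ (y = v ∧ x = u') ∨ (P y).2 < (P v).2 := by
              by_contra hn
              push Not at hn
              obtain ⟨n1, n2, n3⟩ := hn
              apply hDxy
              have nu : y ≠ u := by rintro rfl; linarith
              have nu' : y ≠ u' := by rintro rfl; linarith
              simp only [Pi.add_apply, eg]
              rw [if_neg, if_neg, if_neg]
              · simp
              · rintro (⟨h1, h2⟩ | ⟨h1, h2⟩)
                · exact nu h1
                · exact nu' h1
              · rintro (⟨h1, h2⟩ | ⟨h1, h2⟩)
                · exact n2 h1 h2
                · exact nu' h1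
              · rintro (⟨h1, h2⟩ | ⟨h1, h2⟩)
                · exact n1 h1 h2
                · exact nu h1
            rcases hcases with ⟨rfl, rfl⟩ | ⟨rfl, rfl⟩ | hc
            · exfalso
              apply hxy
              rw [hz1, hD1]; decide
            · rw [ky, ky, Prod.Lex.toLex_lt_toLex]
              exact Or.inr ⟨rfl, hsl⟩
            · rw [ky, ky, Prod.Lex.toLex_lt_toLex]
              exact Or.inl hc
        refine Finset.mem_erase.2 ⟨?_, h u v hz hlt e (hle.trans hlt2.le)⟩
        rintro rfl
        exact absurd (lt_of_le_of_lt hle hlt2) (lt_irrefl _)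

lemma sph (hG : Geo2 P G t1 t2 t3) : Sph (faces P G t1 t2 t3) where
  card3 f hf := hG.card3 hf
  two u v h := by
    have huv := hG.ed_iff.1 h
    obtain ⟨w, hw⟩ := hG.exl huv
    obtain ⟨w', hw'⟩ := hG.exl huv.symm
    obtain ⟨h1, h2⟩ := hG.two_eq hw hw'
    rw [h1, Finset.card_pair h2]
  link := hG.link
  h1 z h1 h2 h3 := hG.h1 (Finset.univ : Finset (Y × Y)).card z h1 (fun u v h => hG.ed_iff.1 (h2 u v h)) h3
    ⟨Finset.univ, le_rfl, fun _ _ _ _ _ _ => Finset.mem_univ _⟩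
  conn := hG.conn
end Geo2

set_option linter.unusedSectionVars false
set_option linter.unusedVariables false

def nonc {Y : Type} (P : Y → ℝ × ℝ) (G : SimpleGraph Y) : Prop :=
  ∀ a b c d, G.Adj a b → G.Adj c d → a ≠ c → a ≠ d → b ≠ c → b ≠ d →
    ∀ k, k ∈ segment ℝ (P a) (P b) → k ∈ segment ℝ (P c) (P d) → False

lemma quad_ev (A B C : ℝ) (h : C ≠ 0) :
    ∀ᶠ e in nhdsWithin (0:ℝ) (Set.Ioi 0), A + B * e + C * e^2 ≠ 0 := by
  have hfin : {e : ℝ | A + B * e + C * e^2 = 0}.Finite := by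
    let p : Polynomial ℝ := Polynomial.C A + Polynomial.C B * Polynomial.X + Polynomial.C C * Polynomial.X^2
    have hp : p ≠ 0 := by
      intro h0
      have : p.coeff 2 = C := by
        simp [p, Polynomial.coeff_X]
      rw [h0] at this
      simp at this
      exact h this.symm
    refine (Polynomial.finite_setOf_isRoot hp).subset ?_
    intro e he
    simp only [Set.mem_setOf_eq] at he ⊢
    simp [p, Polynomial.IsRoot, he]
  have h2 : ({e : ℝ | A + B * e + C * e^2 = 0} \ {0})ᶜ ∈ nhds (0:ℝ) :=
    (hfin.subset Set.diff_subset).isClosed.isOpen_compl.mem_nhds (by simp)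
  filter_upwards [mem_nhdsWithin_of_mem_nhds h2, self_mem_nhdsWithin] with e he hpos h0
  exact he ⟨h0, ne_of_gt hpos⟩

lemma disj_ev {Q : ℝ → ℝ × ℝ} {a b c d : ℝ → ℝ × ℝ} (ha : Continuous a) (hb : Continuous b)
    (hc : Continuous c) (hd : Continuous d)
    (h : ∀ k, k ∈ segment ℝ (a 0) (b 0) → k ∈ segment ℝ (c 0) (d 0) → False) :
    ∀ᶠ e in nhds (0:ℝ), ∀ k, k ∈ segment ℝ (a e) (b e) → k ∈ segment ℝ (c e) (d e) → False := by
  have cs : ∀ x y : ℝ × ℝ, IsCompact (segment ℝ x y) := by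
    intro x y
    rw [← convexHull_pair (𝕜 := ℝ)]
    exact (Set.toFinite {x, y}).isCompact_convexHull ℝ
  obtain ⟨f, u, v, h1, h2, h3⟩ := geometric_hahn_banach_compact_closed (convex_segment (a 0) (b 0))
    (cs _ _) (convex_segment (c 0) (d 0)) (cs _ _).isClosed
    (Set.disjoint_left.2 (fun k k1 k2 => h k k1 k2))
  have oa : ∀ᶠ e in nhds (0:ℝ), f (a e) < u :=
    (f.continuous.comp ha).continuousAt.eventually_lt_const (h1 _ (left_mem_segment ℝ _ _))
  have ob : ∀ᶠ e in nhds (0:ℝ), f (b e) < u :=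
    (f.continuous.comp hb).continuousAt.eventually_lt_const (h1 _ (right_mem_segment ℝ _ _))
  have oc : ∀ᶠ e in nhds (0:ℝ), v < f (c e) :=
    (f.continuous.comp hc).continuousAt.eventually_const_lt (h3 _ (left_mem_segment ℝ _ _))
  have od : ∀ᶠ e in nhds (0:ℝ), v < f (d e) :=
    (f.continuous.comp hd).continuousAt.eventually_const_lt (h3 _ (right_mem_segment ℝ _ _))
  filter_upwards [oa, ob, oc, od] with e ea eb ec ed k k1 k2
  have c1 : Convex ℝ {x | f x < u} := convex_halfSpace_lt f.isLinear u
  have c2 : Convex ℝ {x | v < f x} := convex_halfSpace_gt f.isLinear v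
  have g1 : f k < u := c1.segment_subset ea eb k1
  have g2 : v < f k := c2.segment_subset ec ed k2
  linarith

section
variable {Y : Type} [Fintype Y] [DecidableEq Y]

/-- perturbation -/
lemma perturb (P0 : Y → ℝ × ℝ) (G : SimpleGraph Y) (hnc : nonc P0 G) (t1 t2 t3 : Y)
    (hpos : 0 < oo (P0 t1) (P0 t2) (P0 t3))
    (hin : ∀ z, z ≠ t1 → z ≠ t2 → z ≠ t3 → Geo.ins P0 t1 t2 t3 z) :
    ∃ P : Y → ℝ × ℝ, nonc P G ∧ (∀ a b c, a ≠ b → a ≠ c → b ≠ c → oo (P a) (P b) (P c) ≠ 0) ∧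
      (∀ a b, a ≠ b → (P a).2 ≠ (P b).2) ∧ 0 < oo (P t1) (P t2) (P t3) ∧
      (∀ z, z ≠ t1 → z ≠ t2 → z ≠ t3 → Geo.ins P t1 t2 t3 z) := by
  classical
  obtain ⟨m, mp, mi⟩ : ∃ m : Y → ℝ, (∀ y, 0 < m y) ∧ Function.Injective m := by
    refine ⟨fun y => ((Fintype.equivFin Y y : ℕ) : ℝ) + 1, fun y => by positivity, ?_⟩
    intro a b h
    simp only [add_left_inj, Nat.cast_inj] at h
    exact (Fintype.equivFin Y).injective (Fin.ext h)
  let Q : ℝ → Y → ℝ × ℝ := fun e y => ((P0 y).1 + e * m y, (P0 y).2 + e * (m y)^2)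
  have Qc : ∀ y, Continuous (fun e => Q e y) := by intro y; simp only [Q]; fun_prop
  have Q0 : ∀ y, Q 0 y = P0 y := by intro y; simp [Q]
  have oc : ∀ a b c, Continuous (fun e => oo (Q e a) (Q e b) (Q e c)) := by
    intro a b c; simp only [Q, oo]; fun_prop
  have e1 : ∀ᶠ e in nhds (0:ℝ), nonc (Q e) G := by
    unfold nonc
    simp only [Filter.eventually_all]
    intro a b c d h1 h2 h3 h4 h5 h6
    have := disj_ev (Q := fun _ => 0) (Qc a) (Qc b) (Qc c) (Qc d) (by
      simp only [Q0]; exact hnc a b c d h1 h2 h3 h4 h5 h6)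
    exact this
  have e2 : ∀ᶠ e in nhdsWithin (0:ℝ) (Set.Ioi 0), ∀ a b c, a ≠ b → a ≠ c → b ≠ c →
      oo (Q e a) (Q e b) (Q e c) ≠ 0 := by
    simp only [Filter.eventually_all]
    intro a b c h1 h2 h3
    have hC : oo (m a, (m a)^2) (m b, (m b)^2) (m c, (m c)^2) ≠ 0 := by
      have : oo (m a, (m a)^2) (m b, (m b)^2) (m c, (m c)^2) = (m b - m a) * (m c - m a) * (m c - m b) := by
        simp only [oo]; ring
      rw [this]
      exact mul_ne_zero (mul_ne_zero (sub_ne_zero.2 (fun h => h1 (mi h.symm)))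
        (sub_ne_zero.2 (fun h => h2 (mi h.symm)))) (sub_ne_zero.2 (fun h => h3 (mi h.symm)))
    filter_upwards [quad_ev (oo (P0 a) (P0 b) (P0 c))
      (((P0 b).1 - (P0 a).1) * ((m c)^2 - (m a)^2) + (m b - m a) * ((P0 c).2 - (P0 a).2) -
       (((P0 b).2 - (P0 a).2) * (m c - m a) + ((m b)^2 - (m a)^2) * ((P0 c).1 - (P0 a).1))) _ hC] with e he h0
    apply he
    rw [← h0]
    simp only [oo, Q]; ring
  have e3 : ∀ᶠ e in nhdsWithin (0:ℝ) (Set.Ioi 0), ∀ a b, a ≠ b → (Q e a).2 ≠ (Q e b).2 := by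
    simp only [Filter.eventually_all]
    intro a b h1
    have hC : (m a)^2 - (m b)^2 ≠ 0 := by
      have : (m a)^2 - (m b)^2 = (m a - m b) * (m a + m b) := by ring
      rw [this]
      exact mul_ne_zero (sub_ne_zero.2 (fun h => h1 (mi h))) (by have := mp a; have := mp b; positivity)
    filter_upwards [quad_ev 0 ((P0 a).2 - (P0 b).2) _ hC, self_mem_nhdsWithin] with e he hpos h0
    apply he
    simp only [Q] at h0
    linear_combination e * h0
  have e4 : ∀ᶠ e in nhds (0:ℝ), 0 < oo (Q e t1) (Q e t2) (Q e t3) :=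
    (oc t1 t2 t3).continuousAt.eventually_const_lt (by simp only [Q0]; exact hpos)
  have e5 : ∀ᶠ e in nhds (0:ℝ), ∀ z, z ≠ t1 → z ≠ t2 → z ≠ t3 → Geo.ins (Q e) t1 t2 t3 z := by
    simp only [Filter.eventually_all]
    intro z h1 h2 h3
    obtain ⟨i1, i2, i3⟩ := hin z h1 h2 h3
    have f1 : ∀ᶠ e in nhds (0:ℝ), 0 < oo (Q e t1) (Q e t2) (Q e z) :=
      (oc _ _ _).continuousAt.eventually_const_lt (by simp only [Q0]; exact i1)
    have f2 : ∀ᶠ e in nhds (0:ℝ), 0 < oo (Q e t2) (Q e t3) (Q e z) :=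
      (oc _ _ _).continuousAt.eventually_const_lt (by simp only [Q0]; exact i2)
    have f3 : ∀ᶠ e in nhds (0:ℝ), 0 < oo (Q e t3) (Q e t1) (Q e z) :=
      (oc _ _ _).continuousAt.eventually_const_lt (by simp only [Q0]; exact i3)
    filter_upwards [f1, f2, f3] with e a b c
    exact ⟨a, b, c⟩
  obtain ⟨e, h1, h2, h3, h4, h5⟩ := ((e1.filter_mono nhdsWithin_le_nhds).and (e2.and (e3.and
    ((e4.filter_mono nhdsWithin_le_nhds).and (e5.filter_mono nhdsWithin_le_nhds))))).exists
  exact ⟨Q e, h1, h2, h3, h4, h5⟩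

lemma geo_max (P : Y → ℝ × ℝ) (G0 : SimpleGraph Y) (hnc : nonc P G0)
    (gp : ∀ a b c, a ≠ b → a ≠ c → b ≠ c → oo (P a) (P b) (P c) ≠ 0)
    (yi : ∀ a b, a ≠ b → (P a).2 ≠ (P b).2) : ∃ G, G0 ≤ G ∧ Geo P G := by
  classical
  obtain ⟨G, hle, hmax⟩ := (Set.toFinite {G | nonc P G}).exists_le_maximal hnc
  have hn : nonc P G := hmax.prop
  refine ⟨G, hle, gp, yi, hn, ?_⟩
  intro u v huv hadj
  by_contra hcon
  push Not at hcon
  have hnew : nonc P (G ⊔ SimpleGraph.fromEdgeSet {s(u, v)}) := by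
    have he : ∀ a b, (G ⊔ SimpleGraph.fromEdgeSet {s(u, v)}).Adj a b →
        G.Adj a b ∨ ((a = u ∧ b = v) ∨ (a = v ∧ b = u)) := by
      intro a b h
      rw [SimpleGraph.sup_adj, SimpleGraph.fromEdgeSet_adj] at h
      rcases h with h | ⟨h, -⟩
      · exact Or.inl h
      · right; simpa using h
    intro a b c d h1 h2 ac ad bc bd k k1 k2
    rcases he a b h1 with h1' | ⟨rfl, rfl⟩ | ⟨rfl, rfl⟩ <;> rcases he c d h2 with h2' | ⟨rfl, rfl⟩ | ⟨rfl, rfl⟩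
    · exact hn a b c d h1' h2' ac ad bc bd k k1 k2
    · exact hcon a b k h1' ac ad bc bd k2 k1
    · exact hcon a b k h1' ad ac bd bc (by rw [segment_symm]; exact k2) k1
    · exact hcon c d k h2' ac.symm bc.symm ad.symm bd.symm k1 k2
    · exact ac rfl
    · exact ad rfl
    · exact hcon c d k h2' bc.symm ac.symm bd.symm ad.symm (by rw [segment_symm]; exact k1) k2
    · exact ad rfl
    · exact ac rfl
  have := hmax.le_of_ge hnew le_sup_left
  apply hadj
  apply this
  rw [SimpleGraph.sup_adj, SimpleGraph.fromEdgeSet_adj]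
  exact Or.inr ⟨rfl, huv⟩
end

theorem sphere_exists {V : Type} [Fintype V] [DecidableEq V] [Nonempty V] {H : SimpleGraph V} (hH : IsPlanar H) :
    ∃ (F : Finset (Finset (V ⊕ Fin 3))), Sph F ∧ ∀ u v, H.Adj u v → ed F (Sum.inl u) (Sum.inl v) := by
  classical
  obtain ⟨pos, hinj, hpl⟩ := hH
  obtain ⟨R, hR0, hR⟩ : ∃ R : ℝ, 0 < R ∧ ∀ v, -R < (pos v).1 ∧ (pos v).1 < R ∧ -R < (pos v).2 ∧ (pos v).2 < R := by
    refine ⟨∑ v, (|(pos v).1| + |(pos v).2|) + 1, by positivity, ?_⟩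
    intro v
    have h := Finset.single_le_sum (f := fun v => |(pos v).1| + |(pos v).2|)
      (fun i _ => by positivity) (Finset.mem_univ v)
    have a1 := abs_nonneg (pos v).1
    have a2 := abs_nonneg (pos v).2
    have b1 := abs_lt.1 (show |(pos v).1| < ∑ v, (|(pos v).1| + |(pos v).2|) + 1 by linarith)
    have b2 := abs_lt.1 (show |(pos v).2| < ∑ v, (|(pos v).1| + |(pos v).2|) + 1 by linarith)
    exact ⟨b1.1, b1.2, b2.1, b2.2⟩
  let P0 : V ⊕ Fin 3 → ℝ × ℝ := Sum.elim pos ![(-4*R, -R), (4*R, -R), (0, 4*R)]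
  let G0 : SimpleGraph (V ⊕ Fin 3) := H ⊕g ⊤
  let t1 : V ⊕ Fin 3 := Sum.inr 0
  let t2 : V ⊕ Fin 3 := Sum.inr 1
  let t3 : V ⊕ Fin 3 := Sum.inr 2
  have p1 : P0 t1 = (-4*R, -R) := rfl
  have p2 : P0 t2 = (4*R, -R) := rfl
  have p3 : P0 t3 = (0, 4*R) := rfl
  have hpos : 0 < oo (P0 t1) (P0 t2) (P0 t3) := by
    rw [p1, p2, p3]; simp only [oo]; nlinarith [mul_pos hR0 hR0]
  have hinV : ∀ v, Geo.ins P0 t1 t2 t3 (Sum.inl v) := by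
    intro v
    obtain ⟨a, b, c, d⟩ := hR v
    have pv : P0 (Sum.inl v) = pos v := rfl
    unfold Geo.ins
    rw [p1, p2, p3, pv]
    simp only [oo]
    refine ⟨?_, ?_, ?_⟩
    · have := mul_pos hR0 (show 0 < (pos v).2 + R by linarith)
      nlinarith
    · have := mul_pos hR0 (show 0 < 16 * R - 4 * (pos v).2 - 5 * (pos v).1 by linarith)
      nlinarith
    · have := mul_pos hR0 (show 0 < 16 * R - 4 * (pos v).2 + 5 * (pos v).1 by linarith)
      nlinarith
  have hin : ∀ z, z ≠ t1 → z ≠ t2 → z ≠ t3 → Geo.ins P0 t1 t2 t3 z := by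
    rintro (v | i) h1 h2 h3
    · exact hinV v
    · fin_cases i
      · exact absurd rfl h1
      · exact absurd rfl h2
      · exact absurd rfl h3
  have mixed : ∀ (u v : V) (i j : Fin 3), i ≠ j → ∀ k, k ∈ segment ℝ (P0 (Sum.inl u)) (P0 (Sum.inl v)) →
      k ∈ segment ℝ (P0 (Sum.inr i)) (P0 (Sum.inr j)) → False := by
    intro u v i j hij k k1 k2
    have lin : ∀ a b, 0 < oo (P0 a) (P0 b) (P0 (Sum.inl u)) → 0 < oo (P0 a) (P0 b) (P0 (Sum.inl v)) →
        0 < oo (P0 a) (P0 b) k := by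
      intro a b h1 h2
      obtain ⟨t, t0, t1, ht⟩ := line_seg k1 (P0 a) (P0 b)
      rw [ht]
      rcases eq_or_lt_of_le t0 with h | h
      · rw [← h]; linarith
      · have := mul_pos h h2
        have := mul_nonneg (show 0 ≤ 1 - t by linarith) h1.le
        linarith
    obtain ⟨u1, u2, u3⟩ := hinV u
    obtain ⟨v1, v2, v3⟩ := hinV v
    have l1 := lin _ _ u1 v1
    have l2 := lin _ _ u2 v2
    have l3 := lin _ _ u3 v3
    have z0 := oo_seg k2
    have z1 := z0
    rw [oo_swap] at z1
    fin_cases i <;> fin_cases j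
    · exact hij rfl
    · exact l1.ne' z0
    · exact l3.ne' (neg_eq_zero.1 z1)
    · exact l1.ne' (neg_eq_zero.1 z1)
    · exact hij rfl
    · exact l2.ne' z0
    · exact l3.ne' z0
    · exact l2.ne' (neg_eq_zero.1 z1)
    · exact hij rfl
  have hnc : nonc P0 G0 := by
    rintro (a | a) (b | b) (c | c) (d | d) h1 h2 ac ad bc bd k k1 k2 <;>
      simp only [G0, SimpleGraph.sum_adj_inl, SimpleGraph.sum_adj_inr, ne_eq, Sum.inl.injEq, Sum.inr.injEq,
        SimpleGraph.top_adj] at h1 h2 ac ad bc bd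
    · obtain ⟨g1, g2⟩ := hpl a b c d h1 h2 (by simp [ac, ad]) k k1 k2
      rcases g1 with rfl | rfl <;> rcases g2 with g | g
      · exact ac (hinj g)
      · exact ad (hinj g)
      · exact bc (hinj g)
      · exact bd (hinj g)
    all_goals first
      | exact h1.elim
      | exact h2.elim
      | (simp at h1; done)
      | (simp at h2; done)
      | exact mixed _ _ _ _ h1 k k2 k1
      | exact mixed _ _ _ _ h2 k k1 k2
      | omega
  obtain ⟨P, q1, q2, q3, q4, q5⟩ := perturb P0 G0 hnc t1 t2 t3 hpos hin
  obtain ⟨G, hle, hG⟩ := geo_max P G0 q1 q2 q3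
  have ht : ∀ i j : Fin 3, i ≠ j → G.Adj (Sum.inr i) (Sum.inr j) := by
    intro i j hij
    apply hle
    simpa [G0] using hij
  have hG2 : Geo2 P G t1 t2 t3 :=
    { hG with
      e12 := ht _ _ (by decide)
      e23 := ht _ _ (by decide)
      e31 := ht _ _ (by decide)
      pos := q4
      inn := q5
      ex := ⟨Sum.inl (Classical.arbitrary V), by simp [t1], by simp [t2], by simp [t3]⟩ }
  refine ⟨faces P G t1 t2 t3, hG2.sph, ?_⟩
  intro u v huv
  rw [hG2.ed_iff]
  apply hle
  simpa [G0] using huv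

set_option linter.unusedSectionVars false
section fin
variable {V X : Type} [Fintype V] [DecidableEq V] [Fintype X] [DecidableEq X]

structure MC (G : SimpleGraph V) (F : Finset (Finset X)) (ι : V → X) : Prop where
  sph : Sph F
  inj : Function.Injective ι
  he : ∀ u v, G.Adj u v → ed F (ι u) (ι v)
  nc : ¬ G.Colorable 4
  pl : IsPlanar G
  mn : ∀ (W : Type) [Fintype W] (H : SimpleGraph W), IsPlanar H →
    Fintype.card W < Fintype.card V → H.Colorable 4
  mx : ∀ u v : V, u ≠ v → ¬ G.Adj u v → ¬ IsPlanar (G ⊔ SimpleGraph.fromEdgeSet {s(u, v)})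

def X1 (F : Finset (Finset X)) (ι : V → X) (S : Finset X → ZMod 2) (v : V) : Prop :=
  ∃ f ∈ F, ι v ∈ f ∧ S f = 1

def KS (G : SimpleGraph V) (F : Finset (Finset X)) (ι : V → X) (S : Finset X → ZMod 2) (u v : V) : Prop :=
  G.Adj u v ∧ ∃ f ∈ F, ι u ∈ f ∧ ι v ∈ f ∧ S f = 1

lemma s1 {S : Finset X → ZMod 2} {f : Finset X} : (S + 1) f = 1 ↔ S f = 0 := by
  rw [Pi.add_apply, Pi.one_apply]; generalize S f = x; revert x; decide

lemma s11 (S : Finset X → ZMod 2) : S + 1 + 1 = S := by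
  funext f; change S f + 1 + 1 = S f; generalize S f = x; revert x; decide

lemma IsPlanar.restrict {U : Type} {G : SimpleGraph V} (h : IsPlanar G) (j : U → V) (hj : Function.Injective j)
    (H : SimpleGraph U) (hH : ∀ u v, H.Adj u v → G.Adj (j u) (j v)) : IsPlanar H := by
  obtain ⟨pos, h1, h2⟩ := h
  refine ⟨pos ∘ j, h1.comp hj, ?_⟩
  intro u v x y huv hxy hne p p1 p2
  refine h2 _ _ _ _ (hH _ _ huv) (hH _ _ hxy) ?_ p p1 p2
  intro hc
  apply hne
  have : Sym2.map j s(u, v) = Sym2.map j s(x, y) := by simpa using hc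
  exact Sym2.map.injective hj this

lemma perm_match (C : V → Prop) (f g : V → Fin 4)
    (h : ∀ u v, C u → C v → (f u = f v ↔ g u = g v)) :
    ∃ σ : Equiv.Perm (Fin 4), ∀ u, C u → σ (f u) = g u := by
  classical
  let p : Fin 4 → Prop := fun x => ∃ u, C u ∧ f u = x
  let q : Fin 4 → Prop := fun x => ∃ u, C u ∧ g u = x
  let r : {x // p x} → {x // q x} := fun x => ⟨g x.2.choose, _, x.2.choose_spec.1, rfl⟩
  have hr : ∀ u (hu : C u), (r ⟨f u, u, hu, rfl⟩).1 = g u := by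
    intro u hu
    have hp : p (f u) := ⟨u, hu, rfl⟩
    exact (h _ _ hp.choose_spec.1 hu).1 hp.choose_spec.2
  have hb : Function.Bijective r := by
    constructor
    · rintro ⟨x, u, hu, rfl⟩ ⟨y, v, hv, rfl⟩ hxy
      have := congrArg Subtype.val hxy
      rw [hr u hu, hr v hv] at this
      exact Subtype.ext ((h u v hu hv).2 this)
    · rintro ⟨y, v, hv, rfl⟩
      exact ⟨⟨f v, v, hv, rfl⟩, Subtype.ext (hr v hv)⟩
  refine ⟨(Equiv.ofBijective r hb).extendSubtype, ?_⟩
  intro u hu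
  rw [Equiv.extendSubtype_apply_of_mem _ _ (show p (f u) from ⟨u, hu, rfl⟩)]
  exact hr u hu

variable {G : SimpleGraph V} {F : Finset (Finset X)} {ι : V → X}

lemma MC.col_of (m : MC G F ι) {S : Finset X → ZMod 2} (hR : ¬ ∀ v, X1 F ι S v) (H : SimpleGraph V)
    (hH : ∀ u v, H.Adj u v → X1 F ι S u)
    (hpl : IsPlanar (H.comap (Subtype.val : {v // X1 F ι S v} → V))) :
    ∃ φ : V → Fin 4, ∀ u v, H.Adj u v → φ u ≠ φ v := by
  classical
  push Not at hR
  obtain ⟨w, hw⟩ := hR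
  obtain ⟨C⟩ := m.mn _ _ hpl (Fintype.card_subtype_lt hw)
  refine ⟨fun v => if h : X1 F ι S v then C ⟨v, h⟩ else 0, ?_⟩
  intro u v huv
  have h1 := hH u v huv
  have h2 := hH v u huv.symm
  simp only [h1, h2, dif_pos]
  exact C.valid huv

lemma MC.col_KS (m : MC G F ι) {S : Finset X → ZMod 2} (hR : ¬ ∀ v, X1 F ι S v) :
    ∃ φ : V → Fin 4, ∀ u v, KS G F ι S u v → φ u ≠ φ v := by
  let H : SimpleGraph V :=
    { Adj := KS G F ι S
      symm := ⟨fun u v ⟨h, f, a, b, c, d⟩ => ⟨h.symm, f, a, c, b, d⟩⟩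
      loopless := ⟨fun u h => h.1.ne rfl⟩ }
  exact m.col_of hR H (fun u v ⟨_, f, a, b, _, d⟩ => ⟨f, a, b, d⟩)
    (m.pl.restrict _ Subtype.val_injective _ (fun u v h => h.1))

lemma MC.glue (m : MC G F ι) {S : Finset X → ZMod 2} {a : X} {l : List X}
    (hS : bd F S = ch (a :: (l ++ [a]))) {φ ψ : V → Fin 4}
    (h1 : ∀ u v, KS G F ι S u v → φ u ≠ φ v) (h2 : ∀ u v, KS G F ι (S + 1) u v → ψ u ≠ ψ v)
    (h : ∀ u v, ι u ∈ a :: l → ι v ∈ a :: l → (ψ u = ψ v ↔ φ u = φ v)) : False := by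
  classical
  obtain ⟨σ, hσ⟩ := perm_match (fun u => ι u ∈ a :: l) ψ φ h
  apply m.nc
  have key : ∀ u, X1 F ι (S + 1) u → (if X1 F ι S u then φ u else σ (ψ u)) = σ (ψ u) := by
    rintro u ⟨g, hg, hug, hSg⟩
    split_ifs with hx
    · obtain ⟨f, hf, huf, hSf⟩ := hx
      refine (hσ u ?_).symm
      by_contra hc
      have := off_const m.sph hS hc f hf g hg huf hug
      rw [s1] at hSg
      rw [hSf, hSg] at this
      exact one_ne_zero this
    · rfl
  refine ⟨SimpleGraph.Coloring.mk (fun v => if X1 F ι S v then φ v else σ (ψ v)) ?_⟩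
  intro u v huv
  obtain ⟨-, f, hf, uf, vf⟩ := m.he u v huv
  rcases zt (S f) with h0 | h0
  · rw [key u ⟨f, hf, uf, s1.2 h0⟩, key v ⟨f, hf, vf, s1.2 h0⟩]
    exact fun hc => h2 u v ⟨huv, f, hf, uf, vf, s1.2 h0⟩ (σ.injective hc)
  · have a1 : X1 F ι S u := ⟨f, hf, uf, h0⟩
    have a2 : X1 F ι S v := ⟨f, hf, vf, h0⟩
    rw [if_pos a1, if_pos a2]
    exact h1 u v ⟨huv, f, hf, uf, vf, h0⟩

lemma bd_add_one (hF : Sph F) (S : Finset X → ZMod 2) : bd F (S + 1) = bd F S := by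
  rw [bd_add, bd_one hF, add_zero]

lemma MC.KS_cyc (m : MC G F ι) {S : Finset X → ZMod 2} {a b : X} {l : List X} (hl : l ≠ [])
    (hL : (a :: b :: l).Nodup) (hS : bd F S = ch (a :: (b :: l ++ [a]))) {u v : V} (h : G.Adj u v)
    (hp : pe (a :: (b :: l ++ [a])) (ι u) (ι v)) : KS G F ι S u v := by
  obtain ⟨-, f, hf, -, -, h1, h2, -, -, h3, -⟩ := cyc_face m.sph hl hL hS hp
  exact ⟨h, f, hf, h1, h2, h3⟩

/-- triangles are not separating -/
lemma MC.tri (m : MC G F ι) {a b c : V} (hab : G.Adj a b) (hbc : G.Adj b c) (hac : G.Adj a c) :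
    ∃ S, bd F S = ch (ι a :: (ι b :: [ι c] ++ [ι a])) ∧ ∀ v, X1 F ι (S + 1) v := by
  have hnd : (ι a :: ι b :: [ι c]).Nodup := by
    simp [m.inj.eq_iff, hab.ne, hbc.ne, hac.ne]
  obtain ⟨S, hS⟩ := m.sph.cyc (ι a) (ι b :: [ι c]) (by
    intro u v h
    simp only [pe, List.cons_append, List.nil_append] at h
    rcases h with (⟨rfl, rfl⟩ | ⟨rfl, rfl⟩) | (⟨rfl, rfl⟩ | ⟨rfl, rfl⟩) | (⟨rfl, rfl⟩ | ⟨rfl, rfl⟩) | h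
    · exact m.he _ _ hab
    · exact m.he _ _ hab.symm
    · exact m.he _ _ hbc
    · exact m.he _ _ hbc.symm
    · exact m.he _ _ hac.symm
    · exact m.he _ _ hac
    · exact h.elim)
  have hS' : bd F (S + 1) = ch (ι a :: (ι b :: [ι c] ++ [ι a])) := by rw [bd_add_one m.sph, hS]
  by_cases h1 : ∀ v, X1 F ι (S + 1) v
  · exact ⟨S, hS, h1⟩
  have e2 : S + 1 + 1 = S := s11 S
  by_cases h2 : ∀ v, X1 F ι S v
  · exact ⟨S + 1, hS', by rw [e2]; exact h2⟩
  exfalso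
  obtain ⟨φ, hφ⟩ := m.col_KS h2
  obtain ⟨ψ, hψ⟩ := m.col_KS h1
  have key : ∀ (T : Finset X → ZMod 2) (χ : V → Fin 4), bd F T = ch (ι a :: (ι b :: [ι c] ++ [ι a])) →
      (∀ u v, KS G F ι T u v → χ u ≠ χ v) → χ a ≠ χ b ∧ χ b ≠ χ c ∧ χ a ≠ χ c := by
    intro T χ hT hχ
    exact ⟨hχ _ _ (m.KS_cyc (by simp) hnd hT hab (by simp [pe])), hχ _ _ (m.KS_cyc (by simp) hnd hT hbc (by simp [pe])),
      hχ _ _ (m.KS_cyc (by simp) hnd hT hac (by simp [pe]))⟩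
  obtain ⟨p1, p2, p3⟩ := key S φ hS hφ
  obtain ⟨q1, q2, q3⟩ := key _ ψ hS' hψ
  refine m.glue hS hφ hψ ?_
  intro u v hu hv
  simp only [List.mem_cons, m.inj.eq_iff, List.not_mem_nil, or_false] at hu hv
  rcases hu with rfl | rfl | rfl <;> rcases hv with rfl | rfl | rfl <;>
    simp [p1, p2, p3, q1, q2, q3, p1.symm, p2.symm, p3.symm, q1.symm, q2.symm, q3.symm]

end fin

set_option linter.unusedSectionVars false
section fin
variable {V X : Type} [Fintype V] [DecidableEq V] [Fintype X] [DecidableEq X]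

def KC (K : V → V → Prop) (φ : V → Fin 4) (α β : Fin 4) (u v : V) : Prop :=
  K u v ∧ (φ u = α ∨ φ u = β) ∧ (φ v = α ∨ φ v = β)

lemma kswap (K : V → V → Prop) (hs : ∀ u v, K u v → K v u) (φ : V → Fin 4) (hφ : ∀ u v, K u v → φ u ≠ φ v)
    {a c : V} (hc : ¬ Relation.ReflTransGen (KC K φ (φ a) (φ c)) a c) :
    ∃ ψ : V → Fin 4, (∀ u v, K u v → ψ u ≠ ψ v) ∧ ψ a = ψ c ∧
      ∀ v, φ v ≠ φ a → φ v ≠ φ c → ψ v = φ v := by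
  classical
  set C := fun v => Relation.ReflTransGen (KC K φ (φ a) (φ c)) a v with hC
  have hcol : ∀ v, C v → φ v = φ a ∨ φ v = φ c := by
    intro v hv
    rcases Relation.ReflTransGen.cases_tail hv with h | ⟨w, -, h⟩
    · rw [h]; exact Or.inl rfl
    · exact h.2.2
  have hstep : ∀ u v, K u v → C u → ¬ C v → φ v ≠ φ a ∧ φ v ≠ φ c := by
    intro u v huv hu hv
    by_contra hcon
    exact hv (hu.tail ⟨huv, hcol u hu, by tauto⟩)
  have hsw : ∀ u, C u → Equiv.swap (φ a) (φ c) (φ u) = φ a ∨ Equiv.swap (φ a) (φ c) (φ u) = φ c := by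
    intro u hu
    rcases hcol u hu with h | h <;> rw [h]
    · right; exact Equiv.swap_apply_left _ _
    · left; exact Equiv.swap_apply_right _ _
  refine ⟨fun v => if C v then Equiv.swap (φ a) (φ c) (φ v) else φ v, ?_, ?_, ?_⟩
  · have main : ∀ u v, K u v → C u → ¬ C v → Equiv.swap (φ a) (φ c) (φ u) ≠ φ v := by
      intro u v huv hu hv h
      have := hstep u v huv hu hv
      rcases hsw u hu with h' | h' <;> rw [h'] at h
      · exact this.1 h.symm
      · exact this.2 h.symm
    intro u v huv
    by_cases hu : C u <;> by_cases hv : C v <;> simp only [hu, hv, if_true, if_false]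
    · exact fun h => hφ u v huv ((Equiv.swap _ _).injective h)
    · exact main u v huv hu hv
    · exact (main v u (hs _ _ huv) hv hu).symm
    · exact hφ u v huv
  · have h1 : C a := Relation.ReflTransGen.refl
    simp only [h1, if_true]
    rw [if_neg hc, Equiv.swap_apply_left]
  · intro v h1 h2
    have : ¬ C v := fun h => by rcases hcol v h with h | h <;> contradiction
    simp only [this, if_false]

variable {G : SimpleGraph V} {F : Finset (Finset X)} {ι : V → X}

lemma KS_symm {S : Finset X → ZMod 2} (u v : V) (h : KS G F ι S u v) : KS G F ι S v u := by
  obtain ⟨h, f, a, b, c, d⟩ := h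
  exact ⟨h.symm, f, a, c, b, d⟩

lemma eg_ne {p q u v : X} (h : eg p q u v ≠ 0) : (u = p ∧ v = q) ∨ (u = q ∧ v = p) := by
  by_contra hc; exact h (if_neg hc)

lemma eg_off {p q u : X} (h1 : u ≠ p) (h2 : u ≠ q) (v : X) : eg p q u v = 0 := by
  by_contra hc
  rcases eg_ne hc with h | h
  · exact h1 h.1
  · exact h2 h.1

lemma chain_of (hi : Function.Injective ι) (R : V → V → Prop) (hR : ∀ u v, R u v → u ≠ v) {a c : V}
    (h : Relation.ReflTransGen R a c) :
    ∃ z : X → X → ZMod 2, (∀ u v, z u v = z v u) ∧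
      (∀ u v, z u v ≠ 0 → ∃ p q, (R p q ∨ R q p) ∧ u = ι p ∧ v = ι q) ∧
      ∀ v, ∑ u, z v u = (if v = ι a then 1 else 0) + (if v = ι c then 1 else 0) := by
  induction h with
  | refl =>
    refine ⟨0, fun _ _ => rfl, fun u v h => absurd rfl h, ?_⟩
    intro v
    rw [CharTwo.add_self_eq_zero]; simp
  | @tail p q _ hpq ih =>
    obtain ⟨z, z1, z2, z3⟩ := ih
    refine ⟨z + eg (ι p) (ι q), ?_, ?_, ?_⟩
    · intro u v; simp only [Pi.add_apply]; rw [z1, eg_symm]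
    · intro u v h
      by_cases h0 : z u v = 0
      · rw [Pi.add_apply, Pi.add_apply, h0, zero_add] at h
        rcases eg_ne h with ⟨h1, h2⟩ | ⟨h1, h2⟩
        · exact ⟨p, q, Or.inl hpq, h1, h2⟩
        · exact ⟨q, p, Or.inr hpq, h1, h2⟩
      · exact z2 u v h0
    · intro v
      simp only [Pi.add_apply, Finset.sum_add_distrib]
      rw [z3, eg_sum (fun h => hR _ _ hpq (hi h))]
      generalize (if v = ι a then (1 : ZMod 2) else 0) = x
      generalize (if v = ι p then (1 : ZMod 2) else 0) = y
      generalize (if v = ι q then (1 : ZMod 2) else 0) = w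
      revert x y w; decide

/-- Jordan for Kempe chains -/
lemma MC.kjordan (m : MC G F ι) {S : Finset X → ZMod 2} {a b c d : V}
    (hnd : (ι a :: ι b :: [ι c, ι d]).Nodup)
    (hS : bd F S = ch (ι a :: (ι b :: [ι c, ι d] ++ [ι a])))
    (hcd : G.Adj c d) (hda : G.Adj d a)
    (φ : V → Fin 4)
    (hac : φ a ≠ φ c) (hab : φ a ≠ φ b) (had : φ a ≠ φ d) (hbc : φ b ≠ φ c) (hbd : φ b ≠ φ d) (hcd' : φ c ≠ φ d)
    (h1 : Relation.ReflTransGen (KC (KS G F ι S) φ (φ a) (φ c)) a c) :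
    ¬ Relation.ReflTransGen (KC (KS G F ι S) φ (φ b) (φ d)) b d := by
  obtain ⟨z, z1, z2, z3⟩ := chain_of (ι := ι) m.inj _ (fun u v h => h.1.1.ne) h1
  have z2' : ∀ u v, z u v ≠ 0 → ∃ p q, KC (KS G F ι S) φ (φ a) (φ c) p q ∧ u = ι p ∧ v = ι q := by
    intro u v h
    obtain ⟨p, q, h | h, h2⟩ := z2 u v h
    · exact ⟨p, q, h, h2⟩
    · exact ⟨p, q, ⟨KS_symm _ _ h.1, h.2.2, h.2.1⟩, h2⟩
  have zoff : ∀ w, (φ w = φ b ∨ φ w = φ d) → ∀ v, z (ι w) v = 0 := by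
    intro w hw v
    by_contra hc
    obtain ⟨p, q, h, hp, -⟩ := z2' _ _ hc
    have := m.inj hp
    subst this
    rcases h.2.1 with h | h <;> rcases hw with h' | h' <;> rw [h] at h'
    · exact hab h'
    · exact had h'
    · exact hbc h'.symm
    · exact hcd' h'
  obtain ⟨D, hD⟩ := m.sph.h1 (z + (eg (ι c) (ι d) + eg (ι d) (ι a))) (by
      intro u v; simp only [Pi.add_apply]; rw [z1, eg_symm (ι c), eg_symm (ι d)]) (by
      intro u v h
      by_cases h0 : z u v = 0
      · by_cases h2 : eg (ι c) (ι d) u v = 0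
        · simp only [Pi.add_apply, h0, h2, zero_add] at h
          rcases eg_ne h with ⟨rfl, rfl⟩ | ⟨rfl, rfl⟩
          · exact m.he _ _ hda
          · exact m.he _ _ hda.symm
        · rcases eg_ne h2 with ⟨rfl, rfl⟩ | ⟨rfl, rfl⟩
          · exact m.he _ _ hcd
          · exact m.he _ _ hcd.symm
      · obtain ⟨p, q, h5, rfl, rfl⟩ := z2' _ _ h0
        exact m.he _ _ h5.1.1) (by
      intro v
      simp only [Pi.add_apply, Finset.sum_add_distrib]
      rw [z3, eg_sum (fun h => hcd.ne (m.inj h)), eg_sum (fun h => hda.ne (m.inj h))]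
      generalize (if v = ι a then (1 : ZMod 2) else 0) = x
      generalize (if v = ι c then (1 : ZMod 2) else 0) = y
      generalize (if v = ι d then (1 : ZMod 2) else 0) = w
      revert x y w; decide)
  have hpe : ∀ u v, pe (ι a :: (ι b :: [ι c, ι d] ++ [ι a])) u v → ed F u v :=
    fun u v h => (cyc_face m.sph (by simp) hnd hS h).1
  obtain ⟨k, hk⟩ := m.sph.K (ι a) (ι b) [ι c, ι d] (by simp) hnd S D hS hpe (by
    intro u v h
    rw [hD] at h
    by_cases h0 : z u v = 0
    · left
      by_cases h2 : eg (ι c) (ι d) u v = 0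
      · simp only [Pi.add_apply, h0, h2, zero_add] at h
        rcases eg_ne h with ⟨rfl, rfl⟩ | ⟨rfl, rfl⟩ <;> simp [pe]
      · rcases eg_ne h2 with ⟨rfl, rfl⟩ | ⟨rfl, rfl⟩ <;> simp [pe]
    · right
      obtain ⟨p, q, ⟨⟨-, f, hf, h2, h3, h4⟩, -⟩, rfl, rfl⟩ := z2' _ _ h0
      exact ⟨f, hf, h2, h3, h4⟩)
  have cst : ∀ w, (φ w = φ b ∨ φ w = φ d) → w ≠ d → ∀ f ∈ F, ∀ g ∈ F, ι w ∈ f → ι w ∈ g → D f = D g := by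
    intro w hw hwd
    apply m.sph.link
    intro u
    have wc : w ≠ c := by rintro rfl; rcases hw with h | h; exact hbc h.symm; exact hcd' h
    have wa : w ≠ a := by rintro rfl; rcases hw with h | h; exact hab h; exact had h
    rw [hD]
    simp only [Pi.add_apply]
    rw [zoff w hw, eg_off (fun h => wc (m.inj h)) (fun h => hwd (m.inj h)),
      eg_off (fun h => hwd (m.inj h)) (fun h => wa (m.inj h))]
    rfl
  have key : ∀ v, Relation.ReflTransGen (KC (KS G F ι S) φ (φ b) (φ d)) b v →
      v ≠ d ∧ ∀ f ∈ F, ι v ∈ f → D f = k := by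
    intro v hv
    induction hv with
    | refl =>
      have hb : b ≠ d := fun h => hbd (by rw [h])
      refine ⟨hb, ?_⟩
      intro f hf hbf
      obtain ⟨-, g, hg, hbg, hSg⟩ := cyc_mem_face m.sph (by simp) hnd hS (v := ι b) (by simp)
      rw [cst b (Or.inl rfl) hb f hf g hg hbf hbg]
      exact hk g hg hSg
    | @tail p q _ hpq ih =>
      obtain ⟨-, ih⟩ := ih
      obtain ⟨⟨-, f, hf, hpf, hqf, hSf⟩, -, hq⟩ := hpq
      have hqd : q ≠ d := by
        rintro rfl
        obtain ⟨-, g, hg, hdg, hSg⟩ := cyc_mem_face m.sph (by simp) hnd hS (v := ι q) (by simp)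
        have := m.sph.link (ι q) (D + S) (by
          intro u
          rw [bd_add, hD, hS]
          simp only [ch, List.cons_append, List.nil_append, Pi.add_apply, Pi.zero_apply]
          simp only [List.nodup_cons, List.mem_cons, not_or, List.not_mem_nil, not_false_eq_true] at hnd
          rw [zoff q hq, eg_off (p := ι a) (q := ι b) (Ne.symm hnd.1.2.2.1) (Ne.symm hnd.2.1.2.1),
            eg_off (p := ι b) (q := ι c) (Ne.symm hnd.2.1.2.1) (Ne.symm hnd.2.2.1.1)]
          generalize eg (ι c) (ι q) (ι q) u = x
          generalize eg (ι q) (ι a) (ι q) u = y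
          revert x y; decide) f hf g hg hqf hdg
        rw [Pi.add_apply, Pi.add_apply, ih f hf hpf, hSf, hk g hg hSg, hSg] at this
        simp at this
      refine ⟨hqd, ?_⟩
      intro g hg hqg
      rw [cst q hq hqd g hg f hf hqg hqf]
      exact ih f hf hpf
  exact fun h => (key d h).1 rfl

/-- from all distinct to a type with a repetition -/
lemma MC.kempe (m : MC G F ι) {S : Finset X → ZMod 2} {a b c d : V}
    (hnd : (ι a :: ι b :: [ι c, ι d]).Nodup)
    (hS : bd F S = ch (ι a :: (ι b :: [ι c, ι d] ++ [ι a])))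
    (hcd : G.Adj c d) (hda : G.Adj d a)
    (φ : V → Fin 4) (hφ : ∀ u v, KS G F ι S u v → φ u ≠ φ v)
    (hac : φ a ≠ φ c) (hab : φ a ≠ φ b) (had : φ a ≠ φ d) (hbc : φ b ≠ φ c) (hbd : φ b ≠ φ d) (hcd' : φ c ≠ φ d) :
    ∃ ψ : V → Fin 4, (∀ u v, KS G F ι S u v → ψ u ≠ ψ v) ∧
      ((ψ a = ψ c ∧ ψ b ≠ ψ d) ∨ (ψ a ≠ ψ c ∧ ψ b = ψ d)) := by
  by_cases h1 : Relation.ReflTransGen (KC (KS G F ι S) φ (φ a) (φ c)) a c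
  · obtain ⟨ψ, p1, p2, p3⟩ := kswap _ KS_symm φ hφ (m.kjordan hnd hS hcd hda φ hac hab had hbc hbd hcd' h1)
    refine ⟨ψ, p1, Or.inr ⟨?_, p2⟩⟩
    rw [p3 a hab had, p3 c hbc.symm hcd']; exact hac
  · obtain ⟨ψ, p1, p2, p3⟩ := kswap _ KS_symm φ hφ h1
    refine ⟨ψ, p1, Or.inl ⟨p2, ?_⟩⟩
    rw [p3 b hab.symm hbc, p3 d had.symm hcd'.symm]; exact hbd

end fin

set_option linter.unusedSectionVars false
section fin
variable {V X : Type} [Fintype V] [DecidableEq V] [Fintype X] [DecidableEq X]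
variable {G : SimpleGraph V} {F : Finset (Finset X)} {ι : V → X}

lemma nd_rot {a b c d : X} (h : (a :: b :: [c, d]).Nodup) : (b :: c :: [d, a]).Nodup := by
  simp only [List.nodup_cons, List.mem_cons, not_or, List.not_mem_nil, not_false_eq_true] at h ⊢
  obtain ⟨⟨h1, h2, h3, -⟩, ⟨h4, h5, -⟩, ⟨h6, -⟩, -⟩ := h
  exact ⟨⟨h4, h5, Ne.symm h1, trivial⟩, ⟨h6, Ne.symm h2, trivial⟩, ⟨Ne.symm h3, trivial⟩, trivial, List.nodup_nil⟩

lemma ch_rot (a b c d : X) : ch (a :: (b :: [c, d] ++ [a])) = ch (b :: (c :: [d, a] ++ [b])) := by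
  simp only [ch, List.cons_append, List.nil_append]; abel

lemma MC.diag (m : MC G F ι) {S : Finset X → ZMod 2} {a b c d : V}
    (hnd : (ι a :: ι b :: [ι c, ι d]).Nodup)
    (hS : bd F S = ch (ι a :: (ι b :: [ι c, ι d] ++ [ι a]))) (hR : ¬ ∀ v, X1 F ι S v) :
    ∃ φ : V → Fin 4, (∀ u v, KS G F ι S u v → φ u ≠ φ v) ∧ φ b ≠ φ d := by
  have hbd : b ≠ d := by rintro rfl; simp at hnd
  have hmf := fun v => cyc_mem_face m.sph (by simp) hnd hS (v := v)
  let H : SimpleGraph V :=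
    { Adj := fun u v => KS G F ι S u v ∨ (u = b ∧ v = d) ∨ (u = d ∧ v = b)
      symm := ⟨fun u v h => by
        rcases h with h | h | h
        · exact Or.inl (KS_symm _ _ h)
        · exact Or.inr (Or.inr ⟨h.2, h.1⟩)
        · exact Or.inr (Or.inl ⟨h.2, h.1⟩)⟩
      loopless := ⟨fun u h => by
        rcases h with h | h | h
        · exact h.1.ne rfl
        · exact hbd (h.1.symm.trans h.2)
        · exact hbd (h.2.symm.trans h.1)⟩ }
  obtain ⟨φ, hφ⟩ := m.col_of hR H (by
    rintro u v (⟨-, f, hf, h1, -, h2⟩ | ⟨rfl, -⟩ | ⟨rfl, -⟩)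
    · exact ⟨f, hf, h1, h2⟩
    · exact (hmf (ι u) (by simp)).1
    · exact (hmf (ι u) (by simp)).1) (by
    classical
    refine redraw m.sph S hnd hS ?_ (fun u : {v // X1 F ι S v} => ι u.1)
      (m.inj.comp Subtype.val_injective) ?_ _ ?_
    · obtain ⟨f, hf, -, h⟩ := (hmf (ι a) (by simp)).2
      exact ⟨f, hf, h⟩
    · rintro ⟨u, f, hf, h1, h2⟩
      exact ⟨f, hf, h2, h1⟩
    · rintro u v (⟨-, f, hf, h1, h2, h3⟩ | ⟨h1, h2⟩ | ⟨h1, h2⟩)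
      · exact Or.inl ⟨f, hf, h3, h1, h2⟩
      · exact Or.inr (Or.inl ⟨congrArg ι h1, congrArg ι h2⟩)
      · exact Or.inr (Or.inr ⟨congrArg ι h1, congrArg ι h2⟩))
  exact ⟨φ, fun u v h => hφ u v (Or.inl h), hφ b d (Or.inr (Or.inl ⟨rfl, rfl⟩))⟩

/-- types of colourings of one side -/
lemma MC.types (m : MC G F ι) {S : Finset X → ZMod 2} {a b c d : V}
    (hab : G.Adj a b) (hbc : G.Adj b c) (hcd : G.Adj c d) (hda : G.Adj d a)
    (hnd : (ι a :: ι b :: [ι c, ι d]).Nodup)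
    (hS : bd F S = ch (ι a :: (ι b :: [ι c, ι d] ++ [ι a]))) (hR : ¬ ∀ v, X1 F ι S v) (T : Prop → Prop → Prop)
    (hT : ∀ φ : V → Fin 4, (∀ u v, KS G F ι S u v → φ u ≠ φ v) → T (φ a = φ c) (φ b = φ d)) :
    (T True False ∧ T False True) ∨ (T False False ∧ (T True False ∨ T False True)) := by
  have hp : ∀ φ : V → Fin 4, (∀ u v, KS G F ι S u v → φ u ≠ φ v) →
      φ a ≠ φ b ∧ φ b ≠ φ c ∧ φ c ≠ φ d ∧ φ d ≠ φ a := by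
    intro φ hφ
    exact ⟨hφ _ _ (m.KS_cyc (by simp) hnd hS hab (by simp [pe])), hφ _ _ (m.KS_cyc (by simp) hnd hS hbc (by simp [pe])),
      hφ _ _ (m.KS_cyc (by simp) hnd hS hcd (by simp [pe])), hφ _ _ (m.KS_cyc (by simp) hnd hS hda (by simp [pe]))⟩
  have hff : ∀ φ : V → Fin 4, (∀ u v, KS G F ι S u v → φ u ≠ φ v) → φ a ≠ φ c → φ b ≠ φ d →
      (T False False ∧ (T True False ∨ T False True)) := by
    intro φ hφ h1 h2
    obtain ⟨p1, p2, p3, p4⟩ := hp φ hφ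
    constructor
    · have := hT φ hφ; simpa only [h1, h2] using this
    · obtain ⟨ψ, q1, ⟨q2, q3⟩ | ⟨q2, q3⟩⟩ := m.kempe hnd hS hcd hda φ hφ h1 p1 p4.symm p2 h2 p3
      · left; have := hT ψ q1; simpa only [q2, q3] using this
      · right; have := hT ψ q1; simpa only [q2, q3] using this
  obtain ⟨φ, f1, f2⟩ := m.diag hnd hS hR
  obtain ⟨ψ, g1, g2⟩ := m.diag (nd_rot hnd) (by rw [hS, ch_rot]) hR
  by_cases h1 : φ a = φ c
  · by_cases h2 : ψ b = ψ d
    · left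
      constructor
      · have := hT φ f1; simpa only [h1, f2] using this
      · have := hT ψ g1; simpa only [h2, g2.symm] using this
    · right; exact hff ψ g1 g2.symm h2
  · right; exact hff φ f1 h1 f2

/-- 4-cycles are not separating -/
lemma MC.four (m : MC G F ι) {a b c d : V}
    (hab : G.Adj a b) (hbc : G.Adj b c) (hcd : G.Adj c d) (hda : G.Adj d a) (hac : a ≠ c) (hbd : b ≠ d) :
    (ι a :: ι b :: [ι c, ι d]).Nodup ∧
    ∃ S, bd F S = ch (ι a :: (ι b :: [ι c, ι d] ++ [ι a])) ∧ ∀ v, X1 F ι S v := by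
  have hnd : (ι a :: ι b :: [ι c, ι d]).Nodup := by
    simp [m.inj.eq_iff, hab.ne, hbc.ne, hcd.ne, hda.ne.symm, hac, hbd]
  refine ⟨hnd, ?_⟩
  obtain ⟨S, hS⟩ := m.sph.cyc (ι a) (ι b :: [ι c, ι d]) (by
    intro u v h
    simp only [pe, List.cons_append, List.nil_append] at h
    rcases h with (⟨rfl, rfl⟩ | ⟨rfl, rfl⟩) | (⟨rfl, rfl⟩ | ⟨rfl, rfl⟩) | (⟨rfl, rfl⟩ | ⟨rfl, rfl⟩) | (⟨rfl, rfl⟩ | ⟨rfl, rfl⟩) | h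
    · exact m.he _ _ hab
    · exact m.he _ _ hab.symm
    · exact m.he _ _ hbc
    · exact m.he _ _ hbc.symm
    · exact m.he _ _ hcd
    · exact m.he _ _ hcd.symm
    · exact m.he _ _ hda
    · exact m.he _ _ hda.symm
    · exact h.elim)
  have hS' : bd F (S + 1) = ch (ι a :: (ι b :: [ι c, ι d] ++ [ι a])) := by rw [bd_add_one m.sph, hS]
  by_cases h1 : ∀ v, X1 F ι (S + 1) v
  · exact ⟨S + 1, hS', h1⟩
  by_cases h2 : ∀ v, X1 F ι S v
  · exact ⟨S, hS, h2⟩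
  exfalso
  have key : ∀ (T : Finset X → ZMod 2) (χ : V → Fin 4), bd F T = ch (ι a :: (ι b :: [ι c, ι d] ++ [ι a])) →
      (∀ u v, KS G F ι T u v → χ u ≠ χ v) → χ a ≠ χ b ∧ χ b ≠ χ c ∧ χ c ≠ χ d ∧ χ d ≠ χ a := by
    intro T φ hS hφ
    exact ⟨hφ _ _ (m.KS_cyc (by simp) hnd hS hab (by simp [pe])), hφ _ _ (m.KS_cyc (by simp) hnd hS hbc (by simp [pe])),
      hφ _ _ (m.KS_cyc (by simp) hnd hS hcd (by simp [pe])), hφ _ _ (m.KS_cyc (by simp) hnd hS hda (by simp [pe]))⟩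
  have no : ∀ p q, (∃ φ : V → Fin 4, (∀ u v, KS G F ι S u v → φ u ≠ φ v) ∧ (φ a = φ c ↔ p) ∧ (φ b = φ d ↔ q)) →
      (∃ φ : V → Fin 4, (∀ u v, KS G F ι (S + 1) u v → φ u ≠ φ v) ∧ (φ a = φ c ↔ p) ∧ (φ b = φ d ↔ q)) → False := by
    rintro p q ⟨φ, hφ, e1, e2⟩ ⟨ψ, hψ, e3, e4⟩
    obtain ⟨p1, p2, p3, p4⟩ := key S φ hS hφ
    obtain ⟨q1, q2, q3, q4⟩ := key _ ψ hS' hψ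
    have d1 : ψ a = ψ c ↔ φ a = φ c := by rw [e1, e3]
    have d2 : ψ b = ψ d ↔ φ b = φ d := by rw [e2, e4]
    refine m.glue hS hφ hψ ?_
    intro u v hu hv
    simp only [List.mem_cons, m.inj.eq_iff, List.not_mem_nil, or_false] at hu hv
    rcases hu with rfl | rfl | rfl | rfl <;> rcases hv with rfl | rfl | rfl | rfl <;>
      first
      | exact d1
      | exact d2
      | exact eq_comm.trans (d1.trans eq_comm)
      | exact eq_comm.trans (d2.trans eq_comm)
      | simp [p1, p2, p3, p4, q1, q2, q3, q4, p1.symm, p2.symm, p3.symm, p4.symm, q1.symm, q2.symm, q3.symm, q4.symm]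
  have t1 := m.types hab hbc hcd hda hnd hS h2 (fun p q => ∃ φ : V → Fin 4,
    (∀ u v, KS G F ι S u v → φ u ≠ φ v) ∧ (φ a = φ c ↔ p) ∧ (φ b = φ d ↔ q)) (fun φ h => ⟨φ, h, Iff.rfl, Iff.rfl⟩)
  have t2 := m.types hab hbc hcd hda hnd hS' h1 (fun p q => ∃ φ : V → Fin 4,
    (∀ u v, KS G F ι (S + 1) u v → φ u ≠ φ v) ∧ (φ a = φ c ↔ p) ∧ (φ b = φ d ↔ q)) (fun φ h => ⟨φ, h, Iff.rfl, Iff.rfl⟩)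
  have n1 := no True False
  have n2 := no False True
  have n3 := no False False
  rcases t1 with ⟨x1, x2⟩ | ⟨x1, x2⟩
  · rcases t2 with ⟨y1, -⟩ | ⟨-, y | y⟩
    · exact n1 x1 y1
    · exact n1 x1 y
    · exact n2 x2 y
  · rcases t2 with ⟨y1, y2⟩ | ⟨y, -⟩
    · rcases x2 with x | x
      · exact n1 x y1
      · exact n2 x y2
    · exact n3 x1 y

lemma MC.exdiag (m : MC G F ι) {a b c d : V}
    (hab : G.Adj a b) (hbc : G.Adj b c) (hcd : G.Adj c d) (hda : G.Adj d a) (hac : a ≠ c) (hbd : b ≠ d) :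
    G.Adj a c ∨ G.Adj b d := by
  by_contra hcon
  push Not at hcon
  obtain ⟨n1, n2⟩ := hcon
  obtain ⟨hnd, S, hS, hR⟩ := m.four hab hbc hcd hda hac hbd
  apply m.mx b d hbd n2
  refine redraw m.sph S hnd hS ?_ ι m.inj ?_ _ ?_
  · obtain ⟨f, hf, -, h⟩ := (cyc_mem_face m.sph (by simp) hnd hS (v := ι a) (by simp)).2
    exact ⟨f, hf, h⟩
  · intro u
    obtain ⟨f, hf, h1, h2⟩ := hR u
    exact ⟨f, hf, h2, h1⟩
  · intro u v h
    rw [SimpleGraph.sup_adj, SimpleGraph.fromEdgeSet_adj] at h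
    rcases h with h | ⟨h, -⟩
    · left
      obtain ⟨-, f, hf, uf, vf⟩ := m.he u v h
      rcases zt (S f) with h0 | h0
      · have on : ∀ w, ι w ∈ f → ι w ∈ ι a :: ι b :: [ι c, ι d] := by
          intro w hw
          by_contra hc
          obtain ⟨g, hg, h1, h2⟩ := hR w
          have := off_const m.sph hS hc f hf g hg hw h1
          rw [h0, h2] at this
          exact zero_ne_one this
        have hu := on u uf
        have hv := on v vf
        have fin : pe (ι a :: (ι b :: [ι c, ι d] ++ [ι a])) (ι u) (ι v) → ∃ f ∈ F, S f = 1 ∧ ι u ∈ f ∧ ι v ∈ f := by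
          intro hp
          obtain ⟨-, f, hf, h1, h2, h3⟩ := m.KS_cyc (by simp) hnd hS h hp
          exact ⟨f, hf, h3, h1, h2⟩
        simp only [List.mem_cons, m.inj.eq_iff, List.not_mem_nil, or_false] at hu hv
        rcases hu with rfl | rfl | rfl | rfl <;> rcases hv with rfl | rfl | rfl | rfl <;>
          first
          | exact (h.ne rfl).elim
          | exact (n1 h).elim
          | exact (n2 h).elim
          | exact (n1 h.symm).elim
          | exact (n2 h.symm).elim
          | exact fin (by simp [pe])
      · exact ⟨f, hf, h0, uf, vf⟩
    · right
      rcases (by simpa using h : (u = b ∧ v = d) ∨ (u = d ∧ v = b)) with ⟨rfl, rfl⟩ | ⟨rfl, rfl⟩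
      · exact Or.inl ⟨rfl, rfl⟩
      · exact Or.inr ⟨rfl, rfl⟩

end fin

set_option linter.unusedSectionVars false
section fin
variable {V X : Type} [Fintype V] [DecidableEq V] [Fintype X] [DecidableEq X]
variable {G : SimpleGraph V} {F : Finset (Finset X)} {ι : V → X}

def tr (a b c : X) : X → X → ZMod 2 := ch (a :: (b :: [c] ++ [a]))

lemma tr_eq (a b c : X) : tr a b c = eg a b + eg b c + eg c a := by
  simp only [tr, ch, List.cons_append, List.nil_append]; abel

lemma tr_swap (a b c : X) : tr a b c = tr a c b := by
  rw [tr_eq, tr_eq, eg_swap a c, eg_swap c b, eg_swap b a]; abel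

lemma tr_rot (a b c : X) : tr a b c = tr b c a := by
  rw [tr_eq, tr_eq]; abel

lemma MC.off0 (m : MC G F ι) {S : Finset X → ZMod 2} {a b c w : V} (hS : bd F S = tr (ι a) (ι b) (ι c))
    (hE : ∀ v, X1 F ι (S + 1) v) (h1 : w ≠ a) (h2 : w ≠ b) (h3 : w ≠ c) : ∀ f ∈ F, ι w ∈ f → S f = 0 := by
  intro f hf hw
  obtain ⟨g, hg, g1, g2⟩ := hE w
  rw [off_const m.sph hS (by simp [m.inj.eq_iff, h1, h2, h3]) f hf g hg hw g1]
  exact s1.1 g2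

lemma tr_nd {a b c : X} (hab : a ≠ b) (hbc : b ≠ c) (hac : a ≠ c) : (a :: b :: [c]).Nodup := by
  simp [hab, hbc, hac]

lemma MC.disj (m : MC G F ι) {S T : Finset X → ZMod 2} {a c x y : V} (hac : a ≠ c) (hax : a ≠ x)
    (hcx : c ≠ x) (hay : a ≠ y) (hcy : c ≠ y) (hxy : x ≠ y)
    (hS : bd F S = tr (ι a) (ι c) (ι x)) (hT : bd F T = tr (ι a) (ι c) (ι y))
    (hES : ∀ v, X1 F ι (S + 1) v) (hET : ∀ v, X1 F ι (T + 1) v) : ∀ f ∈ F, S f * T f = 0 := by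
  have oS := m.off0 hS hES hay.symm hcy.symm hxy.symm
  have oT := m.off0 hT hET hax.symm hcx.symm hxy
  have off : ∀ w, (w = x ∨ w = y) → ∀ u, bd F (S * T) (ι w) u = 0 := by
    intro w hw u
    by_contra hc
    obtain ⟨f, hf, g, hg, -, h1, -, h2, -, -, h3⟩ := m.sph.edge (bd_ed hc)
    apply hc
    rw [h3, Pi.mul_apply, Pi.mul_apply]
    rcases hw with rfl | rfl
    · rw [oT f hf h1, oT g hg h2, mul_zero, mul_zero, add_zero]
    · rw [oS f hf h1, oS g hg h2, zero_mul, zero_mul, add_zero]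
  have sup : ∀ u v, bd F (S * T) u v ≠ 0 → (u = ι a ∧ v = ι c) ∨ (u = ι c ∧ v = ι a) := by
    intro u v h
    have hux : u ≠ ι x := by rintro rfl; exact h (off x (Or.inl rfl) v)
    have huy : u ≠ ι y := by rintro rfl; exact h (off y (Or.inr rfl) v)
    have hvx : v ≠ ι x := by rintro rfl; rw [bd_symm] at h; exact h (off x (Or.inl rfl) u)
    have hvy : v ≠ ι y := by rintro rfl; rw [bd_symm] at h; exact h (off y (Or.inr rfl) u)
    by_contra hc
    have e0 : eg (ι a) (ι c) u v = 0 := if_neg hc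
    have e1 : bd F S u v = 0 := by
      rw [hS, tr_eq]
      simp only [Pi.add_apply]
      rw [e0, eg_symm (ι c), eg_symm (ι x)]
      simp [eg, hux, hvx]
    have e2 : bd F T u v = 0 := by
      rw [hT, tr_eq]
      simp only [Pi.add_apply]
      rw [e0]
      simp [eg, huy, hvy]
    obtain ⟨f, hf, g, hg, -, -, -, -, -, -, h3⟩ := m.sph.edge (bd_ed h)
    rw [h3] at e1 e2 h
    apply h
    simp only [Pi.mul_apply]
    rw [CharTwo.add_eq_zero.1 e1, CharTwo.add_eq_zero.1 e2, CharTwo.add_self_eq_zero]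
  have hne : ι a ≠ ι c := fun h => hac (m.inj h)
  have z : bd F (S * T) (ι a) (ι c) = 0 := by
    have := bd_even m.sph.card3 (S * T) (ι a)
    rwa [Finset.sum_eq_single (ι c)] at this
    · intro u _ hu
      by_contra hc
      rcases sup _ _ hc with h | h
      · exact hu h.2
      · exact hne h.1
    · simp
  have z0 : bd F (S * T) = 0 := by
    funext u v
    by_contra hc
    rcases sup u v hc with ⟨rfl, rfl⟩ | ⟨rfl, rfl⟩
    · exact hc z
    · rw [bd_symm] at hc; exact hc z
  intro f hf
  obtain ⟨g, hg, -, hg0⟩ := (cyc_mem_face m.sph (by simp) (tr_nd hne (fun h => hcx (m.inj h))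
    (fun h => hax (m.inj h))) hS (v := ι a) (by simp)).2
  have := m.sph.conn _ z0 f hf g hg
  rw [Pi.mul_apply, Pi.mul_apply, hg0, zero_mul] at this
  exact this

lemma MC.tri' (m : MC G F ι) {a b c : V} (hab : G.Adj a b) (hbc : G.Adj b c) (hac : G.Adj a c) :
    ∃ S, bd F S = tr (ι a) (ι b) (ι c) ∧ ∀ v, X1 F ι (S + 1) v := m.tri hab hbc hac

lemma MC.codeg (m : MC G F ι) {a c b d w : V} (hac : G.Adj a c) (ab : G.Adj a b) (cb : G.Adj c b)
    (ad : G.Adj a d) (cd : G.Adj c d) (aw : G.Adj a w) (cw : G.Adj c w) (hbd : b ≠ d) (hwb : w ≠ b) (hwd : w ≠ d) :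
    False := by
  obtain ⟨S1, h1, e1⟩ := m.tri' hac cb ab
  obtain ⟨S2, h2, e2⟩ := m.tri' hac cd ad
  obtain ⟨S3, h3, e3⟩ := m.tri' hac cw aw
  have d12 := m.disj hac.ne ab.ne cb.ne ad.ne cd.ne hbd h1 h2 e1 e2
  have d13 := m.disj hac.ne ab.ne cb.ne aw.ne cw.ne hwb.symm h1 h3 e1 e3
  have d23 := m.disj hac.ne ad.ne cd.ne aw.ne cw.ne hwd.symm h2 h3 e2 e3
  obtain ⟨f, hf, g, hg, -, -, -, -, -, -, hB⟩ := m.sph.edge (m.he _ _ hac)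
  have one : ∀ x, a ≠ x → c ≠ x → tr (ι a) (ι c) (ι x) (ι a) (ι c) = 1 := by
    intro x h1 h2
    rw [tr_eq]
    simp [eg, m.inj.eq_iff, h1, h2, hac.ne, hac.ne.symm]
  have b1 := hB S1
  have b2 := hB S2
  have b3 := hB S3
  rw [h1, one b ab.ne cb.ne] at b1
  rw [h2, one d ad.ne cd.ne] at b2
  rw [h3, one w aw.ne cw.ne] at b3
  have f12 := d12 f hf
  have f13 := d13 f hf
  have f23 := d23 f hf
  have g12 := d12 g hg
  have g13 := d13 g hg
  have g23 := d23 g hg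
  revert b1 b2 b3 f12 f13 f23 g12 g13 g23
  generalize S1 f = x1
  generalize S2 f = x2
  generalize S3 f = x3
  generalize S1 g = y1
  generalize S2 g = y2
  generalize S3 g = y3
  revert x1 x2 x3 y1 y2 y3
  decide

lemma MC.noK4 (m : MC G F ι) {a b c d w : V} (ab : G.Adj a b) (ac : G.Adj a c) (ad : G.Adj a d)
    (bc : G.Adj b c) (bd' : G.Adj b d) (cd : G.Adj c d) (wa : w ≠ a) (wb : w ≠ b) (wc : w ≠ c) (wd : w ≠ d) :
    False := by
  obtain ⟨S1, h1, e1⟩ := m.tri' ab bc ac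
  obtain ⟨S2, h2, e2⟩ := m.tri' ab bd' ad
  obtain ⟨S3, h3, e3⟩ := m.tri' ac cd ad
  obtain ⟨S4, h4, e4⟩ := m.tri' bc cd bd'
  have d2 := m.disj ab.ne ac.ne bc.ne ad.ne bd'.ne cd.ne h1 h2 e1 e2
  have d3 := m.disj ac.ne ab.ne bc.ne.symm ad.ne cd.ne bd'.ne (by rw [h1, tr_swap]) h3 e1 e3
  have d4 := m.disj bc.ne ab.ne.symm ac.ne.symm bd'.ne cd.ne ad.ne (by rw [h1, tr_rot]) h4 e1 e4
  have hne : ∀ {u v}, G.Adj u v → ι u ≠ ι v := fun h h' => h.ne (m.inj h')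
  have z : bd F (S1 + S2 + S3 + S4) = 0 := by
    rw [bd_add, bd_add, bd_add, h1, h2, h3, h4, tr_eq, tr_eq, tr_eq, tr_eq, eg_swap (ι c) (ι a),
      eg_swap (ι d) (ι b)]
    funext u v
    simp only [Pi.add_apply, Pi.zero_apply]
    generalize eg (ι a) (ι b) u v = x1
    generalize eg (ι b) (ι c) u v = x2
    generalize eg (ι a) (ι c) u v = x3
    generalize eg (ι b) (ι d) u v = x4
    generalize eg (ι d) (ι a) u v = x5
    generalize eg (ι c) (ι d) u v = x6
    revert x1 x2 x3 x4 x5 x6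
    decide
  obtain ⟨f, hf, wf, -⟩ := e1 w
  obtain ⟨g, hg, -, g1⟩ := (cyc_mem_face m.sph (by simp) (tr_nd (hne ab) (hne bc) (hne ac)) h1 (v := ι a) (by simp)).1
  have := m.sph.conn _ z f hf g hg
  have q2 := d2 g hg
  have q3 := d3 g hg
  have q4 := d4 g hg
  rw [g1, one_mul] at q2 q3 q4
  simp only [Pi.add_apply] at this
  rw [m.off0 h1 e1 wa wb wc f hf wf, m.off0 h2 e2 wa wb wd f hf wf, m.off0 h3 e3 wa wc wd f hf wf,
    m.off0 h4 e4 wb wc wd f hf wf, g1, q2, q3, q4] at this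
  simp at this

end fin

lemma ext_max {W : Type} [Fintype W] (H : SimpleGraph W) (h : IsPlanar H) : ∃ H', H ≤ H' ∧ IsMaximalPlanar H' := by
  classical
  obtain ⟨K, hle, hmax⟩ := (Set.toFinite {K : SimpleGraph W | IsPlanar K}).exists_le_maximal h
  refine ⟨K, hle, hmax.prop, ?_⟩
  intro u v huv hadj hp
  apply hadj
  apply hmax.le_of_ge hp le_sup_left
  rw [SimpleGraph.sup_adj, SimpleGraph.fromEdgeSet_adj]
  exact Or.inr ⟨rfl, huv⟩

theorem stmt_16 {V : Type} [Fintype V] (EP : SimpleGraph V)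
    (hEP : IsMinCounterexample EP)
    (a b c d : V)
    (hab : EP.Adj a b) (hbc : EP.Adj b c) (hcd : EP.Adj c d) (hda : EP.Adj d a)
    (hac : a ≠ c) (hbd : b ≠ d) :
    Xor' (EP.Adj a c) (EP.Adj b d) ∧
    (EP.Adj a c → ∀ w : V, EP.Adj a w → EP.Adj c w → w = b ∨ w = d) ∧
    (EP.Adj b d → ∀ w : V, EP.Adj b w → EP.Adj d w → w = a ∨ w = c) := by
  classical
  obtain ⟨⟨hpl, hmx⟩, hnc, hmin⟩ := hEP
  haveI : Nonempty V := ⟨a⟩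
  obtain ⟨F, hF, he⟩ := sphere_exists hpl
  have m : MC EP F (Sum.inl : V → V ⊕ Fin 3) :=
    { sph := hF
      inj := Sum.inl_injective
      he := he
      nc := hnc
      pl := hpl
      mn := by
        intro W _ H hH hlt
        by_contra hc
        obtain ⟨H', hle, hm⟩ := ext_max H hH
        have := hmin W H' hm (fun h => hc (h.mono_left hle))
        omega
      mx := hmx }
  have ex := m.exdiag hab hbc hcd hda hac hbd
  obtain ⟨w, wa, wb, wc, wd⟩ : ∃ w, w ≠ a ∧ w ≠ b ∧ w ≠ c ∧ w ≠ d := by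
    by_contra hcon
    apply hnc
    have h4 : Fintype.card V ≤ 4 := by
      rw [← Finset.card_univ]
      refine (Finset.card_le_card (t := {a, b, c, d}) ?_).trans Finset.card_le_four
      intro w _
      simp only [Finset.mem_insert, Finset.mem_singleton]
      by_contra hw
      exact hcon ⟨w, by tauto⟩
    exact EP.colorable_of_fintype.mono h4
  refine ⟨?_, ?_, ?_⟩
  · rcases ex with h | h
    · exact Or.inl ⟨h, fun h' => m.noK4 hab h hda.symm hbc h' hcd wa wb wc wd⟩
    · exact Or.inr ⟨h, fun h' => m.noK4 hab h' hda.symm hbc h hcd wa wb wc wd⟩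
  · intro h w h1 h2
    by_contra hw
    rw [not_or] at hw
    exact m.codeg h hab hbc.symm hda.symm hcd h1 h2 hbd hw.1 hw.2
  · intro h w h1 h2
    by_contra hw
    rw [not_or] at hw
    exact m.codeg h hab.symm hda hbc hcd.symm h1 h2 hac hw.1 hw.2
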